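/- Let Σ be a complete connected translating graph in a direction v_θ = sin θ·e₃ + cos θ·e₂ (θ ∈ [0,π)), contained in the slab {(x,y,z) : |x| ≤ w}, w > 0. Then there exist a real number t₀ > 0 and positive integers ω⁺ and ω⁻ such that for every t ≥ t₀ the number of connected components of Σ ∩ {y ≥ t} equals ω⁺ and the number of connected components of Σ ∩ {y ≤ −t} equals ω⁻. In particular these numbers of components are finite and at least 1 for all t ≥ t₀. -/

import Mathlib

open MeasureTheory Metric Real EuclideanSpace
open scoped RealInnerProductSpace ENNReal NNReal

noncomputable section

abbrev E3 : Type := EuclideanSpace ℝ (Fin 3)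

def e1 : E3 := EuclideanSpace.single 0 1
def e2 : E3 := EuclideanSpace.single 1 1
def e3 : E3 := EuclideanSpace.single 2 1

/-- First partial derivative of `u` in the first variable. -/
def pds (u : ℝ × ℝ → ℝ) (p : ℝ × ℝ) : ℝ := fderiv ℝ u p (1, 0)

/-- First partial derivative of `u` in the second variable. -/
def pdt (u : ℝ × ℝ → ℝ) (p : ℝ × ℝ) : ℝ := fderiv ℝ u p (0, 1)

/-- `S` is a translating graph in the direction of the unit vector `v`, with respect to the
orthonormal basis `(a, b, v)` of `ℝ³`, over the open connected domain `Ω ⊆ ℝ²`, given by the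
smooth function `u : Ω → ℝ` solving the translator equation. -/
structure IsTranslatingGraph (a b v : E3) (Ω : Set (ℝ × ℝ)) (u : ℝ × ℝ → ℝ)
    (S : Set E3) : Prop where
  norm_a : ‖a‖ = 1
  norm_b : ‖b‖ = 1
  norm_v : ‖v‖ = 1
  inner_ab : ⟪a, b⟫ = 0
  inner_av : ⟪a, v⟫ = 0
  inner_bv : ⟪b, v⟫ = 0
  isOpen_dom : IsOpen Ω
  isConnected_dom : IsConnected Ω
  smooth : ContDiffOn ℝ (⊤ : ℕ∞) u Ω
  pde : ∀ p ∈ Ω,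
    (1 + (pdt u p) ^ 2) * pds (fun q => pds u q) p
      - 2 * pds u p * pdt u p * pdt (fun q => pds u q) p
      + (1 + (pds u p) ^ 2) * pdt (fun q => pdt u q) p
    = (1 + (pds u p) ^ 2 + (pdt u p) ^ 2) *
        (⟪e3, v⟫ - pds u p * ⟪e3, a⟫ - pdt u p * ⟪e3, b⟫)
  graph_eq : S = {q : E3 | ∃ p ∈ Ω, q = p.1 • a + p.2 • b + u p • v}

/-- Entropy of a surface. -/
def entropy (S : Set E3) : ℝ≥0∞ :=
  ⨆ (x₀ : E3) (s₀ : ℝ) (_ : 0 < s₀),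
    (ENNReal.ofReal (4 * π * s₀))⁻¹ *
      ∫⁻ q in S, ENNReal.ofReal (Real.exp (-‖q - x₀‖ ^ 2 / (4 * s₀))) ∂(μH[2])

/-- Number of connected components (as a cardinal). -/
def numComponents (A : Set E3) : Cardinal := Cardinal.mk (ConnectedComponents A)

def vθ (θ : ℝ) : E3 := Real.sin θ • e3 + Real.cos θ • e2
def bθ (θ : ℝ) : E3 := Real.cos θ • e3 - Real.sin θ • e2


/-- The point of the translating graph over parameter `p`, for the basis `(e₁, b_θ, v_θ)`. -/
def graphPtθ (θ : ℝ) (u : ℝ × ℝ → ℝ) (p : ℝ × ℝ) : E3 :=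
  p.1 • e1 + p.2 • bθ θ + u p • vθ θ

/-- The Gauss map of a translating graph in the direction `v_θ`, as a function of the
parameter `p ∈ Ω`: `N = (v_θ − u_s e₁ − u_t b_θ)/√(1+u_s²+u_t²)`. -/
def gaussMapθ (θ : ℝ) (u : ℝ × ℝ → ℝ) (p : ℝ × ℝ) : E3 :=
  (Real.sqrt (1 + (pds u p) ^ 2 + (pdt u p) ^ 2))⁻¹ •
    (vθ θ - pds u p • e1 - pdt u p • bθ θ)

open scoped Topology

/-- Euclidean inner product of triples of real numbers. -/
def dot3 (a b : ℝ × ℝ × ℝ) : ℝ := a.1 * b.1 + a.2.1 * b.2.1 + a.2.2 * b.2.2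

/-- The graph parametrization of `u`. -/
def graph3 (u : ℝ × ℝ → ℝ) (p : ℝ × ℝ) : ℝ × ℝ × ℝ := (p.1, p.2, u p)

/-- A linear combination of exponentials of linear forms plus a linear form. -/
def expSum (L : List (ℝ × (ℝ × ℝ × ℝ))) (l P : ℝ × ℝ × ℝ) : ℝ :=
  (L.map fun a => a.1 * Real.exp (dot3 a.2 P)).sum + dot3 l P

/-- The drift Laplacian (with drift `e`) of `expSum L l` along a surface with mean curvature
vector `e^⊥` at a point `P` with unit normal `N`. -/
def driftLap (e N : ℝ × ℝ × ℝ) (L : List (ℝ × (ℝ × ℝ × ℝ))) (l P : ℝ × ℝ × ℝ) : ℝ :=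
  (L.map fun a => a.1 * Real.exp (dot3 a.2 P) *
    (dot3 a.2 a.2 - dot3 a.2 N ^ 2 + dot3 e a.2)).sum + dot3 e l

/-- Multiply the coefficients of a list of exponentials by `r`. -/
def scaleList (r : ℝ) (L : List (ℝ × (ℝ × ℝ × ℝ))) : List (ℝ × (ℝ × ℝ × ℝ)) :=
  L.map fun a => (r * a.1, a.2)

lemma expSum_scaleList (r : ℝ) (L : List (ℝ × (ℝ × ℝ × ℝ))) (l P : ℝ × ℝ × ℝ) :
    expSum (scaleList r L) l P = r * expSum L 0 P + dot3 l P := by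
  simp only [expSum, scaleList, List.map_map, Function.comp_def, mul_assoc, List.sum_map_mul_left]
  simp [dot3]

lemma driftLap_scaleList (e N : ℝ × ℝ × ℝ) (r : ℝ) (L : List (ℝ × (ℝ × ℝ × ℝ)))
    (l P : ℝ × ℝ × ℝ) :
    driftLap e N (scaleList r L) l P = r * driftLap e N L 0 P + dot3 e l := by
  simp only [driftLap, scaleList, List.map_map, Function.comp_def, mul_assoc,
    List.sum_map_mul_left]
  simp [dot3]

lemma expSum_append (L L' : List (ℝ × (ℝ × ℝ × ℝ))) (l P : ℝ × ℝ × ℝ) :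
    expSum (L ++ L') l P = expSum L l P + expSum L' 0 P := by
  simp only [expSum, List.map_append, List.sum_append]
  simp [dot3]; ring

lemma driftLap_append (e N : ℝ × ℝ × ℝ) (L L' : List (ℝ × (ℝ × ℝ × ℝ))) (l P : ℝ × ℝ × ℝ) :
    driftLap e N (L ++ L') l P = driftLap e N L l P + driftLap e N L' 0 P := by
  simp only [driftLap, List.map_append, List.sum_append]
  simp [dot3]; ring

lemma continuous_dot3 (l : ℝ × ℝ × ℝ) : Continuous (dot3 l) := by
  unfold dot3; fun_prop

lemma continuous_expSum (L : List (ℝ × (ℝ × ℝ × ℝ))) (l : ℝ × ℝ × ℝ) :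
    Continuous (expSum L l) := by
  induction L with
  | nil =>
    have : expSum [] l = dot3 l := by funext P; simp [expSum]
    exact this ▸ continuous_dot3 l
  | cons a L ih =>
    have : expSum (a :: L) l = fun P => a.1 * Real.exp (dot3 a.2 P) + expSum L l P := by
      funext P; simp [expSum]; ring
    rw [this]
    exact (continuous_const.mul (Real.continuous_exp.comp (continuous_dot3 _))).add ih

lemma continuous_driftLap (e : ℝ × ℝ × ℝ) (L : List (ℝ × (ℝ × ℝ × ℝ))) (l : ℝ × ℝ × ℝ) :
    Continuous fun z : (ℝ × ℝ × ℝ) × (ℝ × ℝ × ℝ) => driftLap e z.1 L l z.2 := by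
  induction L with
  | nil => simpa [driftLap] using continuous_const
  | cons a L ih =>
    have : (fun z : (ℝ × ℝ × ℝ) × (ℝ × ℝ × ℝ) => driftLap e z.1 (a :: L) l z.2) =
        fun z => a.1 * Real.exp (dot3 a.2 z.2) *
          (dot3 a.2 a.2 - dot3 a.2 z.1 ^ 2 + dot3 e a.2) + driftLap e z.1 L l z.2 := by
      funext z; simp [driftLap]; ring
    rw [this]
    refine Continuous.add ?_ ih
    have h1 := (continuous_dot3 a.2).comp
      (continuous_fst : Continuous fun z : (ℝ × ℝ × ℝ) × (ℝ × ℝ × ℝ) => z.1)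
    have h2 := (continuous_dot3 a.2).comp
      (continuous_snd : Continuous fun z : (ℝ × ℝ × ℝ) × (ℝ × ℝ × ℝ) => z.2)
    simp only [Function.comp_def] at h1 h2
    fun_prop

/-- The properties of a complete translating graph in a slab which follow from the translator
equation through the maximum principle: the graph of `u` over `Ω` is closed, and `max_le` is the
second order condition at a local maximum of a function on the graph. -/
structure SlabSoliton (e : ℝ × ℝ × ℝ) (w : ℝ) (Ω : Set (ℝ × ℝ)) (u : ℝ × ℝ → ℝ)
    (n : ℝ × ℝ → ℝ × ℝ × ℝ) : Prop where
  isOpen : IsOpen Ω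
  isConnected : IsConnected Ω
  abs_fst_le : ∀ p ∈ Ω, |p.1| ≤ w
  continuousOn : ContinuousOn u Ω
  isClosed : IsClosed {P : ℝ × ℝ × ℝ | (P.1, P.2.1) ∈ Ω ∧ u (P.1, P.2.1) = P.2.2}
  fst_dir : e.1 = 0
  dot_dir : dot3 e e = 1
  dot_normal : ∀ p ∈ Ω, dot3 (n p) (n p) = 1
  max_le : ∀ (L : List (ℝ × (ℝ × ℝ × ℝ))) (l : ℝ × ℝ × ℝ), ∀ p ∈ Ω,
    IsLocalMax (fun q => expSum L l (graph3 u q)) p → driftLap e (n p) L l (graph3 u p) ≤ 0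

namespace SlabSoliton

variable {e : ℝ × ℝ × ℝ} {w : ℝ} {Ω : Set (ℝ × ℝ)} {u : ℝ × ℝ → ℝ} {n : ℝ × ℝ → ℝ × ℝ × ℝ}

lemma continuousOn_graph3 (H : SlabSoliton e w Ω u n) : ContinuousOn (graph3 u) Ω :=
  continuousOn_fst.prodMk (continuousOn_snd.prodMk H.continuousOn)

lemma continuousOn_dot (H : SlabSoliton e w Ω u n) (l : ℝ × ℝ × ℝ) :
    ContinuousOn (fun p => dot3 l (graph3 u p)) Ω :=
  (continuous_dot3 l).comp_continuousOn H.continuousOn_graph3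

lemma isCompact_of_bdd (H : SlabSoliton e w Ω u n) {X : Set (ℝ × ℝ)} (hX : X ⊆ Ω)
    (hcl : ∀ p ∈ Ω, p ∈ closure X → p ∈ X) {R : ℝ} (hR : ∀ p ∈ X, |p.2| ≤ R ∧ |u p| ≤ R) :
    IsCompact X := by
  have himg : X = (fun P : ℝ × ℝ × ℝ => (P.1, P.2.1)) '' (graph3 u '' X) := by
    rw [Set.image_image]; simp [graph3]
  have hproj : Continuous fun P : ℝ × ℝ × ℝ => (P.1, P.2.1) := by fun_prop
  rw [himg]
  refine IsCompact.image ?_ hproj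
  refine Metric.isCompact_of_isClosed_isBounded ?_ ?_
  · refine isClosed_of_closure_subset fun P hP => ?_
    have hPS : P ∈ {P : ℝ × ℝ × ℝ | (P.1, P.2.1) ∈ Ω ∧ u (P.1, P.2.1) = P.2.2} := by
      refine closure_minimal ?_ H.isClosed hP
      rintro _ ⟨p, hp, rfl⟩
      exact ⟨hX hp, rfl⟩
    refine ⟨(P.1, P.2.1), hcl _ hPS.1 ?_, ?_⟩
    · rw [himg]
      exact image_closure_subset_closure_image hproj ⟨P, hP, rfl⟩
    · simp [graph3, hPS.2]
  · refine (isCompact_Icc (a := ((-w, -R, -R) : ℝ × ℝ × ℝ)) (b := (w, R, R))).isBounded.subset ?_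
    rintro _ ⟨p, hp, rfl⟩
    have h1 := abs_le.1 (H.abs_fst_le p (hX hp))
    have h2 := abs_le.1 (hR p hp).1
    have h3 := abs_le.1 (hR p hp).2
    exact ⟨⟨h1.1, h2.1, h3.1⟩, ⟨h1.2, h2.2, h3.2⟩⟩

/-- A point of the closure of a subset of `Ω` on which `u` is bounded belongs to `Ω`. -/
lemma mem_of_mem_closure (H : SlabSoliton e w Ω u n) {X : Set (ℝ × ℝ)} (hX : X ⊆ Ω) {R : ℝ}
    (hR : ∀ p ∈ X, |u p| ≤ R) {p : ℝ × ℝ} (hp : p ∈ closure X) : p ∈ Ω := by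
  have hc : IsCompact {q | q ∈ Ω ∧ |q.2| ≤ |p.2| + 1 ∧ |u q| ≤ R} := by
    refine H.isCompact_of_bdd (R := max (|p.2| + 1) R) (fun q hq => hq.1) ?_ fun q hq =>
      ⟨hq.2.1.trans (le_max_left _ _), hq.2.2.trans (le_max_right _ _)⟩
    intro q hq hqc
    refine ⟨hq, ?_, ?_⟩
    · exact closure_minimal (fun q hq => hq.2.1 : _ ⊆ {q : ℝ × ℝ | |q.2| ≤ |p.2| + 1})
        (isClosed_le (by fun_prop) continuous_const) hqc
    · have h1 : (𝓝[{q | q ∈ Ω ∧ |q.2| ≤ |p.2| + 1 ∧ |u q| ≤ R}] q).NeBot :=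
        mem_closure_iff_nhdsWithin_neBot.1 hqc
      have h2 : Filter.Tendsto (fun x => |u x|)
          (𝓝[{q | q ∈ Ω ∧ |q.2| ≤ |p.2| + 1 ∧ |u q| ≤ R}] q) (𝓝 |u q|) :=
        ((H.continuousOn q hq).mono (fun q hq => hq.1)).tendsto.abs
      exact le_of_tendsto h2 (Filter.eventually_of_mem self_mem_nhdsWithin fun x hx => hx.2.2)
  have hsub : X ∩ {q : ℝ × ℝ | |q.2| < |p.2| + 1} ⊆
      {q | q ∈ Ω ∧ |q.2| ≤ |p.2| + 1 ∧ |u q| ≤ R} := fun q hq => ⟨hX hq.1, le_of_lt hq.2, hR q hq.1⟩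
  have hop : IsOpen {q : ℝ × ℝ | |q.2| < |p.2| + 1} := isOpen_lt (by fun_prop) continuous_const
  have : p ∈ closure (X ∩ {q : ℝ × ℝ | |q.2| < |p.2| + 1}) := by
    rw [Set.inter_comm]
    exact hop.inter_closure ⟨by simp, hp⟩
  exact (closure_minimal hsub hc.isClosed this).1

end SlabSoliton

lemma mem_connectedComponentIn_of_mem_closure {α : Type*} [TopologicalSpace α] {F : Set α}
    {x y : α} (hx : x ∈ F) (hy : y ∈ F) (h : y ∈ closure (connectedComponentIn F x)) :
    y ∈ connectedComponentIn F x := by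
  have h1 : IsPreconnected (insert y (connectedComponentIn F x)) :=
    isPreconnected_connectedComponentIn.subset_closure (Set.subset_insert _ _)
      (Set.insert_subset h subset_closure)
  exact h1.subset_connectedComponentIn (Set.mem_insert_of_mem _ (mem_connectedComponentIn hx))
    (Set.insert_subset hy (connectedComponentIn_subset _ _)) (Set.mem_insert _ _)

lemma barrier_bracket {a d C b Nl Nq Nx el eq' s m M : ℝ} (hs : s = 1 ∨ s = -1)
    (hm : 0 < m) (ham : m ≤ a) (hdm : m ≤ d) (haM : a ≤ M) (hdM : d ≤ M) (hC : C = 2 * M + 1)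
    (hb : 0 < b) (hb1 : b ≤ 1) (hbm : b * (8 * M + 2) < m) (hN : Nl ^ 2 + Nx ^ 2 ≤ 1)
    (hlq : Nl ^ 2 + Nq ^ 2 ≤ 1) (hxq : Nx ^ 2 + Nq ^ 2 ≤ 1) (hel : 0 ≤ el)
    (heq : |eq'| ≤ 1) :
    C * (b ^ 2 - (s * b * Nq) ^ 2 + s * b * eq')
      - a * (1 + b ^ 2 - (Nl + s * b * Nq) ^ 2 + el + s * b * eq')
      - d * (1 + b ^ 2 - (Nx + s * b * Nq) ^ 2 + s * b * eq') < 0 := by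
  have hse : |s * eq'| ≤ 1 := by rcases hs with rfl | rfl <;> simpa using heq
  have hse' := abs_le.1 hse
  have hs2 : s ^ 2 = 1 := by rcases hs with rfl | rfl <;> norm_num
  have k1 : |s * (2 * Nl * Nq)| ≤ 1 := by
    rw [abs_le]; rcases hs with rfl | rfl <;> constructor <;>
      nlinarith [sq_nonneg (Nl + Nq), sq_nonneg (Nl - Nq)]
  have k2 : |s * (2 * Nx * Nq)| ≤ 1 := by
    rw [abs_le]; rcases hs with rfl | rfl <;> constructor <;>
      nlinarith [sq_nonneg (Nx + Nq), sq_nonneg (Nx - Nq)]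
  have k1' := abs_le.1 k1
  have k2' := abs_le.1 k2
  have hM : 0 < M := by linarith
  have t1 : b ^ 2 - (s * b * Nq) ^ 2 + s * b * eq' ≤ 2 * b := by
    have : s * b * eq' ≤ b := by linarith [mul_le_mul_of_nonneg_left hse'.2 hb.le]
    have h2 : b ^ 2 ≤ b := by nlinarith
    linarith [sq_nonneg (s * b * Nq)]
  have t2 : 1 - Nl ^ 2 - 2 * b ≤ 1 + b ^ 2 - (Nl + s * b * Nq) ^ 2 + el + s * b * eq' := by
    have h1 : -b ≤ s * b * eq' := by linarith [mul_le_mul_of_nonneg_left hse'.1 hb.le]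
    have h2 : b * (s * (2 * Nl * Nq)) ≤ b := by linarith [mul_le_mul_of_nonneg_left k1'.2 hb.le]
    have h3 : (s * b * Nq) ^ 2 ≤ b ^ 2 := by
      have : (s * b * Nq) ^ 2 = b ^ 2 * Nq ^ 2 := by rw [mul_pow, mul_pow, hs2]; ring
      rw [this]; nlinarith [sq_nonneg Nl, sq_nonneg b]
    have h4 : (Nl + s * b * Nq) ^ 2 = Nl ^ 2 + b * (s * (2 * Nl * Nq)) + (s * b * Nq) ^ 2 := by ring
    linarith
  have t3 : 1 - Nx ^ 2 - 2 * b ≤ 1 + b ^ 2 - (Nx + s * b * Nq) ^ 2 + s * b * eq' := by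
    have h1 : -b ≤ s * b * eq' := by linarith [mul_le_mul_of_nonneg_left hse'.1 hb.le]
    have h2 : b * (s * (2 * Nx * Nq)) ≤ b := by linarith [mul_le_mul_of_nonneg_left k2'.2 hb.le]
    have h3 : (s * b * Nq) ^ 2 ≤ b ^ 2 := by
      have : (s * b * Nq) ^ 2 = b ^ 2 * Nq ^ 2 := by rw [mul_pow, mul_pow, hs2]; ring
      rw [this]; nlinarith [sq_nonneg Nx, sq_nonneg b]
    have h4 : (Nx + s * b * Nq) ^ 2 = Nx ^ 2 + b * (s * (2 * Nx * Nq)) + (s * b * Nq) ^ 2 := by ring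
    linarith
  have u1 := mul_le_mul_of_nonneg_left t1 (by linarith : 0 ≤ C)
  have u2 := mul_le_mul_of_nonneg_left t2 (by linarith : 0 ≤ a)
  have u3 := mul_le_mul_of_nonneg_left t3 (by linarith : 0 ≤ d)
  have v1 : m * (1 - Nl ^ 2) ≤ a * (1 - Nl ^ 2) :=
    mul_le_mul_of_nonneg_right ham (by nlinarith [sq_nonneg Nx])
  have v2 : m * (1 - Nx ^ 2) ≤ d * (1 - Nx ^ 2) :=
    mul_le_mul_of_nonneg_right hdm (by nlinarith [sq_nonneg Nl])
  have v3 : m * (Nl ^ 2 + Nx ^ 2) ≤ m := by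
    simpa using mul_le_mul_of_nonneg_left hN hm.le
  have v4 : b * a ≤ b * M := mul_le_mul_of_nonneg_left haM hb.le
  have v5 : b * d ≤ b * M := mul_le_mul_of_nonneg_left hdM hb.le
  subst hC
  linarith

lemma sq_dot_le {α β x y : ℝ} (h : α ^ 2 + β ^ 2 = 1) : (α * x + β * y) ^ 2 ≤ x ^ 2 + y ^ 2 := by
  nlinarith [sq_nonneg (α * y - β * x), sq_nonneg x, sq_nonneg y]

/-- A strict supersolution on the part of a slab where the linear function `α t + β u` is bounded,
growing exponentially in the orthogonal direction. -/
lemma exists_barrier {e : ℝ × ℝ × ℝ} (he : e.1 = 0) (hee : dot3 e e = 1) {α β : ℝ}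
    (hαβ : α ^ 2 + β ^ 2 = 1) (hpos : 0 ≤ e.2.1 * α + e.2.2 * β) (R : ℝ) :
    ∃ b : ℝ, 0 < b ∧ ∃ L : List (ℝ × (ℝ × ℝ × ℝ)), ∀ P : ℝ × ℝ × ℝ, |P.1| ≤ R →
      |α * P.2.1 + β * P.2.2| ≤ R →
      Real.cosh (b * (α * P.2.2 - β * P.2.1)) ≤ expSum L 0 P ∧
      ∀ N : ℝ × ℝ × ℝ, dot3 N N = 1 → driftLap e N L 0 P < 0 := by
  obtain ⟨e1, e2, e3⟩ := e
  simp only [dot3] at he hee hpos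
  subst he
  set m := Real.exp (-R) with hm
  set M := Real.exp R with hM
  have hm0 : 0 < m := Real.exp_pos _
  have hM0 : 0 < M := Real.exp_pos _
  set b := min 1 (m / (2 * (8 * M + 2))) with hb
  have hb0 : 0 < b := by positivity
  have hb1 : b ≤ 1 := min_le_left _ _
  have hbm : b * (8 * M + 2) < m := by
    have : b ≤ m / (2 * (8 * M + 2)) := min_le_right _ _
    rw [le_div_iff₀ (by positivity)] at this
    nlinarith
  refine ⟨b, hb0, [((2 * M + 1) / 2, (0, -b * β, b * α)), ((2 * M + 1) / 2, (0, b * β, -b * α)),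
    (-1 / 2, (0, α - b * β, β + b * α)), (-1 / 2, (0, α + b * β, β - b * α)),
    (-1 / 2, (1, -b * β, b * α)), (-1 / 2, (1, b * β, -b * α))], ?_⟩
  rintro ⟨x, y, z⟩ hx hX
  simp only at hx hX
  set X := α * y + β * z with hXdef
  set Q := b * (α * z - β * y) with hQdef
  have hx' := abs_le.1 hx
  have hX' := abs_le.1 hX
  have haM : Real.exp X ≤ M := Real.exp_le_exp.2 hX'.2
  have ham : m ≤ Real.exp X := Real.exp_le_exp.2 hX'.1
  have hdM : Real.exp x ≤ M := Real.exp_le_exp.2 hx'.2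
  have hdm : m ≤ Real.exp x := Real.exp_le_exp.2 hx'.1
  have q1 : 0 * x + -b * β * y + b * α * z = Q := by rw [hQdef]; ring
  have q2 : 0 * x + b * β * y + -b * α * z = -Q := by rw [hQdef]; ring
  have q3 : 0 * x + (α - b * β) * y + (β + b * α) * z = X + Q := by rw [hQdef, hXdef]; ring
  have q4 : 0 * x + (α + b * β) * y + (β - b * α) * z = X + -Q := by rw [hQdef, hXdef]; ring
  have q5 : 1 * x + -b * β * y + b * α * z = x + Q := by rw [hQdef]; ring
  have q6 : 1 * x + b * β * y + -b * α * z = x + -Q := by rw [hQdef]; ring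
  have hE1 := Real.exp_pos Q
  have hE2 := Real.exp_pos (-Q)
  constructor
  · simp only [expSum, dot3, List.map_cons, List.map_nil, List.sum_cons, List.sum_nil, q1, q2, q3,
      q4, q5, q6, Real.cosh_eq]
    simp only [Real.exp_add, Prod.fst_zero, Prod.snd_zero, zero_mul, add_zero]
    have h1 : 0 ≤ (Real.exp Q + Real.exp (-Q)) * (2 * M - Real.exp X - Real.exp x) :=
      mul_nonneg (by linarith) (by linarith)
    linarith
  · rintro ⟨N1, N2, N3⟩ hN
    simp only [dot3] at hN
    have hl := sq_dot_le (x := N2) (y := N3) hαβ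
    have hq : (α * N3 - β * N2) ^ 2 ≤ N2 ^ 2 + N3 ^ 2 := by
      nlinarith [sq_nonneg (α * N2 + β * N3)]
    have hlq : (α * N2 + β * N3) ^ 2 + (α * N3 - β * N2) ^ 2 = N2 ^ 2 + N3 ^ 2 := by
      linear_combination (N2 ^ 2 + N3 ^ 2) * hαβ
    have heq : |α * e3 - β * e2| ≤ 1 := by
      rw [abs_le_one_iff_mul_self_le_one]
      nlinarith [sq_nonneg (α * e2 + β * e3)]
    have B := fun s hs => barrier_bracket (a := Real.exp X) (d := Real.exp x) (b := b)
      (Nl := α * N2 + β * N3) (Nq := α * N3 - β * N2) (Nx := N1) (el := e2 * α + e3 * β)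
      (eq' := α * e3 - β * e2) (s := s) hs hm0 ham hdm haM hdM rfl hb0 hb1 hbm
      (by linarith only [hN, hl]) (by linarith only [hN, hlq, sq_nonneg N1])
      (by linarith only [hN, hq]) (by simpa using hpos) heq
    have B1 := mul_neg_of_pos_of_neg hE1 (B 1 (Or.inl rfl))
    have B2 := mul_neg_of_pos_of_neg hE2 (B (-1) (Or.inr rfl))
    have g1 : 0 * 0 + -b * β * (-b * β) + b * α * (b * α) = b ^ 2 := by
      linear_combination b ^ 2 * hαβ
    have g2 : 0 * 0 + b * β * (b * β) + -b * α * (-b * α) = b ^ 2 := by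
      linear_combination b ^ 2 * hαβ
    have g3 : 0 * 0 + (α - b * β) * (α - b * β) + (β + b * α) * (β + b * α) = 1 + b ^ 2 := by
      linear_combination (1 + b ^ 2) * hαβ
    have g4 : 0 * 0 + (α + b * β) * (α + b * β) + (β - b * α) * (β - b * α) = 1 + b ^ 2 := by
      linear_combination (1 + b ^ 2) * hαβ
    have g5 : 1 * 1 + -b * β * (-b * β) + b * α * (b * α) = 1 + b ^ 2 := by
      linear_combination b ^ 2 * hαβ
    have g6 : 1 * 1 + b * β * (b * β) + -b * α * (-b * α) = 1 + b ^ 2 := by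
      linear_combination b ^ 2 * hαβ
    simp only [driftLap, dot3, List.map_cons, List.map_nil, List.sum_cons, List.sum_nil, q1, q2, q3,
      q4, q5, q6, g1, g2, g3, g4, g5, g6]
    simp only [Real.exp_add, Prod.fst_zero, Prod.snd_zero, mul_zero, add_zero]
    generalize Real.exp Q = E at *
    generalize Real.exp (-Q) = E' at *
    generalize Real.exp X = A at *
    generalize Real.exp x = D at *
    clear hbm ham hdm haM hdM hl hq hlq heq hN B g1 g2 g3 g4 g5 g6 q1 q2 q3 q4 q5 q6
    linarith only [B1, B2]

/-- In a compact set, a connected component contained in an open set can be separated from the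
complement of the open set. -/
lemma IsCompact.exists_separation_component {X : Type*} [TopologicalSpace X] [T2Space X]
    {Z V : Set X} (hZ : IsCompact Z) (hV : IsOpen V) {x : X} (hx : x ∈ Z)
    (hxV : connectedComponentIn Z x ⊆ V) :
    ∃ A B : Set X, IsCompact A ∧ IsCompact B ∧ A ∪ B = Z ∧ Disjoint A B ∧ x ∈ A ∧ A ⊆ V := by
  have : CompactSpace Z := isCompact_iff_compactSpace.1 hZ
  have hU : IsOpen ((↑) ⁻¹' V : Set Z) := hV.preimage continuous_subtype_val
  have hsub : connectedComponent (⟨x, hx⟩ : Z) ⊆ (↑) ⁻¹' V := by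
    rw [← Set.image_subset_iff, ← connectedComponentIn_eq_image hx]; exact hxV
  rw [connectedComponent_eq_iInter_isClopen] at hsub
  have : Nonempty {s : Set Z // IsClopen s ∧ (⟨x, hx⟩ : Z) ∈ s} :=
    ⟨⟨Set.univ, isClopen_univ, Set.mem_univ _⟩⟩
  obtain ⟨⟨s, hs, hxs⟩, hsV⟩ := exists_subset_nhds_of_compactSpace
    (V := fun s : {s : Set Z // IsClopen s ∧ (⟨x, hx⟩ : Z) ∈ s} => (s : Set Z))
    (fun a b => ⟨⟨a.1 ∩ b.1, a.2.1.inter b.2.1, a.2.2, b.2.2⟩, Set.inter_subset_left,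
      Set.inter_subset_right⟩) (fun s => s.2.1.1) (fun y hy => hU.mem_nhds (hsub hy))
  refine ⟨(↑) '' s, (↑) '' sᶜ, hs.1.isCompact.image continuous_subtype_val,
    hs.compl.1.isCompact.image continuous_subtype_val, ?_, ?_, ⟨_, hxs, rfl⟩, ?_⟩
  · rw [← Set.image_union, Set.union_compl_self, Set.image_univ, Subtype.range_coe]
  · exact (Set.disjoint_image_iff Subtype.val_injective).2 disjoint_compl_right
  · exact Set.image_subset_iff.2 hsV

/-- The part of the graph of `u` where the linear function `m` exceeds `c`. -/
def superlevel (Ω : Set (ℝ × ℝ)) (u : ℝ × ℝ → ℝ) (m : ℝ × ℝ × ℝ) (c : ℝ) : Set (ℝ × ℝ) :=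
  {p ∈ Ω | c < dot3 m (graph3 u p)}

lemma superlevel_anti {Ω : Set (ℝ × ℝ)} {u : ℝ × ℝ → ℝ} {m : ℝ × ℝ × ℝ} {c c' : ℝ} (h : c ≤ c') :
    superlevel Ω u m c' ⊆ superlevel Ω u m c := fun _ hp => ⟨hp.1, h.trans_lt hp.2⟩

lemma one_add_sq_div_two_le_cosh (x : ℝ) : 1 + x ^ 2 / 2 ≤ Real.cosh x := by
  have h1 : Real.cosh x = 1 + 2 * Real.sinh |x / 2| ^ 2 := by
    have h2 : x = 2 * (x / 2) := by ring
    have h3 : Real.sinh |x / 2| ^ 2 = Real.sinh (x / 2) ^ 2 := by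
      rw [Real.sinh_sq, Real.cosh_abs, Real.sinh_sq]
    rw [h3]
    conv_lhs => rw [h2, Real.cosh_two_mul, Real.cosh_sq]
    ring
  have h4 : |x / 2| ≤ Real.sinh |x / 2| := Real.self_le_sinh_iff.2 (abs_nonneg _)
  have h5 : |x / 2| ^ 2 = x ^ 2 / 4 := by rw [sq_abs]; ring
  nlinarith [abs_nonneg (x / 2)]

lemma abs_le_of_cosh_le {b x K : ℝ} (hb : 0 < b) (h : Real.cosh (b * x) ≤ K) :
    |x| ≤ K / b := by
  have h1 : |b * x| ≤ Real.cosh (b * x) := by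
    rw [← Real.cosh_abs]
    have h4 : |b * x| ≤ Real.sinh |b * x| := Real.self_le_sinh_iff.2 (abs_nonneg _)
    linarith [Real.sinh_lt_cosh |b * x|]
  rw [abs_mul, abs_of_pos hb] at h1
  rw [le_div_iff₀ hb, mul_comm]
  exact h1.trans h

lemma abs_le_of_rotation {α β a b R S : ℝ} (h : α ^ 2 + β ^ 2 = 1) (h1 : |α * a + β * b| ≤ R)
    (h2 : |α * b - β * a| ≤ S) : |a| ≤ R + S ∧ |b| ≤ R + S := by
  have hα : |α| ≤ 1 := abs_le_one_iff_mul_self_le_one.2 (by nlinarith [sq_nonneg β])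
  have hβ : |β| ≤ 1 := abs_le_one_iff_mul_self_le_one.2 (by nlinarith [sq_nonneg α])
  have ea : a = α * (α * a + β * b) - β * (α * b - β * a) := by linear_combination -a * h
  have eb : b = β * (α * a + β * b) + α * (α * b - β * a) := by linear_combination -b * h
  have k : ∀ x y R : ℝ, |x| ≤ 1 → |y| ≤ R → |x * y| ≤ R := fun x y R hx hy => by
    rw [abs_mul]; nlinarith [abs_nonneg x, abs_nonneg y]
  constructor
  · rw [ea]
    exact (abs_sub _ _).trans (add_le_add (k _ _ _ hα h1) (k _ _ _ hβ h2))
  · rw [eb]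
    exact (abs_add_le _ _).trans (add_le_add (k _ _ _ hβ h1) (k _ _ _ hα h2))

namespace SlabSoliton

variable {e : ℝ × ℝ × ℝ} {w : ℝ} {Ω : Set (ℝ × ℝ)} {u : ℝ × ℝ → ℝ} {n : ℝ × ℝ → ℝ × ℝ × ℝ}
  {m : ℝ × ℝ × ℝ}

lemma isOpen_superlevel (H : SlabSoliton e w Ω u n) (m : ℝ × ℝ × ℝ) (c : ℝ) :
    IsOpen (superlevel Ω u m c) :=
  (H.continuousOn_dot m).isOpen_inter_preimage H.isOpen isOpen_Ioi

lemma isLocalMax_false (H : SlabSoliton e w Ω u n) (hem : dot3 e m = 0)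
    {L : List (ℝ × (ℝ × ℝ × ℝ))} {ε : ℝ} (hε : 0 < ε) {p : ℝ × ℝ} (hp : p ∈ Ω)
    (hL : driftLap e (n p) L 0 (graph3 u p) < 0)
    (hmax : IsLocalMax (fun q => dot3 m (graph3 u q) - ε * expSum L 0 (graph3 u q)) p) : False := by
  have h := H.max_le (scaleList (-ε) L) m p hp (by
    simp only [expSum_scaleList]
    refine hmax.congr ?_
    filter_upwards with q
    ring)
  rw [driftLap_scaleList, hem] at h
  nlinarith

lemma growth_aux {A B ε b q : ℝ} (hε : 0 < ε) (hb : 0 < b)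
    (h : B ≤ A + |q| - ε * Real.cosh (b * q)) : |q| ≤ 1 + 2 * (|A - B| + 1) / (ε * b ^ 2) := by
  by_contra! hq
  have h1 : 1 + (b * q) ^ 2 / 2 ≤ Real.cosh (b * q) := one_add_sq_div_two_le_cosh _
  have h2 : 1 < |q| := lt_of_le_of_lt (le_add_of_nonneg_right (by positivity)) hq
  have h3 : 2 * (|A - B| + 1) < |q| * (ε * b ^ 2) := by
    rw [← div_lt_iff₀ (by positivity)]; linarith
  have h4 : (b * q) ^ 2 = b ^ 2 * |q| ^ 2 := by rw [mul_pow, sq_abs]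
  have h5 : |q| * (2 * (|A - B| + 1)) < |q| * (|q| * (ε * b ^ 2)) :=
    mul_lt_mul_of_pos_left h3 (by linarith)
  have h6 : ε * (1 + (b * q) ^ 2 / 2) ≤ ε * Real.cosh (b * q) :=
    mul_le_mul_of_nonneg_left h1 hε.le
  rw [h4] at h6
  have h7 := le_abs_self (A - B)
  have h8 : |A - B| ≤ |q| * |A - B| := by nlinarith [abs_nonneg (A - B)]
  nlinarith

/-- Maximum principle on the (unbounded) components of superlevel sets of the linear function
`m`, which is harmonic for the drift Laplacian. -/
lemma not_bounded_component (H : SlabSoliton e w Ω u n) (hem : dot3 e m = 0) {α β : ℝ}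
    (hαβ : α ^ 2 + β ^ 2 = 1) (hpos : 0 ≤ e.2.1 * α + e.2.2 * β) {R c : ℝ} {p₀ : ℝ × ℝ}
    (hp₀ : p₀ ∈ superlevel Ω u m c)
    (hB : ∀ p ∈ connectedComponentIn (superlevel Ω u m c) p₀, |α * p.2 + β * u p| ≤ R ∧
      dot3 m (graph3 u p) ≤ R + |α * u p - β * p.2|) : False := by
  obtain ⟨b, hb, L, hL⟩ := exists_barrier H.fst_dir H.dot_dir hαβ hpos (max R w)
  set D := connectedComponentIn (superlevel Ω u m c) p₀ with hD
  have hDs : D ⊆ superlevel Ω u m c := connectedComponentIn_subset _ _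
  have hDΩ : D ⊆ Ω := fun p hp => (hDs hp).1
  have hDo : IsOpen D := (H.isOpen_superlevel m c).connectedComponentIn
  have hp₀D : p₀ ∈ D := mem_connectedComponentIn hp₀
  set Y : ℝ × ℝ → ℝ := fun p => dot3 m (graph3 u p) with hY
  set h : ℝ × ℝ → ℝ := fun p => expSum L 0 (graph3 u p) with hh
  have hLD : ∀ p ∈ D, Real.cosh (b * (α * u p - β * p.2)) ≤ h p ∧
      driftLap e (n p) L 0 (graph3 u p) < 0 := fun p hp => by
    obtain ⟨h1, h2⟩ := hL (graph3 u p) ((H.abs_fst_le p (hDΩ hp)).trans (le_max_right _ _))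
      ((hB p hp).1.trans (le_max_left _ _))
    exact ⟨h1, h2 _ (H.dot_normal p (hDΩ hp))⟩
  have hh1 : ∀ p ∈ D, 1 ≤ h p := fun p hp => (Real.one_le_cosh _).trans (hLD p hp).1
  set ε := (Y p₀ - c) / (2 * h p₀) with hε
  have hh0 := hh1 p₀ hp₀D
  have hYc : c < Y p₀ := hp₀.2
  have hε0 : 0 < ε := div_pos (by linarith) (by linarith)
  have hεh : ε * h p₀ = (Y p₀ - c) / 2 := by rw [hε]; field_simp
  set F : ℝ × ℝ → ℝ := fun p => Y p - ε * h p with hF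
  have hYcont : ContinuousOn Y Ω := H.continuousOn_dot m
  have hFcont : ContinuousOn F Ω := hYcont.sub (continuousOn_const.mul
    ((continuous_expSum L 0).comp_continuousOn H.continuousOn_graph3))
  set K := {p ∈ D | F p₀ ≤ F p} with hK
  have hF0 : c < F p₀ := by simp only [hF]; linarith
  have hKc : IsCompact K := by
    refine H.isCompact_of_bdd
      (R := R + (1 + 2 * (|R - F p₀| + 1) / (ε * b ^ 2))) (fun p hp => hDΩ hp.1) ?_ ?_
    · intro p hp hpK
      have h1 : F p₀ ≤ F p := continuousWithinAt_const.closure_le hpK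
        ((hFcont p hp).mono fun q hq => hDΩ hq.1) fun q hq => hq.2
      have h2 : F p₀ ≤ Y p := continuousWithinAt_const.closure_le hpK
        ((hYcont p hp).mono fun q hq => hDΩ hq.1) fun q hq =>
          hq.2.trans (sub_le_self _ (mul_nonneg hε0.le (zero_le_one.trans (hh1 q hq.1))))
      exact ⟨mem_connectedComponentIn_of_mem_closure hp₀ ⟨hp, hF0.trans_le h2⟩
        (closure_mono (fun q hq => hq.1) hpK), h1⟩
    · intro p hp
      refine abs_le_of_rotation hαβ (hB p hp.1).1 (growth_aux hε0 hb ?_)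
      have h1 := mul_le_mul_of_nonneg_left (hLD p hp.1).1 hε0.le
      have h2 : Y p ≤ _ := (hB p hp.1).2
      have h3 : F p₀ ≤ Y p - ε * h p := hp.2
      linarith
  obtain ⟨p₁, hp₁, hmax⟩ := hKc.exists_isMaxOn ⟨p₀, hp₀D, le_refl _⟩
    (hFcont.mono fun p hp => hDΩ hp.1)
  refine H.isLocalMax_false hem hε0 (hDΩ hp₁.1) (hLD p₁ hp₁.1).2 ?_
  filter_upwards [hDo.mem_nhds hp₁.1] with p hp
  by_cases hpK : F p₀ ≤ F p
  · exact hmax (⟨hp, hpK⟩ : p ∈ K)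
  · exact (not_le.1 hpK).le.trans hp₁.2

lemma exists_lt_dot (H : SlabSoliton e w Ω u n) (hem : dot3 e m = 0) (hm1 : m.1 = 0)
    (hmm : dot3 m m = 1) {c : ℝ} {p₀ : ℝ × ℝ} (hp₀ : p₀ ∈ superlevel Ω u m c) (M : ℝ) :
    ∃ p ∈ connectedComponentIn (superlevel Ω u m c) p₀, M < dot3 m (graph3 u p) := by
  by_contra! hcon
  refine H.not_bounded_component hem (α := m.2.1) (β := m.2.2) (R := max |c| |M|) ?_ ?_ hp₀ ?_
  · simp only [dot3, hm1] at hmm; linarith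
  · simp only [dot3, hm1] at hem; linarith
  · intro p hp
    have h1 : c < dot3 m (graph3 u p) := (connectedComponentIn_subset _ _ hp).2
    have h2 := hcon p hp
    have h3 : m.2.1 * p.2 + m.2.2 * u p = dot3 m (graph3 u p) := by simp [dot3, graph3, hm1]
    have h4 : |dot3 m (graph3 u p)| ≤ max |c| |M| := by
      rw [abs_le]
      constructor
      · linarith [neg_abs_le c, le_max_left |c| |M|]
      · exact h2.trans ((le_abs_self M).trans (le_max_right _ _))
    exact ⟨h3 ▸ h4, (le_abs_self _).trans (h4.trans (le_add_of_nonneg_right (abs_nonneg _)))⟩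

lemma exists_lt_abs_snd (H : SlabSoliton e w Ω u n) (hem : dot3 e m = 0) (hm1 : m.1 = 0)
    (hmm : dot3 m m = 1) {c : ℝ} {p₀ : ℝ × ℝ} (hp₀ : p₀ ∈ superlevel Ω u m c) (R : ℝ) :
    ∃ p ∈ connectedComponentIn (superlevel Ω u m c) p₀, R < |p.2| := by
  by_contra! hcon
  obtain ⟨α, hα, hα'⟩ : ∃ α : ℝ, (α = 1 ∨ α = -1) ∧ 0 ≤ e.2.1 * α := by
    rcases le_total 0 e.2.1 with h | h
    · exact ⟨1, Or.inl rfl, by linarith⟩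
    · exact ⟨-1, Or.inr rfl, by linarith⟩
  have hα1 : |α| = 1 := by rcases hα with rfl | rfl <;> simp
  refine H.not_bounded_component hem (α := α) (β := 0) (R := R) ?_ ?_ hp₀ ?_
  · rw [← sq_abs, hα1]; norm_num
  · simpa using hα'
  · intro p hp
    have h1 := hcon p hp
    simp only [dot3, hm1] at hmm
    have h2 : |m.2.1| ≤ 1 := abs_le_one_iff_mul_self_le_one.2 (by nlinarith [sq_nonneg m.2.2])
    have h3 : |m.2.2| ≤ 1 := abs_le_one_iff_mul_self_le_one.2 (by nlinarith [sq_nonneg m.2.1])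
    refine ⟨by simpa [abs_mul, hα1] using h1, ?_⟩
    have h4 : dot3 m (graph3 u p) = m.2.1 * p.2 + m.2.2 * u p := by simp [dot3, graph3, hm1]
    have h5 : |m.2.1 * p.2| ≤ |p.2| := by rw [abs_mul]; nlinarith [abs_nonneg p.2]
    have h6 : |m.2.2 * u p| ≤ |u p| := by rw [abs_mul]; nlinarith [abs_nonneg (u p)]
    rw [h4, zero_mul, sub_zero, abs_mul, hα1, one_mul]
    linarith [le_abs_self (m.2.1 * p.2), le_abs_self (m.2.2 * u p)]

/-- A component of `{m ≥ c}` has points with `m > c` arbitrarily close to it. -/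
lemma component_not_subset (H : SlabSoliton e w Ω u n) (hem : dot3 e m = 0) (hm1 : m.1 = 0)
    (hmm : dot3 m m = 1) {c : ℝ} {p₀ : ℝ × ℝ} (hp₀ : p₀ ∈ Ω) (hc : dot3 m (graph3 u p₀) = c)
    {V : Set (ℝ × ℝ)} (hV : IsOpen V) (hVc : ∀ p ∈ V, p ∈ Ω → dot3 m (graph3 u p) ≤ c)
    (hsub : connectedComponentIn {p ∈ Ω | c ≤ dot3 m (graph3 u p)} p₀ ⊆ V) : False := by
  have hαβ : m.2.1 ^ 2 + m.2.2 ^ 2 = 1 := by simp only [dot3, hm1] at hmm; linarith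
  have hpos : 0 ≤ e.2.1 * m.2.1 + e.2.2 * m.2.2 := by simp only [dot3, hm1] at hem; linarith
  obtain ⟨b, hb, L, hL⟩ := exists_barrier H.fst_dir H.dot_dir hαβ hpos (max (|c| + 1) w)
  set Y : ℝ × ℝ → ℝ := fun p => dot3 m (graph3 u p) with hY
  set h : ℝ × ℝ → ℝ := fun p => expSum L 0 (graph3 u p) with hh
  have hYcont : ContinuousOn Y Ω := H.continuousOn_dot m
  have hhcont : ContinuousOn h Ω :=
    (continuous_expSum L 0).comp_continuousOn H.continuousOn_graph3
  have hYeq : ∀ p, m.2.1 * p.2 + m.2.2 * u p = Y p := fun p => by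
    simp [hY, dot3, graph3, hm1]
  have hLD : ∀ p ∈ Ω, |Y p| ≤ |c| + 1 → Real.cosh (b * (m.2.1 * u p - m.2.2 * p.2)) ≤ h p ∧
      driftLap e (n p) L 0 (graph3 u p) < 0 := fun p hp hpY => by
    obtain ⟨h1, h2⟩ := hL (graph3 u p) ((H.abs_fst_le p hp).trans (le_max_right _ _))
      (by rw [show m.2.1 * (graph3 u p).2.1 + m.2.2 * (graph3 u p).2.2 = Y p from hYeq p]
          exact hpY.trans (le_max_left _ _))
    exact ⟨h1, h2 _ (H.dot_normal p hp)⟩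
  have habs : ∀ p, c - 1 ≤ Y p → Y p ≤ c + 1 → |Y p| ≤ |c| + 1 := fun p h1 h2 => by
    rw [abs_le]; constructor <;> linarith [neg_abs_le c, le_abs_self c]
  set Z := {p ∈ Ω | c ≤ Y p ∧ Y p ≤ c + 1 ∧ h p ≤ h p₀} with hZdef
  have hZ : IsCompact Z := by
    refine H.isCompact_of_bdd (R := |c| + 1 + h p₀ / b) (fun p hp => hp.1) ?_ ?_
    · intro p hp hpZ
      refine ⟨hp, ?_, ?_, ?_⟩
      · exact continuousWithinAt_const.closure_le hpZ
          ((hYcont p hp).mono fun q hq => hq.1) fun q hq => hq.2.1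
      · exact ((hYcont p hp).mono fun q hq => hq.1).closure_le hpZ continuousWithinAt_const
          fun q hq => hq.2.2.1
      · exact ((hhcont p hp).mono fun q hq => hq.1).closure_le hpZ continuousWithinAt_const
          fun q hq => hq.2.2.2
    · intro p hp
      have h1 := habs p (by linarith [hp.2.1]) hp.2.2.1
      exact abs_le_of_rotation hαβ (by rw [hYeq]; exact h1)
        (abs_le_of_cosh_le hb ((hLD p hp.1 h1).1.trans hp.2.2.2))
  have hp₀Z : p₀ ∈ Z := ⟨hp₀, hc.ge, by linarith [hc.le], le_refl _⟩
  have hZsub : Z ⊆ {p ∈ Ω | c ≤ dot3 m (graph3 u p)} := fun p hp => ⟨hp.1, hp.2.1⟩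
  obtain ⟨A, B, hA, hBc, hAB, hdisj, hp₀A, hAV⟩ := hZ.exists_separation_component hV hp₀Z
    ((connectedComponentIn_mono p₀ hZsub).trans hsub)
  obtain ⟨W, hWo, hAW, hWsub, hWc⟩ := exists_open_between_and_isCompact_closure hA
    ((hV.inter hBc.isClosed.isOpen_compl).inter (H.isOpen_superlevel m (c - 1)))
    (fun p hp => ⟨⟨hAV hp, fun hpB => hdisj.le_bot ⟨hp, hpB⟩⟩, by
      have : p ∈ Z := hAB ▸ Or.inl hp
      exact ⟨this.1, by have := this.2.1; simp only [hY] at this; linarith⟩⟩)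
  have hWΩ : closure W ⊆ Ω := fun p hp => (hWsub hp).2.1
  have hWY : ∀ p ∈ closure W, Y p ≤ c := fun p hp => hVc p (hWsub hp).1.1 (hWΩ hp)
  have hWL : ∀ p ∈ closure W, Real.cosh (b * (m.2.1 * u p - m.2.2 * p.2)) ≤ h p ∧
      driftLap e (n p) L 0 (graph3 u p) < 0 := fun p hp =>
    hLD p (hWΩ hp) (habs p (hWsub hp).2.2.le (by linarith [hWY p hp]))
  have hWh : ∀ p ∈ closure W, 0 < h p := fun p hp =>
    (Real.cosh_pos _).trans_le (hWL p hp).1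
  have hp₀W : p₀ ∈ closure W := subset_closure (hAW hp₀A)
  have hE : ∀ p ∈ closure W \ W, h p ≤ h p₀ → Y p < c := by
    intro p hp hph
    refine lt_of_le_of_ne (hWY p hp.1) fun hpc => ?_
    have hpZ : p ∈ Z := ⟨hWΩ hp.1, hpc.ge, by linarith [hpc.le], hph⟩
    have : p ∈ A ∪ B := hAB ▸ hpZ
    rcases this with hpA | hpB
    · exact hp.2 (hAW hpA)
    · exact (hWsub hp.1).1.2 hpB
  obtain ⟨δ, hδ, hδE⟩ : ∃ δ : ℝ, 0 < δ ∧ ∀ p ∈ closure W \ W, h p ≤ h p₀ → Y p ≤ c - δ := by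
    have hEc : IsCompact ((closure W \ W) ∩ {p ∈ Ω | h p ≤ h p₀}) := by
      have h1 : IsCompact (closure W \ W) := hWc.diff hWo
      have h2 : IsClosed ((closure W \ W) ∩ {p ∈ Ω | h p ≤ h p₀}) := by
        have := (hhcont.mono (Set.sdiff_subset.trans hWΩ)).preimage_isClosed_of_isClosed
          h1.isClosed (isClosed_Iic (a := h p₀))
        convert this using 1
        ext p
        exact ⟨fun hp => ⟨hp.1, hp.2.2⟩, fun hp => ⟨hp.1, hWΩ hp.1.1, hp.2⟩⟩
      exact h1.of_isClosed_subset h2 Set.inter_subset_left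
    rcases Set.eq_empty_or_nonempty ((closure W \ W) ∩ {p ∈ Ω | h p ≤ h p₀}) with he | hne
    · refine ⟨1, one_pos, fun p hp hph => absurd he (Set.Nonempty.ne_empty ⟨p, hp, hWΩ hp.1, hph⟩)⟩
    · obtain ⟨q, hq, hqmax⟩ := hEc.exists_isMaxOn hne (hYcont.mono fun p hp => hp.2.1)
      refine ⟨c - Y q, by linarith [hE q hq.1 hq.2.2], fun p hp hph => ?_⟩
      have : Y p ≤ Y q := hqmax ⟨hp, hWΩ hp.1, hph⟩
      linarith
  have hh0 := hWh p₀ hp₀W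
  set ε := δ / (2 * h p₀) with hε
  have hε0 : 0 < ε := div_pos hδ (by linarith)
  have hεh : ε * h p₀ = δ / 2 := by rw [hε]; field_simp
  obtain ⟨p₁, hp₁, hmax⟩ := hWc.exists_isMaxOn ⟨p₀, hp₀W⟩
    (f := fun p => Y p - ε * h p) ((hYcont.mono hWΩ).sub (continuousOn_const.mul (hhcont.mono hWΩ)))
  have h1 : Y p₀ - ε * h p₀ ≤ Y p₁ - ε * h p₁ := hmax hp₀W
  have hY0 : Y p₀ = c := hc
  by_cases hp₁W : p₁ ∈ W
  · refine H.isLocalMax_false hem hε0 (hWΩ hp₁) (hWL p₁ hp₁).2 ?_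
    filter_upwards [hWo.mem_nhds hp₁W] with p hp
    exact hmax (subset_closure hp)
  · have h2 : h p₁ ≤ h p₀ := by
      by_contra! hlt
      nlinarith [hWY p₁ hp₁]
    have h3 := hδE p₁ ⟨hp₁, hp₁W⟩ h2
    have h4 := mul_pos hε0 (hWh p₁ hp₁)
    linarith

end SlabSoliton

lemma expSum_eq_of_vertical {L : List (ℝ × (ℝ × ℝ × ℝ))} {l : ℝ × ℝ × ℝ}
    (hL : ∀ a ∈ L, a.2.2.2 = 0) (hl : l.2.2 = 0) (P : ℝ × ℝ × ℝ) :
    expSum L l P = expSum L l (P.1, P.2.1, 0) := by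
  have h : ∀ a : ℝ × ℝ × ℝ, a.2.2 = 0 → dot3 a P = dot3 a (P.1, P.2.1, 0) := fun a ha => by
    simp [dot3, ha]
  simp only [expSum, h l hl]
  congr 2
  exact List.map_congr_left fun a ha => by rw [h _ (hL a ha)]

lemma driftLap_eq_of_vertical {L : List (ℝ × (ℝ × ℝ × ℝ))} (e N l : ℝ × ℝ × ℝ)
    (hL : ∀ a ∈ L, a.2.2.2 = 0) (P : ℝ × ℝ × ℝ) :
    driftLap e N L l P = driftLap e N L l (P.1, P.2.1, 0) := by
  have h : ∀ a : ℝ × ℝ × ℝ, a.2.2 = 0 → dot3 a P = dot3 a (P.1, P.2.1, 0) := fun a ha => by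
    simp [dot3, ha]
  simp only [driftLap]
  congr 2
  exact List.map_congr_left fun a ha => by rw [h _ (hL a ha)]

/-- `cosh (⟨a, P⟩ - c)` as a sum of exponentials. -/
def coshList (a : ℝ × ℝ × ℝ) (c : ℝ) : List (ℝ × (ℝ × ℝ × ℝ)) :=
  [(Real.exp (-c) / 2, a), (Real.exp c / 2, -a)]

lemma expSum_coshList (a P : ℝ × ℝ × ℝ) (c : ℝ) :
    expSum (coshList a c) 0 P = Real.cosh (dot3 a P - c) := by
  have h1 : dot3 (-a) P = -dot3 a P := by simp [dot3]; ring
  have h2 : dot3 0 P = 0 := by simp [dot3]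
  simp only [expSum, coshList, List.map_cons, List.map_nil, List.sum_cons, List.sum_nil, h1, h2,
    Real.cosh_eq]
  rw [show dot3 a P - c = -c + dot3 a P by ring, show -(-c + dot3 a P) = c + -dot3 a P by ring,
    Real.exp_add, Real.exp_add]
  ring

lemma driftLap_coshList_le {e N a P : ℝ × ℝ × ℝ} {c : ℝ} (haa : dot3 a a = 1)
    (hea : |dot3 e a| ≤ 1) (hP : |dot3 a P - c| ≤ 1) :
    driftLap e N (coshList a c) 0 P ≤ 6 := by
  have h1 : ∀ x, dot3 (-a) x = -dot3 a x := fun x => by simp [dot3]; ring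
  have h3 : ∀ x, dot3 x (-a) = -dot3 x a := fun x => by simp [dot3]; ring
  have h2 : dot3 e 0 = 0 := by simp [dot3]
  have hc := abs_le.1 hP
  have he := abs_le.1 hea
  simp only [driftLap, coshList, List.map_cons, List.map_nil, List.sum_cons, List.sum_nil, h1, h2,
    h3, haa]
  have e1 : Real.exp (-c) / 2 * Real.exp (dot3 a P) = Real.exp (dot3 a P - c) / 2 := by
    rw [show dot3 a P - c = -c + dot3 a P by ring, Real.exp_add]; ring
  have e2 : Real.exp c / 2 * Real.exp (-dot3 a P) = Real.exp (c - dot3 a P) / 2 := by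
    rw [show c - dot3 a P = c + -dot3 a P by ring, Real.exp_add]; ring
  have hb : ∀ x : ℝ, x ≤ 1 → Real.exp x ≤ 3 := fun x hx =>
    (Real.exp_le_exp.2 hx).trans (by linarith [Real.exp_one_lt_d9])
  rw [e1, e2]
  have b1 := hb (dot3 a P - c) hc.2
  have b2 := hb (c - dot3 a P) (by linarith)
  have p1 := Real.exp_pos (dot3 a P - c)
  have p2 := Real.exp_pos (c - dot3 a P)
  have s := sq_nonneg (dot3 a N)
  have k : ∀ x y : ℝ, 0 < x → x ≤ 3 → y ≤ 2 → x / 2 * y ≤ 3 := fun x y h h' h'' => by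
    nlinarith
  have := k _ (1 - dot3 a N ^ 2 + dot3 e a) p1 b1 (by linarith)
  have := k _ (1 - (-dot3 a N) ^ 2 + -dot3 e a) p2 b2 (by nlinarith)
  have e3 : -(-1 : ℝ) = 1 := by norm_num
  simp only [neg_neg] at *
  linarith

lemma isCompact_unit3 : IsCompact {N : ℝ × ℝ × ℝ | dot3 N N = 1} := by
  refine (isCompact_Icc (a := ((-1, -1, -1) : ℝ × ℝ × ℝ)) (b := (1, 1, 1))).of_isClosed_subset
    (isClosed_eq (by unfold dot3; fun_prop) continuous_const) fun N hN => ?_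
  simp only [dot3, Set.mem_ofPred_eq] at hN
  have k : ∀ x : ℝ, x * x ≤ 1 → -1 ≤ x ∧ x ≤ 1 := fun x hx =>
    abs_le.1 (abs_le_one_iff_mul_self_le_one.2 hx)
  have h1 := k N.1 (by nlinarith [sq_nonneg N.2.1, sq_nonneg N.2.2])
  have h2 := k N.2.1 (by nlinarith [sq_nonneg N.1, sq_nonneg N.2.2])
  have h3 := k N.2.2 (by nlinarith [sq_nonneg N.1, sq_nonneg N.2.1])
  exact ⟨⟨h1.1, h2.1, h3.1⟩, ⟨h1.2, h2.2, h3.2⟩⟩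

lemma exists_driftLap_ge {e l Q : ℝ × ℝ × ℝ} {L : List (ℝ × (ℝ × ℝ × ℝ))}
    (h : ∀ N, dot3 N N = 1 → 0 < driftLap e N L l Q) :
    ∃ m₀ : ℝ, 0 < m₀ ∧ ∀ᶠ P in 𝓝 Q, ∀ N, dot3 N N = 1 → m₀ < driftLap e N L l P := by
  obtain ⟨N₀, hN₀, hmin⟩ := isCompact_unit3.exists_isMinOn
    ⟨((1, 0, 0) : ℝ × ℝ × ℝ), by simp [dot3]⟩
    (f := fun N => driftLap e N L l Q) ((continuous_driftLap e L l).comp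
      (by fun_prop : Continuous fun N : ℝ × ℝ × ℝ => (N, Q))).continuousOn
  have h0 := h N₀ hN₀
  refine ⟨driftLap e N₀ L l Q / 2, by linarith, ?_⟩
  have hopen : IsOpen {z : (ℝ × ℝ × ℝ) × (ℝ × ℝ × ℝ) |
      driftLap e N₀ L l Q / 2 < driftLap e z.1 L l z.2} :=
    isOpen_lt continuous_const (continuous_driftLap e L l)
  obtain ⟨A, B, -, hB, hA, hQ, hAB⟩ := generalized_tube_lemma isCompact_unit3
    (isCompact_singleton (x := Q)) hopen (by
      rintro ⟨N, P⟩ ⟨hN, rfl⟩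
      have : driftLap e N₀ L l P ≤ driftLap e N L l P := hmin hN
      simp only [Set.mem_ofPred_eq]
      linarith)
  filter_upwards [hB.mem_nhds (hQ rfl)] with P hP N hN
  exact hAB (Set.mk_mem_prod (hA hN) hP)

namespace SlabSoliton

variable {e : ℝ × ℝ × ℝ} {w : ℝ} {Ω : Set (ℝ × ℝ)} {u : ℝ × ℝ → ℝ} {n : ℝ × ℝ → ℝ × ℝ × ℝ}

lemma exists_bound_of_lt_frontier (H : SlabSoliton e w Ω u n) {K : Set (ℝ × ℝ)}
    (hK : IsCompact K) {g : ℝ × ℝ → ℝ} (hg : Continuous g) {A : ℝ}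
    (h : ∀ p ∈ closure Ω \ Ω, p ∈ K → g p < A) :
    ∃ h₀ : ℝ, ∀ p ∈ Ω, p ∈ K → h₀ < |u p| → g p < A := by
  have hZ : IsCompact ((K ∩ closure Ω) ∩ {p | A ≤ g p}) :=
    (hK.inter_right isClosed_closure).inter_right (isClosed_le continuous_const hg)
  have hZΩ : (K ∩ closure Ω) ∩ {p | A ≤ g p} ⊆ Ω := fun p hp => by
    by_contra hpΩ
    exact absurd (h p ⟨hp.1.2, hpΩ⟩ hp.1.1) (not_lt.2 hp.2)
  obtain ⟨h₀, hh⟩ := hZ.bddAbove_image (f := fun p => |u p|) (H.continuousOn.mono hZΩ).abs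
  refine ⟨h₀, fun p hp hpK hlt => ?_⟩
  by_contra! hA
  exact absurd (hh ⟨p, ⟨⟨hpK, subset_closure hp⟩, hA⟩, rfl⟩) (not_le.2 hlt)

/-- The frontier of the domain is a barrier for the drift Laplacian: a function which is strictly
subharmonic on all planes has no local maximum on it. -/
lemma frontier_maximum_principle (H : SlabSoliton e w Ω u n) {L : List (ℝ × (ℝ × ℝ × ℝ))}
    {l : ℝ × ℝ × ℝ} (hL : ∀ a ∈ L, a.2.2.2 = 0) (hl : l.2.2 = 0) {q : ℝ × ℝ}
    (hq : q ∈ closure Ω \ Ω)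
    (hpos : ∀ N, dot3 N N = 1 → 0 < driftLap e N L l (q.1, q.2, 0))
    (hmax : ∀ᶠ p in 𝓝 q, p ∈ closure Ω \ Ω →
      expSum L l (p.1, p.2, 0) ≤ expSum L l (q.1, q.2, 0)) : False := by
  obtain ⟨m₀, hm₀, hev⟩ := exists_driftLap_ge hpos
  have hemb : Continuous fun p : ℝ × ℝ => ((p.1, p.2, 0) : ℝ × ℝ × ℝ) := by fun_prop
  obtain ⟨r', hr', hball⟩ := Metric.nhds_basis_closedBall.mem_iff.1
    (((hemb.tendsto q).eventually hev).and hmax)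
  obtain ⟨r, hr, hr1, hrr⟩ : ∃ r : ℝ, 0 < r ∧ r ≤ 1 ∧ r ≤ r' :=
    ⟨min 1 r', lt_min one_pos hr', min_le_left _ _, min_le_right _ _⟩
  have hdist : ∀ p : ℝ × ℝ, p ∈ closedBall q r ↔ |p.1 - q.1| ≤ r ∧ |p.2 - q.2| ≤ r := fun p => by
    rw [mem_closedBall, Prod.dist_eq, max_le_iff, Real.dist_eq, Real.dist_eq]
  have hb : ∀ p ∈ closedBall q r, (∀ N, dot3 N N = 1 → m₀ < driftLap e N L l (p.1, p.2, 0)) ∧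
      (p ∈ closure Ω \ Ω → expSum L l (p.1, p.2, 0) ≤ expSum L l (q.1, q.2, 0)) :=
    fun p hp => hball (closedBall_subset_closedBall hrr hp)
  set η := m₀ / 100 with hη
  have hη0 : 0 < η := by positivity
  have hcr : 1 < Real.cosh r := Real.one_lt_cosh.2 hr.ne'
  have hc1 : 1 < Real.cosh 1 := Real.one_lt_cosh.2 one_ne_zero
  have hc3 : Real.cosh 1 < 3 := by
    rw [Real.cosh_eq]
    have h1 := Real.exp_one_lt_d9
    have h2 : Real.exp (-1) ≤ 1 := Real.exp_le_one_iff.2 (by norm_num)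
    linarith
  obtain ⟨ε, hε0, hεη, hεr⟩ : ∃ ε : ℝ, 0 < ε ∧ ε ≤ η ∧ ε ≤ η * (Real.cosh r - 1) :=
    ⟨min η (η * (Real.cosh r - 1)), lt_min hη0 (mul_pos hη0 (by linarith)), min_le_left _ _,
      min_le_right _ _⟩
  set δ := ε * (Real.cosh 1 - 1) / 2 with hδ
  have hδ0 : 0 < δ := by
    have := mul_pos hε0 (sub_pos.2 hc1); positivity
  have hδε : δ < ε := by rw [hδ]; nlinarith
  set g : ℝ × ℝ → ℝ := fun p => expSum L l (p.1, p.2, 0) -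
    η * (Real.cosh (p.1 - q.1) + Real.cosh (p.2 - q.2)) with hg
  have hgc : Continuous g := by
    refine ((continuous_expSum L l).comp hemb).sub (continuous_const.mul ?_)
    exact (Real.continuous_cosh.comp (by fun_prop)).add (Real.continuous_cosh.comp (by fun_prop))
  set G := expSum L l (q.1, q.2, 0) - 2 * η with hG
  have hgq : g q = G := by simp [hg, hG]; ring
  obtain ⟨h₁, hh₁⟩ := H.exists_bound_of_lt_frontier (isCompact_closedBall q r) hgc (A := G + δ)
    fun p hp hpK => by
      have h1 := (hb p hpK).2 hp
      have h2 : η * 2 ≤ η * (Real.cosh (p.1 - q.1) + Real.cosh (p.2 - q.2)) :=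
        mul_le_mul_of_nonneg_left
          (by linarith [Real.one_le_cosh (p.1 - q.1), Real.one_le_cosh (p.2 - q.2)]) hη0.le
      simp only [hg, hG]; linarith
  obtain ⟨h₂, hh₂⟩ := H.exists_bound_of_lt_frontier (isCompact_sphere q r) hgc (A := G - δ)
    fun p hp hpK => by
      have h1 := (hb p (sphere_subset_closedBall hpK)).2 hp
      have h3 : max |p.1 - q.1| |p.2 - q.2| = r := by
        rw [← Real.dist_eq, ← Real.dist_eq, ← Prod.dist_eq]; exact hpK
      have h4 : 1 + Real.cosh r ≤ Real.cosh (p.1 - q.1) + Real.cosh (p.2 - q.2) := by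
        rcases max_choice |p.1 - q.1| |p.2 - q.2| with h5 | h5
        · rw [← Real.cosh_abs (p.1 - q.1), ← h5, h3]; linarith [Real.one_le_cosh (p.2 - q.2)]
        · rw [← Real.cosh_abs (p.2 - q.2), ← h5, h3]; linarith [Real.one_le_cosh (p.1 - q.1)]
      have h2 := mul_le_mul_of_nonneg_left h4 hη0.le
      simp only [hg, hG]; linarith
  obtain ⟨p₀, hp₀Ω, hp₀b, hp₀g, hp₀u⟩ : ∃ p ∈ Ω, p ∈ closedBall q r ∧ G - δ < g p ∧
      max h₁ h₂ + 1 < |u p| := by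
    by_contra! hcon
    have hnb : closedBall q r ∩ {p | G - δ < g p} ∈ 𝓝 q :=
      Filter.inter_mem (closedBall_mem_nhds q hr)
        ((isOpen_lt continuous_const hgc).mem_nhds (by simp only [Set.mem_ofPred_eq]; linarith))
    refine hq.2 (H.mem_of_mem_closure (X := Ω ∩ (closedBall q r ∩ {p | G - δ < g p}))
      Set.inter_subset_left (R := max h₁ h₂ + 1) (fun p hp => hcon p hp.1 hp.2.1 hp.2.2) ?_)
    exact (mem_closure_iff_nhdsWithin_neBot.2 (by
      have := mem_closure_iff_nhdsWithin_neBot.1 hq.1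
      rwa [nhdsWithin_inter_of_mem']
      exact mem_nhdsWithin_of_mem_nhds hnb))
  set h := u p₀ with hh
  set M := {p ∈ Ω | p ∈ closedBall q r ∧ |u p - h| ≤ 1} with hM
  have hucont : ContinuousOn (fun p => |u p - h|) Ω := (H.continuousOn.sub continuousOn_const).abs
  have hMc : IsCompact M := by
    refine H.isCompact_of_bdd (R := max (|q.2| + r) (|h| + 1)) (fun p hp => hp.1) ?_ ?_
    · intro p hp hpM
      refine ⟨hp, closure_minimal (fun q hq => hq.2.1) isClosed_closedBall hpM, ?_⟩
      exact ((hucont p hp).mono fun q hq => hq.1).closure_le hpM continuousWithinAt_const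
          fun q hq => hq.2.2
    · intro p hp
      have h1 := ((hdist p).1 hp.2.1).2
      have h2 := hp.2.2
      have h3 := abs_sub_abs_le_abs_sub p.2 q.2
      have h4 := abs_sub_abs_le_abs_sub (u p) h
      exact ⟨le_trans (by linarith) (le_max_left _ _), le_trans (by linarith) (le_max_right _ _)⟩
  have hMu : ∀ p ∈ M, max h₁ h₂ < |u p| := fun p hp => by
    have h2 := hp.2.2
    have h4 := abs_sub_abs_le_abs_sub h (u p)
    rw [abs_sub_comm] at h4
    linarith
  set F : ℝ × ℝ → ℝ := fun p => g p - ε * Real.cosh (u p - h) with hF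
  have hFc : ContinuousOn F Ω := hgc.continuousOn.sub (continuousOn_const.mul
    (Real.continuous_cosh.comp_continuousOn (H.continuousOn.sub continuousOn_const)))
  obtain ⟨p₁, hp₁, hp₁max⟩ := hMc.exists_isMaxOn ⟨p₀, hp₀Ω, hp₀b, by simp [hh]⟩
    (hFc.mono fun p hp => hp.1)
  have hF0 : g p₀ - ε ≤ F p₁ := by
    have : F p₀ ≤ F p₁ := hp₁max ⟨hp₀Ω, hp₀b, by simp [hh]⟩
    simpa [hF, hh] using this
  have hu1 : |u p₁ - h| < 1 := by
    refine lt_of_le_of_ne hp₁.2.2 fun heq => ?_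
    have h1 := hh₁ p₁ hp₁.1 hp₁.2.1 ((le_max_left _ _).trans_lt (hMu p₁ hp₁))
    have h2 : F p₁ = g p₁ - ε * Real.cosh 1 := by
      simp only [hF]; rw [← Real.cosh_abs, heq]
    linarith
  have hr1' : p₁ ∈ ball q r := by
    refine mem_ball.2 (lt_of_le_of_ne (mem_closedBall.1 hp₁.2.1) fun heq => ?_)
    have h1 := hh₂ p₁ hp₁.1 heq ((le_max_right _ _).trans_lt (hMu p₁ hp₁))
    have h2 : ε * 1 ≤ ε * Real.cosh (u p₁ - h) :=
      mul_le_mul_of_nonneg_left (Real.one_le_cosh _) hε0.le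
    have h3 : F p₁ = g p₁ - ε * Real.cosh (u p₁ - h) := rfl
    linarith
  have hd := (hdist p₁).1 hp₁.2.1
  have hloc : IsLocalMax (fun p => expSum (scaleList (-η) (coshList (1, 0, 0) q.1) ++
      (scaleList (-η) (coshList (0, 1, 0) q.2) ++
      (scaleList (-ε) (coshList (0, 0, 1) h) ++ L))) l (graph3 u p)) p₁ := by
    have hFeq : ∀ p, expSum (scaleList (-η) (coshList (1, 0, 0) q.1) ++
      (scaleList (-η) (coshList (0, 1, 0) q.2) ++
      (scaleList (-ε) (coshList (0, 0, 1) h) ++ L))) l (graph3 u p) = F p := fun p => by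
      have h0 : ∀ P, dot3 0 P = 0 := fun P => by simp [dot3]
      have hl' : expSum L 0 (graph3 u p) + dot3 l (graph3 u p) = expSum L l (p.1, p.2, 0) := by
        refine Eq.trans ?_ (expSum_eq_of_vertical hL hl (graph3 u p))
        simp [expSum, h0]
      simp only [expSum_append, expSum_scaleList, expSum_coshList, h0, hF, hg, ← hl']
      simp only [dot3, graph3]
      ring_nf
    simp only [hFeq]
    filter_upwards [H.isOpen.mem_nhds hp₁.1, isOpen_ball.mem_nhds hr1',
      (hucont.continuousAt (H.isOpen.mem_nhds hp₁.1)).eventually_lt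
        continuousAt_const hu1] with p hp1 hp2 hp3
    exact hp₁max ⟨hp1, ball_subset_closedBall hp2, hp3.le⟩
  have key := H.max_le _ l p₁ hp₁.1 hloc
  have hee := H.dot_dir
  simp only [dot3, H.fst_dir] at hee
  have he2 : |e.2.1| ≤ 1 := abs_le_one_iff_mul_self_le_one.2 (by nlinarith [sq_nonneg e.2.2])
  have he3 : |e.2.2| ≤ 1 := abs_le_one_iff_mul_self_le_one.2 (by nlinarith [sq_nonneg e.2.1])
  have d1 : driftLap e (n p₁) (coshList (1, 0, 0) q.1) 0 (graph3 u p₁) ≤ 6 :=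
    driftLap_coshList_le (by simp [dot3]) (by simp [dot3, H.fst_dir])
      (by simpa [dot3, graph3] using hd.1.trans hr1)
  have d2 : driftLap e (n p₁) (coshList (0, 1, 0) q.2) 0 (graph3 u p₁) ≤ 6 :=
    driftLap_coshList_le (by simp [dot3]) (by simpa [dot3] using he2)
      (by simpa [dot3, graph3] using hd.2.trans hr1)
  have d3 : driftLap e (n p₁) (coshList (0, 0, 1) h) 0 (graph3 u p₁) ≤ 6 :=
    driftLap_coshList_le (by simp [dot3]) (by simpa [dot3] using he3)
      (by simpa [dot3, graph3] using hp₁.2.2)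
  have d4 : m₀ < driftLap e (n p₁) L 0 (graph3 u p₁) + dot3 e l := by
    have h1 := (hb p₁ hp₁.2.1).1 _ (H.dot_normal p₁ hp₁.1)
    have h2 := driftLap_eq_of_vertical e (n p₁) l hL (graph3 u p₁)
    have h3 : driftLap e (n p₁) L l (graph3 u p₁) =
        driftLap e (n p₁) L 0 (graph3 u p₁) + dot3 e l := by simp [driftLap, dot3]
    simp only [graph3] at *
    linarith
  have h0 : dot3 e 0 = 0 := by simp [dot3]
  simp only [driftLap_append, driftLap_scaleList, h0] at key
  have k1 := mul_le_mul_of_nonneg_left d1 hη0.le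
  have k2 := mul_le_mul_of_nonneg_left d2 hη0.le
  have k3 := mul_le_mul_of_nonneg_left d3 hε0.le
  linarith

end SlabSoliton

section PartialDerivatives

variable {v : ℝ × ℝ → ℝ} {Ω : Set (ℝ × ℝ)} {p : ℝ × ℝ}

lemma contDiffOn_pds (hΩ : IsOpen Ω) (hv : ContDiffOn ℝ (⊤ : ℕ∞) v Ω) :
    ContDiffOn ℝ (⊤ : ℕ∞) (pds v) Ω :=
  (hv.fderiv_of_isOpen hΩ (by exact_mod_cast le_top)).clm_apply contDiffOn_const

lemma contDiffOn_pdt (hΩ : IsOpen Ω) (hv : ContDiffOn ℝ (⊤ : ℕ∞) v Ω) :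
    ContDiffOn ℝ (⊤ : ℕ∞) (pdt v) Ω :=
  (hv.fderiv_of_isOpen hΩ (by exact_mod_cast le_top)).clm_apply contDiffOn_const

lemma hasFDerivAt_of_contDiffOn (hΩ : IsOpen Ω) (hv : ContDiffOn ℝ (⊤ : ℕ∞) v Ω) (hp : p ∈ Ω) :
    HasFDerivAt v (fderiv ℝ v p) p :=
  ((hv.contDiffAt (hΩ.mem_nhds hp)).differentiableAt (by simp)).hasFDerivAt

lemma fderiv_apply_eq (v : ℝ × ℝ → ℝ) (p : ℝ × ℝ) (a b : ℝ) :
    fderiv ℝ v p (a, b) = a * pds v p + b * pdt v p := by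
  have : ((a, b) : ℝ × ℝ) = a • ((1, 0) : ℝ × ℝ) + b • ((0, 1) : ℝ × ℝ) := by simp
  rw [this, map_add, map_smul, map_smul]
  rfl

lemma hasDerivAt_line (hΩ : IsOpen Ω) (hv : ContDiffOn ℝ (⊤ : ℕ∞) v Ω) (a b x : ℝ)
    (hp : (p.1 + x * a, p.2 + x * b) ∈ Ω) :
    HasDerivAt (fun r : ℝ => v (p.1 + r * a, p.2 + r * b))
      (a * pds v (p.1 + x * a, p.2 + x * b) + b * pdt v (p.1 + x * a, p.2 + x * b)) x := by
  rw [← fderiv_apply_eq]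
  have h1 : HasDerivAt (fun r : ℝ => (p.1 + r * a, p.2 + r * b)) (a, b) x := by
    refine HasDerivAt.prodMk ?_ ?_
    · simpa using ((hasDerivAt_id x).mul_const a).const_add p.1
    · simpa using ((hasDerivAt_id x).mul_const b).const_add p.2
  exact (hasFDerivAt_of_contDiffOn hΩ hv hp).comp_hasDerivAt x h1

lemma hasDerivAt_fst (hΩ : IsOpen Ω) (hv : ContDiffOn ℝ (⊤ : ℕ∞) v Ω) (hp : p ∈ Ω) :
    HasDerivAt (fun s : ℝ => v (s, p.2)) (pds v p) p.1 :=
  (hasFDerivAt_of_contDiffOn hΩ hv hp).comp_hasDerivAt p.1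
    ((hasDerivAt_id p.1).prodMk (hasDerivAt_const p.1 p.2))

lemma hasDerivAt_snd (hΩ : IsOpen Ω) (hv : ContDiffOn ℝ (⊤ : ℕ∞) v Ω) (hp : p ∈ Ω) :
    HasDerivAt (fun t : ℝ => v (p.1, t)) (pdt v p) p.2 :=
  (hasFDerivAt_of_contDiffOn hΩ hv hp).comp_hasDerivAt p.2
    ((hasDerivAt_const p.2 p.1).prodMk (hasDerivAt_id p.2))

lemma pds_pdt_comm (hΩ : IsOpen Ω) (hv : ContDiffOn ℝ (⊤ : ℕ∞) v Ω) (hp : p ∈ Ω) :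
    pds (pdt v) p = pdt (pds v) p := by
  have h1 : ContDiffOn ℝ (⊤ : ℕ∞) (fderiv ℝ v) Ω :=
    hv.fderiv_of_isOpen hΩ (by exact_mod_cast le_top)
  have h2 : DifferentiableAt ℝ (fderiv ℝ v) p :=
    (h1.contDiffAt (hΩ.mem_nhds hp)).differentiableAt (by simp)
  have h3 := (hv.contDiffAt (hΩ.mem_nhds hp)).isSymmSndFDerivAt
    (by simp only [minSmoothness_of_isRCLikeNormedField]; exact WithTop.coe_le_coe.2 le_top)
  have h4 := h3.eq (1, 0) (0, 1)
  have h5 : ∀ a b : ℝ × ℝ, fderiv ℝ (fun q => fderiv ℝ v q a) p b = fderiv ℝ (fderiv ℝ v) p b a :=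
    fun a b => by
      rw [fderiv_clm_apply h2 (differentiableAt_const a)]
      simp
  change fderiv ℝ (fun q => fderiv ℝ v q (0, 1)) p (1, 0) =
    fderiv ℝ (fun q => fderiv ℝ v q (1, 0)) p (0, 1)
  rw [h5, h5, h4]

end PartialDerivatives

/-- `√(1 + |∇u|²)`. -/
def gradW (u : ℝ × ℝ → ℝ) (p : ℝ × ℝ) : ℝ := √(1 + pds u p ^ 2 + pdt u p ^ 2)

lemma gradW_sq (u : ℝ × ℝ → ℝ) (p : ℝ × ℝ) : gradW u p ^ 2 = 1 + pds u p ^ 2 + pdt u p ^ 2 :=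
  Real.sq_sqrt (by positivity)

lemma gradW_pos (u : ℝ × ℝ → ℝ) (p : ℝ × ℝ) : 0 < gradW u p := Real.sqrt_pos.2 (by positivity)

/-- The translator equation, with `κ` and `σ` the components of the drift. -/
def TranslatorEq (κ σ : ℝ) (u : ℝ × ℝ → ℝ) (p : ℝ × ℝ) : Prop :=
  (1 + pdt u p ^ 2) * pds (pds u) p - 2 * pds u p * pdt u p * pdt (pds u) p
    + (1 + pds u p ^ 2) * pdt (pdt u) p = gradW u p ^ 2 * (σ - κ * pdt u p)

section Divergence

variable {u : ℝ × ℝ → ℝ} {Ω : Set (ℝ × ℝ)} {p : ℝ × ℝ} {κ σ : ℝ}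

lemma hasDerivAt_grad_div {a b a' b' W x : ℝ} {A B : ℝ → ℝ} (hA : HasDerivAt A a' x)
    (hB : HasDerivAt B b' x) (ha : A x = a) (hb : B x = b) (hW : √(1 + a ^ 2 + b ^ 2) = W) :
    HasDerivAt (fun r => A r / √(1 + A r ^ 2 + B r ^ 2))
      ((a' * W - a * ((a * a' + b * b') / W)) / W ^ 2) x := by
  have hpos : 0 < 1 + a ^ 2 + b ^ 2 := by positivity
  have h1 : HasDerivAt (fun r => 1 + A r ^ 2 + B r ^ 2) (2 * (a * a' + b * b')) x := by
    have := ((hA.fun_pow 2).const_add 1).fun_add (hB.fun_pow 2)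
    refine this.congr_deriv ?_
    rw [ha, hb]; push_cast; ring
  have h2 := h1.sqrt (by rw [ha, hb]; exact hpos.ne')
  have h3 := hA.fun_div h2 (by rw [ha, hb]; exact (Real.sqrt_pos.2 hpos).ne')
  refine h3.congr_deriv ?_
  rw [ha, hb, hW, mul_div_mul_left _ _ two_ne_zero]

/-- The derivative in the first variable of `u_s / W`. -/
def dsFlux (u : ℝ × ℝ → ℝ) (p : ℝ × ℝ) : ℝ :=
  (pds (pds u) p * gradW u p - pds u p *
    ((pds u p * pds (pds u) p + pdt u p * pds (pdt u) p) / gradW u p)) / gradW u p ^ 2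

/-- The derivative in the second variable of `u_t / W`. -/
def dtFlux (u : ℝ × ℝ → ℝ) (p : ℝ × ℝ) : ℝ :=
  (pdt (pdt u) p * gradW u p - pdt u p *
    ((pdt u p * pdt (pdt u) p + pds u p * pdt (pds u) p) / gradW u p)) / gradW u p ^ 2

lemma hasDerivAt_dsFlux (hΩ : IsOpen Ω) (hu : ContDiffOn ℝ (⊤ : ℕ∞) u Ω) (hp : p ∈ Ω) :
    HasDerivAt (fun s => pds u (s, p.2) / gradW u (s, p.2)) (dsFlux u p) p.1 :=
  hasDerivAt_grad_div (hasDerivAt_fst hΩ (contDiffOn_pds hΩ hu) hp)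
    (hasDerivAt_fst hΩ (contDiffOn_pdt hΩ hu) hp) rfl rfl rfl

lemma hasDerivAt_dtFlux (hΩ : IsOpen Ω) (hu : ContDiffOn ℝ (⊤ : ℕ∞) u Ω) (hp : p ∈ Ω) :
    HasDerivAt (fun t => pdt u (p.1, t) / gradW u (p.1, t)) (dtFlux u p) p.2 := by
  have h := hasDerivAt_grad_div (W := gradW u p) (hasDerivAt_snd hΩ (contDiffOn_pdt hΩ hu) hp)
    (hasDerivAt_snd hΩ (contDiffOn_pds hΩ hu) hp) rfl rfl (by rw [gradW, add_right_comm])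
  refine h.congr_of_eventuallyEq (Filter.Eventually.of_forall fun t => ?_)
  simp only [gradW, add_right_comm]

lemma dsFlux_add_dtFlux (hΩ : IsOpen Ω) (hu : ContDiffOn ℝ (⊤ : ℕ∞) u Ω) (hp : p ∈ Ω)
    (h : TranslatorEq κ σ u p) :
    dsFlux u p + dtFlux u p = (σ - κ * pdt u p) / gradW u p := by
  have hW := gradW_pos u p
  have hsq := gradW_sq u p
  unfold TranslatorEq at h
  unfold dsFlux dtFlux
  rw [pds_pdt_comm hΩ hu hp]
  have e : ∀ X Y a b : ℝ, (X * gradW u p - a * (Y / gradW u p)) / gradW u p ^ 2 =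
      (X * gradW u p ^ 2 - a * Y) / gradW u p ^ 3 := fun X Y a b => by field_simp
  rw [e _ _ _ 0, e _ _ _ 0, ← add_div, div_eq_div_iff (by positivity) (by positivity)]
  have : gradW u p ^ 3 = gradW u p ^ 2 * gradW u p := by ring
  rw [this]
  linear_combination gradW u p * h + gradW u p * (pds (pds u) p + pdt (pdt u) p) * hsq

end Divergence

section SecondOrder

lemma second_deriv_nonpos_of_isLocalMax {f f' : ℝ → ℝ} {f'' x : ℝ}
    (h1 : ∀ᶠ r in 𝓝 x, HasDerivAt f (f' r) r) (h2 : HasDerivAt f' f'' x)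
    (hmax : IsLocalMax f x) : f'' ≤ 0 := by
  by_contra! hpos
  have hd : deriv f =ᶠ[𝓝 x] f' := h1.mono fun r hr => hr.deriv
  have hdd : deriv (deriv f) x = f'' := hd.deriv_eq.trans h2.deriv
  have hmin : IsLocalMin f x := isLocalMin_of_deriv_deriv_pos (hdd ▸ hpos) hmax.deriv_eq_zero
    h1.self_of_nhds.continuousAt
  have hconst : f =ᶠ[𝓝 x] fun _ => f x :=
    (hmax.and hmin).mono fun r hr => le_antisymm hr.1 hr.2
  have h3 : deriv f =ᶠ[𝓝 x] fun _ => 0 := hconst.deriv.trans (by simp)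
  have h4 : deriv (deriv f) x = 0 := h3.deriv_eq.trans (by simp)
  linarith

variable {γ γ' : ℝ → ℝ × ℝ × ℝ} {v : ℝ × ℝ × ℝ} {r : ℝ}

lemma hasDerivAt_dot3 (a : ℝ × ℝ × ℝ) (h : HasDerivAt γ v r) :
    HasDerivAt (fun r => dot3 a (γ r)) (dot3 a v) r := by
  have h1 : HasDerivAt (fun r => (γ r).1) v.1 r := h.fst
  have h2 : HasDerivAt (fun r => (γ r).2.1) v.2.1 r := h.snd.fst
  have h3 : HasDerivAt (fun r => (γ r).2.2) v.2.2 r := h.snd.snd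
  exact ((h1.const_mul a.1).fun_add (h2.const_mul a.2.1)).fun_add (h3.const_mul a.2.2)

lemma hasDerivAt_expSum (L : List (ℝ × (ℝ × ℝ × ℝ))) (l : ℝ × ℝ × ℝ) (h : HasDerivAt γ v r) :
    HasDerivAt (fun r => expSum L l (γ r))
      ((L.map fun a => a.1 * Real.exp (dot3 a.2 (γ r)) * dot3 a.2 v).sum + dot3 l v) r := by
  refine HasDerivAt.fun_add ?_ (hasDerivAt_dot3 l h)
  induction L with
  | nil => simpa using hasDerivAt_const r 0
  | cons a L ih =>
    simp only [List.map_cons, List.sum_cons]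
    refine HasDerivAt.fun_add (((hasDerivAt_dot3 a.2 h).exp.const_mul a.1).congr_deriv ?_) ih
    ring

lemma hasDerivAt_expSum_deriv (L : List (ℝ × (ℝ × ℝ × ℝ))) (l : ℝ × ℝ × ℝ)
    (h : HasDerivAt γ (γ' r) r) (h' : HasDerivAt γ' v r) :
    HasDerivAt (fun r => (L.map fun a => a.1 * Real.exp (dot3 a.2 (γ r)) * dot3 a.2 (γ' r)).sum +
        dot3 l (γ' r))
      ((L.map fun a => a.1 * Real.exp (dot3 a.2 (γ r)) * (dot3 a.2 (γ' r) ^ 2 + dot3 a.2 v)).sum +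
        dot3 l v) r := by
  refine HasDerivAt.fun_add ?_ (hasDerivAt_dot3 l h')
  induction L with
  | nil => simpa using hasDerivAt_const r 0
  | cons a L ih =>
    simp only [List.map_cons, List.sum_cons]
    refine HasDerivAt.fun_add ((((hasDerivAt_dot3 a.2 h).exp.const_mul a.1).fun_mul
      (hasDerivAt_dot3 a.2 h')).congr_deriv ?_) ih
    ring

end SecondOrder

section Normal

variable {u : ℝ × ℝ → ℝ} {Ω : Set (ℝ × ℝ)} {p : ℝ × ℝ} {κ σ : ℝ}

/-- The upward unit normal of the graph of `u`. -/
def graphNormal (u : ℝ × ℝ → ℝ) (p : ℝ × ℝ) : ℝ × ℝ × ℝ :=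
  (-pds u p / gradW u p, -pdt u p / gradW u p, 1 / gradW u p)

lemma dot3_graphNormal (u : ℝ × ℝ → ℝ) (p : ℝ × ℝ) :
    dot3 (graphNormal u p) (graphNormal u p) = 1 := by
  have hW := gradW_pos u p
  have hsq := gradW_sq u p
  simp only [dot3, graphNormal]
  field_simp
  linarith

/-- The second derivative of `u` in the direction `(a, b)`. -/
def hess (u : ℝ × ℝ → ℝ) (p : ℝ × ℝ) (a b : ℝ) : ℝ :=
  a * (a * pds (pds u) p + b * pdt (pds u) p) + b * (a * pds (pdt u) p + b * pdt (pdt u) p)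

lemma derivs_of_isLocalMax (hΩ : IsOpen Ω) (hu : ContDiffOn ℝ (⊤ : ℕ∞) u Ω) (hp : p ∈ Ω)
    {L : List (ℝ × (ℝ × ℝ × ℝ))} {l : ℝ × ℝ × ℝ}
    (hmax : IsLocalMax (fun q => expSum L l (graph3 u q)) p) (a b : ℝ) :
    (L.map fun k => k.1 * Real.exp (dot3 k.2 (graph3 u p)) *
      dot3 k.2 (a, b, a * pds u p + b * pdt u p)).sum +
        dot3 l (a, b, a * pds u p + b * pdt u p) = 0 ∧
    (L.map fun k => k.1 * Real.exp (dot3 k.2 (graph3 u p)) *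
      (dot3 k.2 (a, b, a * pds u p + b * pdt u p) ^ 2 + dot3 k.2 (0, 0, hess u p a b))).sum +
        dot3 l (0, 0, hess u p a b) ≤ 0 := by
  set c : ℝ → ℝ × ℝ := fun r => (p.1 + r * a, p.2 + r * b) with hc
  have hc0 : c 0 = p := by simp [hc]
  have hcc : Continuous c := by fun_prop
  have hcΩ : ∀ᶠ r in 𝓝 (0 : ℝ), c r ∈ Ω :=
    hcc.continuousAt.eventually_mem (by rw [hc0]; exact hΩ.mem_nhds hp)
  have hγ : ∀ r, c r ∈ Ω → HasDerivAt (fun r => graph3 u (c r))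
      (a, b, a * pds u (c r) + b * pdt u (c r)) r := fun r hr => by
    have hlin : ∀ x d : ℝ, HasDerivAt (fun r : ℝ => x + r * d) d r := fun x d => by
      simpa using ((hasDerivAt_id r).mul_const d).const_add x
    exact (hlin p.1 a).prodMk ((hlin p.2 b).prodMk (hasDerivAt_line hΩ hu a b r hr))
  have hγ' : HasDerivAt (fun r => ((a, b, a * pds u (c r) + b * pdt u (c r)) : ℝ × ℝ × ℝ))
      (0, 0, hess u p a b) 0 := by
    have h1 := hasDerivAt_line hΩ (contDiffOn_pds hΩ hu) a b 0 (p := p) (hcΩ.self_of_nhds)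
    have h2 := hasDerivAt_line hΩ (contDiffOn_pdt hΩ hu) a b 0 (p := p) (hcΩ.self_of_nhds)
    have h3 := (h1.const_mul a).fun_add (h2.const_mul b)
    refine HasDerivAt.prodMk (hasDerivAt_const _ _)
      (HasDerivAt.prodMk (hasDerivAt_const _ _) (h3.congr_deriv ?_))
    simp [hess]
  have hmax' : IsLocalMax (fun r => expSum L l (graph3 u (c r))) 0 := by
    have : Filter.Tendsto c (𝓝 0) (𝓝 p) := by
      have := hcc.tendsto 0
      rwa [hc0] at this
    have h1 := this.eventually hmax
    simpa only [IsLocalMax, IsMaxFilter, hc0] using h1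
  have hfirst := fun r hr => hasDerivAt_expSum L l (hγ r hr)
  have hΩ0 : c 0 ∈ Ω := hc0.symm ▸ hp
  constructor
  · have := hmax'.hasDerivAt_eq_zero (hfirst 0 hΩ0)
    simpa only [hc0] using this
  · have := second_deriv_nonpos_of_isLocalMax (hcΩ.mono hfirst)
      (hasDerivAt_expSum_deriv L l (hγ 0 hΩ0) hγ') hmax'
    simpa only [hc0] using this

lemma sum_combination {α : Type*} (L : List α) (f₁ f₂ f₃ f₄ f₅ : α → ℝ) (C D : ℝ)
    (h : ∀ k ∈ L, f₁ k + f₂ k + f₃ k + C * f₄ k = D * f₅ k) :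
    (L.map f₁).sum + (L.map f₂).sum + (L.map f₃).sum + C * (L.map f₄).sum =
      D * (L.map f₅).sum := by
  induction L with
  | nil => simp
  | cons a L ih =>
    simp only [List.map_cons, List.sum_cons]
    have h1 := h a (by simp)
    have h2 := ih fun k hk => h k (by simp [hk])
    linear_combination h1 + h2

lemma driftLap_nonpos_of_isLocalMax (hΩ : IsOpen Ω) (hu : ContDiffOn ℝ (⊤ : ℕ∞) u Ω) (hp : p ∈ Ω)
    (heq : TranslatorEq κ σ u p) {L : List (ℝ × (ℝ × ℝ × ℝ))} {l : ℝ × ℝ × ℝ}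
    (hmax : IsLocalMax (fun q => expSum L l (graph3 u q)) p) :
    driftLap (0, κ, σ) (graphNormal u p) L l (graph3 u p) ≤ 0 := by
  have h1 := (derivs_of_isLocalMax hΩ hu hp hmax 1 0).2
  have h2 := (derivs_of_isLocalMax hΩ hu hp hmax 0 1).2
  have h3 := (derivs_of_isLocalMax hΩ hu hp hmax (pdt u p) (-pds u p)).2
  have h4 := (derivs_of_isLocalMax hΩ hu hp hmax 0 1).1
  have hW := gradW_pos u p
  have hsq := gradW_sq u p
  unfold TranslatorEq at heq
  have hH : hess u p 1 0 + hess u p 0 1 + hess u p (pdt u p) (-pds u p) =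
      gradW u p ^ 2 * (σ - κ * pdt u p) := by
    rw [← heq]
    simp only [hess, pds_pdt_comm hΩ hu hp]
    ring
  have hk := sum_combination L
    (fun k => k.1 * Real.exp (dot3 k.2 (graph3 u p)) *
      (dot3 k.2 (1, 0, 1 * pds u p + 0 * pdt u p) ^ 2 + dot3 k.2 (0, 0, hess u p 1 0)))
    (fun k => k.1 * Real.exp (dot3 k.2 (graph3 u p)) *
      (dot3 k.2 (0, 1, 0 * pds u p + 1 * pdt u p) ^ 2 + dot3 k.2 (0, 0, hess u p 0 1)))
    (fun k => k.1 * Real.exp (dot3 k.2 (graph3 u p)) *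
      (dot3 k.2 (pdt u p, -pds u p, pdt u p * pds u p + -pds u p * pdt u p) ^ 2 +
        dot3 k.2 (0, 0, hess u p (pdt u p) (-pds u p))))
    (fun k => k.1 * Real.exp (dot3 k.2 (graph3 u p)) *
      dot3 k.2 (0, 1, 0 * pds u p + 1 * pdt u p))
    (fun k => k.1 * Real.exp (dot3 k.2 (graph3 u p)) *
      (dot3 k.2 k.2 - dot3 k.2 (graphNormal u p) ^ 2 + dot3 (0, κ, σ) k.2))
    (gradW u p ^ 2 * κ) (gradW u p ^ 2) fun k _ => by
      have hN : gradW u p ^ 2 * dot3 k.2 (graphNormal u p) ^ 2 =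
          (k.2.2.2 - pds u p * k.2.1 - pdt u p * k.2.2.1) ^ 2 := by
        rw [← mul_pow]
        congr 1
        simp only [dot3, graphNormal]
        field_simp
        ring
      simp only [dot3] at hN ⊢
      linear_combination k.1 * Real.exp (k.2.1 * (graph3 u p).1 + k.2.2.1 * (graph3 u p).2.1 +
        k.2.2.2 * (graph3 u p).2.2) * (k.2.2.2 * hH + hN -
          (k.2.1 ^ 2 + k.2.2.1 ^ 2 + k.2.2.2 ^ 2) * hsq)
  have hl : dot3 l (0, 0, hess u p 1 0) + dot3 l (0, 0, hess u p 0 1) +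
      dot3 l (0, 0, hess u p (pdt u p) (-pds u p)) +
      gradW u p ^ 2 * κ * dot3 l (0, 1, 0 * pds u p + 1 * pdt u p) =
      gradW u p ^ 2 * dot3 (0, κ, σ) l := by
    simp only [dot3]
    linear_combination l.2.2 * hH
  have hfin : gradW u p ^ 2 * driftLap (0, κ, σ) (graphNormal u p) L l (graph3 u p) ≤ 0 := by
    rw [driftLap, mul_add, ← hk, ← hl]
    linear_combination h1 + h2 + h3 + gradW u p ^ 2 * κ * h4
  by_contra! hcon
  exact absurd hfin (not_le.2 (by positivity))

end Normal

section AreaEstimate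

lemma exists_cutoff : ∃ (τ τ' : ℝ → ℝ) (C : ℝ), (∀ y, HasDerivAt τ (τ' y) y) ∧ Continuous τ' ∧
    (∀ y < 1 / 4, τ y = 0 ∧ τ' y = 0) ∧ (∀ y, 1 ≤ y → τ y = 1) ∧
    (∀ y, 0 ≤ τ y ∧ τ y ≤ 1) ∧ ∀ y, 0 ≤ τ' y ∧ τ' y ≤ C := by
  set τ : ℝ → ℝ := fun y => Real.smoothTransition ((4 * y - 1) / 3) with hτ
  have hdiff : ContDiff ℝ 1 τ := Real.smoothTransition.contDiff.comp (by fun_prop)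
  have hcont : Continuous (deriv τ) := hdiff.continuous_deriv le_rfl
  have hmono : Monotone τ := fun x y h => Real.smoothTransition.monotone (by linarith)
  have h0 : ∀ y < 1 / 4, τ y = 0 := fun y hy => Real.smoothTransition.zero_of_nonpos (by linarith)
  have h1 : ∀ y, 1 ≤ y → τ y = 1 := fun y hy => Real.smoothTransition.one_of_one_le (by linarith)
  have d0 : ∀ y < 1 / 4, deriv τ y = 0 := fun y hy => by
    have : τ =ᶠ[𝓝 y] fun _ => 0 := (eventually_lt_nhds hy).mono h0
    rw [this.deriv_eq]; simp
  have d1 : ∀ y, 1 < y → deriv τ y = 0 := fun y hy => by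
    have : τ =ᶠ[𝓝 y] fun _ => 1 := (eventually_gt_nhds hy).mono fun z hz => h1 z (le_of_lt hz)
    rw [this.deriv_eq]; simp
  obtain ⟨C, hC⟩ := (isCompact_Icc (a := (1 / 4 : ℝ)) (b := 1)).bddAbove_image hcont.continuousOn
  have hnn : ∀ y, 0 ≤ deriv τ y := fun y => hmono.deriv_nonneg
  have hC0 : 0 ≤ C := (hnn 1).trans (hC ⟨1, by norm_num, rfl⟩)
  refine ⟨τ, deriv τ, C, fun y => (hdiff.differentiable one_ne_zero y).hasDerivAt, hcont,
    fun y hy => ⟨h0 y hy, d0 y hy⟩, h1, fun y => ⟨Real.smoothTransition.nonneg _,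
      Real.smoothTransition.le_one _⟩, fun y => ⟨hnn y, ?_⟩⟩
  rcases lt_or_ge y (1 / 4) with h | h
  · rw [d0 y h]; exact hC0
  rcases le_or_gt y 1 with h' | h'
  · exact hC ⟨y, ⟨h, h'⟩, rfl⟩
  · rw [d1 y h']; exact hC0

variable {D Z St : Set (ℝ × ℝ)} {F F' : ℝ × ℝ → ℝ}

lemma continuousOn_indicator_glue (hD : IsOpen D) (hZ : IsClosed Z) (hZD : Z ⊆ D)
    (hF : ContinuousOn F D) (h0 : ∀ p ∈ D, p ∈ St → p ∉ Z → F p = 0) :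
    ContinuousOn (D.indicator F) St := by
  intro p hp
  by_cases hpD : p ∈ D
  · refine ContinuousAt.continuousWithinAt ?_
    refine (hF.continuousAt (hD.mem_nhds hpD)).congr ?_
    filter_upwards [hD.mem_nhds hpD] with x hx
    rw [Set.indicator_of_mem hx]
  · have hpZ : p ∉ Z := fun h => hpD (hZD h)
    have : D.indicator F =ᶠ[𝓝[St] p] fun _ => 0 := by
      filter_upwards [self_mem_nhdsWithin, mem_nhdsWithin_of_mem_nhds
        (hZ.isOpen_compl.mem_nhds hpZ)] with x hx hxZ
      by_cases hxD : x ∈ D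
      · rw [Set.indicator_of_mem hxD]; exact h0 x hxD hx hxZ
      · exact Set.indicator_of_notMem hxD _
    exact continuousWithinAt_const.congr_of_eventuallyEq this (Set.indicator_of_notMem hpD _)

lemma hasDerivAt_indicator_glue (hD : IsOpen D) (hZ : IsClosed Z) (hZD : Z ⊆ D)
    {c : ℝ → ℝ × ℝ} (hc : Continuous c) {r : ℝ} (hSt : ∀ᶠ x in 𝓝 r, c x ∈ St)
    (hF : c r ∈ D → HasDerivAt (fun x => F (c x)) (F' (c r)) r)
    (h0 : ∀ p ∈ D, p ∈ St → p ∉ Z → F p = 0) :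
    HasDerivAt (fun x => D.indicator F (c x)) (D.indicator F' (c r)) r := by
  by_cases hpD : c r ∈ D
  · rw [Set.indicator_of_mem hpD]
    refine (hF hpD).congr_of_eventuallyEq ?_
    filter_upwards [hc.continuousAt.eventually_mem (hD.mem_nhds hpD)] with x hx
    rw [Set.indicator_of_mem hx]
  · rw [Set.indicator_of_notMem hpD]
    have hpZ : c r ∉ Z := fun h => hpD (hZD h)
    refine (hasDerivAt_const r (0 : ℝ)).congr_of_eventuallyEq ?_
    filter_upwards [hSt, hc.continuousAt.eventually_mem (hZ.isOpen_compl.mem_nhds hpZ)]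
      with x hx hxZ
    by_cases hxD : c x ∈ D
    · rw [Set.indicator_of_mem hxD]; exact h0 _ hxD hx hxZ
    · exact Set.indicator_of_notMem hxD _

lemma setIntegral_rect {a a' b b' : ℝ} (ha : a ≤ a') (hb : b ≤ b')
    (hF : ContinuousOn F (Set.Icc a a' ×ˢ Set.Icc b b')) :
    (∫ z in Set.Icc a a' ×ˢ Set.Icc b b', F z) = (∫ x in a..a', ∫ y in b..b', F (x, y)) ∧
    (∫ z in Set.Icc a a' ×ˢ Set.Icc b b', F z) = ∫ y in b..b', ∫ x in a..a', F (x, y) := by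
  have hint : IntegrableOn F (Set.Icc a a' ×ˢ Set.Icc b b') (volume.prod volume) :=
    hF.integrableOn_compact (isCompact_Icc.prod isCompact_Icc)
  have hint' : IntegrableOn (fun z : ℝ × ℝ => F z.swap) (Set.Icc b b' ×ˢ Set.Icc a a')
      (volume.prod volume) := by
    refine ContinuousOn.integrableOn_compact (isCompact_Icc.prod isCompact_Icc) ?_
    exact hF.comp continuous_swap.continuousOn fun z hz => ⟨hz.2, hz.1⟩
  constructor
  · rw [Measure.volume_eq_prod, setIntegral_prod F hint, intervalIntegral.integral_of_le ha,
      integral_Icc_eq_integral_Ioc]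
    congr 1; funext x
    rw [intervalIntegral.integral_of_le hb, integral_Icc_eq_integral_Ioc]
  · rw [Measure.volume_eq_prod, ← setIntegral_prod_swap, setIntegral_prod _ hint',
      intervalIntegral.integral_of_le hb, integral_Icc_eq_integral_Ioc]
    congr 1; funext x
    rw [intervalIntegral.integral_of_le ha, integral_Icc_eq_integral_Ioc]
    rfl

lemma integral_parabola (b : ℝ) : ∫ t in b..(b + 1), (t - b) * (b + 1 - t) = 1 / 6 := by
  have h : ∀ t ∈ Set.uIcc b (b + 1), HasDerivAt (fun t => (t - b) ^ 2 / 2 - (t - b) ^ 3 / 3)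
      ((t - b) * (b + 1 - t)) t := fun t _ => by
    have h1 : HasDerivAt (fun t : ℝ => t - b) 1 t := (hasDerivAt_id t).sub_const b
    refine (((h1.fun_pow 2).div_const 2).fun_sub ((h1.fun_pow 3).div_const 3)).congr_deriv ?_
    push_cast; ring
  rw [intervalIntegral.integral_eq_sub_of_hasDerivAt h
    ((by fun_prop : Continuous fun t : ℝ => (t - b) * (b + 1 - t)).intervalIntegrable _ _)]
  norm_num

end AreaEstimate

section AreaBound

variable {u : ℝ × ℝ → ℝ} {Ω D : Set (ℝ × ℝ)} {κ σ μ ν w b c C : ℝ} {τ τ' : ℝ → ℝ}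

lemma flux_bound {a d W κ σ μ ν s η η' t t' C : ℝ} (hW : 0 < W)
    (hsq : W ^ 2 = 1 + a ^ 2 + d ^ 2) (hκ : |κ| ≤ 1) (hσ : |σ| ≤ 1) (hμ : |μ| ≤ 1) (hs : |s| = 1)
    (hsν : s * ν = |ν|) (hν : |ν| ≤ 1) (hη : 0 ≤ η ∧ η ≤ 1) (hη' : |η'| ≤ 1) (ht : 0 ≤ t ∧ t ≤ 1)
    (ht' : 0 ≤ t' ∧ t' ≤ C) :
    η * (t' * |ν * a|) ≤ s * (η * (t' * (ν * a) * (a / W)) + (η' * t * (d / W) +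
      η * (t' * (μ + ν * d) * (d / W))) + η * t * ((σ - κ * d) / W)) + (3 + 2 * C) := by
  have hW1 : 1 ≤ W := by nlinarith [sq_nonneg a, sq_nonneg d]
  have hdW : |d / W| ≤ 1 := by
    rw [abs_div, abs_of_pos hW, div_le_one hW]
    exact abs_le_of_sq_le_sq (by nlinarith [sq_nonneg a]) hW.le
  have haW : |a| ≤ W := abs_le_of_sq_le_sq (by nlinarith [sq_nonneg d]) hW.le
  have h1W : |1 / W| ≤ 1 := by
    rw [abs_div, abs_one, abs_of_pos hW, div_le_one hW]; exact hW1
  have hC : 0 ≤ C := ht'.1.trans ht'.2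
  have hmul : ∀ {x y X Y : ℝ}, |x| ≤ X → |y| ≤ Y → |x * y| ≤ X * Y := fun {x y X Y} hx hy => by
    rw [abs_mul]
    exact mul_le_mul hx hy (abs_nonneg _) ((abs_nonneg _).trans hx)
  have hηa : |η| ≤ 1 := by rw [abs_of_nonneg hη.1]; exact hη.2
  have hta : |t| ≤ 1 := by rw [abs_of_nonneg ht.1]; exact ht.2
  have ht'a : |t'| ≤ C := by rw [abs_of_nonneg ht'.1]; exact ht'.2
  have b1 : |s * (η * t * (σ * (1 / W)))| ≤ 1 * (1 * 1 * (1 * 1)) :=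
    hmul hs.le (hmul (hmul hηa hta) (hmul hσ h1W))
  have b2 : |s * (η * t * (κ * (d / W)))| ≤ 1 * (1 * 1 * (1 * 1)) :=
    hmul hs.le (hmul (hmul hηa hta) (hmul hκ hdW))
  have b3 : |s * (η' * t * (d / W))| ≤ 1 * (1 * 1 * 1) :=
    hmul hs.le (hmul (hmul hη' hta) hdW)
  have b4 : |s * (η * t' * (μ * (d / W)))| ≤ 1 * (1 * C * (1 * 1)) :=
    hmul hs.le (hmul (hmul hηa ht'a) (hmul hμ hdW))
  have b5 : abs (η * t' * abs ν) ≤ 1 * C * 1 := hmul (hmul hηa ht'a) (by rwa [abs_abs])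
  have key : |a| - 1 ≤ (a ^ 2 + d ^ 2) / W := by
    rw [le_div_iff₀ hW]
    nlinarith [abs_nonneg a]
  have b6 : η * t' * |ν| * (|a| - 1) ≤ η * t' * |ν| * ((a ^ 2 + d ^ 2) / W) :=
    mul_le_mul_of_nonneg_left key (mul_nonneg (mul_nonneg hη.1 ht'.1) (abs_nonneg _))
  have e : s * (η * (t' * (ν * a) * (a / W)) + (η' * t * (d / W) +
      η * (t' * (μ + ν * d) * (d / W))) + η * t * ((σ - κ * d) / W)) =
      η * t' * |ν| * ((a ^ 2 + d ^ 2) / W) + s * (η' * t * (d / W)) +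
      s * (η * t' * (μ * (d / W))) + s * (η * t * (σ * (1 / W))) -
      s * (η * t * (κ * (d / W))) := by
    rw [← hsν]; ring
  rw [e, abs_mul]
  linarith only [b6, (abs_le.1 b1).1, (abs_le.1 b2).2, (abs_le.1 b3).1, (abs_le.1 b4).1,
    (abs_le.1 b5).2]

lemma area_bound (hΩ : IsOpen Ω) (hu : ContDiffOn ℝ (⊤ : ℕ∞) u Ω)
    (heq : ∀ p ∈ Ω, TranslatorEq κ σ u p) (hκ : |κ| ≤ 1) (hσ : |σ| ≤ 1) (hμ : |μ| ≤ 1)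
    (hν1 : |ν| ≤ 1) (hτ : ∀ y, HasDerivAt τ (τ' y) y) (hτ' : Continuous τ')
    (h0 : ∀ y < 1 / 4, τ y = 0 ∧ τ' y = 0) (h1 : ∀ y, 1 ≤ y → τ y = 1)
    (hb : ∀ y, 0 ≤ τ y ∧ τ y ≤ 1) (hb' : ∀ y, 0 ≤ τ' y ∧ τ' y ≤ C) (hw : 0 ≤ w)
    (hDo : IsOpen D) (hDΩ : D ⊆ Ω) (hDw : ∀ p ∈ D, |p.1| ≤ w)
    (hcl : ∀ p ∈ closure D, b ≤ p.2 → p.2 ≤ b + 1 → p ∈ Ω)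
    (hclD : ∀ p ∈ closure D, b ≤ p.2 → p.2 ≤ b + 1 → c < μ * p.2 + ν * u p → p ∈ D)
    (hpt : ∀ t, b ≤ t → t ≤ b + 1 → ∃ x, (x, t) ∈ D ∧ c + 1 ≤ μ * t + ν * u (x, t)) :
    1 / 6 ≤ (3 + 2 * C) * volume.real (D ∩ {p | b ≤ p.2 ∧ p.2 ≤ b + 1}) := by
  set Y : ℝ × ℝ → ℝ := fun p => μ * p.2 + ν * u p with hY
  have hYc : ContinuousOn Y Ω :=
    (continuous_const.mul continuous_snd).continuousOn.add (continuousOn_const.mul hu.continuousOn)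
  set K : Set (ℝ × ℝ) := closure D ∩ {p | b ≤ p.2 ∧ p.2 ≤ b + 1} with hK
  have hKcl : IsClosed K := isClosed_closure.inter
    ((isClosed_le continuous_const continuous_snd).inter
      (isClosed_le continuous_snd continuous_const))
  have hKΩ : K ⊆ Ω := fun p hp => hcl p hp.1 hp.2.1 hp.2.2
  set Z : Set (ℝ × ℝ) := K ∩ Y ⁻¹' Set.Ici (c + 1 / 4) with hZdef
  have hZ : IsClosed Z := (hYc.mono hKΩ).preimage_isClosed_of_isClosed hKcl isClosed_Ici
  have hZD : Z ⊆ D := fun p hp => hclD p hp.1.1 hp.1.2.1 hp.1.2.2 (by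
    have : c + 1 / 4 ≤ Y p := hp.2
    simp only [hY] at this
    linarith)
  set a := w + 1 with ha
  set R : Set (ℝ × ℝ) := Set.Icc (-a) a ×ˢ Set.Icc b (b + 1) with hR
  have hYlt : ∀ p ∈ D, b ≤ p.2 → p.2 ≤ b + 1 → p ∉ Z → Y p - c < 1 / 4 := fun p hp h2 h3 h4 => by
    by_contra! hcon
    refine h4 ⟨⟨subset_closure hp, h2, h3⟩, ?_⟩
    simp only [Set.mem_preimage, Set.mem_Ici]; linarith
  -- regularity of the ingredients
  have cus := (contDiffOn_pds hΩ hu).continuousOn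
  have cut := (contDiffOn_pdt hΩ hu).continuousOn
  have cuss := (contDiffOn_pds hΩ (contDiffOn_pds hΩ hu)).continuousOn
  have cust := (contDiffOn_pdt hΩ (contDiffOn_pds hΩ hu)).continuousOn
  have cuts := (contDiffOn_pds hΩ (contDiffOn_pdt hΩ hu)).continuousOn
  have cutt := (contDiffOn_pdt hΩ (contDiffOn_pdt hΩ hu)).continuousOn
  have cW : ContinuousOn (gradW u) Ω :=
    Real.continuous_sqrt.comp_continuousOn ((continuousOn_const.add (cus.pow 2)).add (cut.pow 2))
  have hW0 : ∀ p ∈ Ω, gradW u p ≠ 0 := fun p _ => (gradW_pos u p).ne'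
  have hW20 : ∀ p ∈ Ω, gradW u p ^ 2 ≠ 0 := fun p _ => (pow_pos (gradW_pos u p) 2).ne'
  have cds : ContinuousOn (dsFlux u) Ω :=
    ((cuss.mul cW).sub (cus.mul (((cus.mul cuss).add (cut.mul cuts)).div cW hW0))).div
      (cW.pow 2) hW20
  have cdt : ContinuousOn (dtFlux u) Ω :=
    ((cutt.mul cW).sub (cut.mul (((cut.mul cutt).add (cus.mul cust)).div cW hW0))).div
      (cW.pow 2) hW20
  have cτ : ContinuousOn (fun p => τ (Y p - c)) Ω :=
    (continuous_iff_continuousAt.2 fun y => (hτ y).continuousAt).comp_continuousOn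
      (hYc.sub continuousOn_const)
  have cτ' : ContinuousOn (fun p => τ' (Y p - c)) Ω :=
    hτ'.comp_continuousOn (hYc.sub continuousOn_const)
  have cη : ContinuousOn (fun p : ℝ × ℝ => (p.2 - b) * (b + 1 - p.2)) Ω :=
    (by fun_prop : Continuous fun p : ℝ × ℝ => (p.2 - b) * (b + 1 - p.2)).continuousOn
  have cη' : ContinuousOn (fun p : ℝ × ℝ => b + 1 - p.2 - (p.2 - b)) Ω :=
    (by fun_prop : Continuous fun p : ℝ × ℝ => b + 1 - p.2 - (p.2 - b)).continuousOn
  have hτs : ∀ p ∈ Ω, HasDerivAt (fun s => τ (Y (s, p.2) - c)) (τ' (Y p - c) * (ν * pds u p)) p.1 :=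
    fun p hp => by
      have := (((hasDerivAt_fst hΩ hu hp).const_mul ν).const_add (μ * p.2)).sub_const c
      exact (hτ _).comp p.1 this
  have hτt : ∀ p ∈ Ω, HasDerivAt (fun t => τ (Y (p.1, t) - c))
      (τ' (Y p - c) * (μ + ν * pdt u p)) p.2 := fun p hp => by
    have h2 : HasDerivAt (fun t => Y (p.1, t) - c) (μ * 1 + ν * pdt u p) p.2 :=
      (((hasDerivAt_id p.2).const_mul μ).fun_add
        ((hasDerivAt_snd hΩ hu hp).const_mul ν)).sub_const c
    rw [mul_one] at h2
    exact (hτ _).comp p.2 h2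
  -- the fields
  set f : ℝ × ℝ → ℝ := fun p => (p.2 - b) * (b + 1 - p.2) * (τ (Y p - c) * (pds u p / gradW u p))
    with hf
  set f' : ℝ × ℝ → ℝ := fun p => (p.2 - b) * (b + 1 - p.2) *
    (τ' (Y p - c) * (ν * pds u p) * (pds u p / gradW u p) + τ (Y p - c) * dsFlux u p) with hf'
  set g : ℝ × ℝ → ℝ := fun p => (p.2 - b) * (b + 1 - p.2) * (τ (Y p - c) * (pdt u p / gradW u p))
    with hg
  set g' : ℝ × ℝ → ℝ := fun p => (b + 1 - p.2 - (p.2 - b)) * (τ (Y p - c) * (pdt u p / gradW u p))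
    + (p.2 - b) * (b + 1 - p.2) *
    (τ' (Y p - c) * (μ + ν * pdt u p) * (pdt u p / gradW u p) + τ (Y p - c) * dtFlux u p) with hg'
  set k : ℝ × ℝ → ℝ := fun p => (p.2 - b) * (b + 1 - p.2) * (τ' (Y p - c) * |ν * pds u p|) with hk
  set φ : ℝ × ℝ → ℝ := fun p => τ (Y p - c) with hφ
  set φ' : ℝ × ℝ → ℝ := fun p => τ' (Y p - c) * (ν * pds u p) with hφ'
  have gl : ∀ F : ℝ × ℝ → ℝ, ContinuousOn F Ω →
      (∀ p, τ (Y p - c) = 0 → τ' (Y p - c) = 0 → F p = 0) →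
      ContinuousOn (D.indicator F) R := fun F hF hF0 =>
    continuousOn_indicator_glue hDo hZ hZD (hF.mono hDΩ) fun p hp hpR hpZ => by
      have := h0 _ (hYlt p hp hpR.2.1 hpR.2.2 hpZ)
      exact hF0 p this.1 this.2
  have cf' : ContinuousOn (D.indicator f') R :=
    gl f' (cη.mul (((cτ'.mul (continuousOn_const.mul cus)).mul (cus.div cW hW0)).add (cτ.mul cds)))
      fun p e1 e2 => by simp [hf', e1, e2]
  have cg : ContinuousOn (D.indicator g) R :=
    gl g (cη.mul (cτ.mul (cut.div cW hW0))) fun p e1 e2 => by simp [hg, e1]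
  have cg' : ContinuousOn (D.indicator g') R :=
    gl g' ((cη'.mul (cτ.mul (cut.div cW hW0))).add
      (cη.mul (((cτ'.mul (continuousOn_const.add (continuousOn_const.mul cut))).mul
        (cut.div cW hW0)).add (cτ.mul cdt))))
      fun p e1 e2 => by simp [hg', e1, e2]
  have ck : ContinuousOn (D.indicator k) R :=
    gl k (cη.mul (cτ'.mul (continuousOn_const.mul cus).abs)) fun p e1 e2 => by simp [hk, e2]
  have cφ' : ContinuousOn (D.indicator φ') R :=
    gl φ' (cτ'.mul (continuousOn_const.mul cus)) fun p e1 e2 => by simp [hφ', e2]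
  have hend : ∀ x t : ℝ, w < |x| → (x, t) ∉ D := fun x t hx hp => absurd (hDw _ hp) (not_le.2 hx)
  have hae : w < |a| := by rw [abs_of_nonneg (by linarith)]; linarith
  have hae' : w < |(-a)| := by rwa [abs_neg]
  have slice1 : ∀ {F : ℝ × ℝ → ℝ}, ContinuousOn F R → ∀ t ∈ Set.Icc b (b + 1),
      ContinuousOn (fun s => F (s, t)) (Set.Icc (-a) a) := fun hF t ht =>
    hF.comp (by fun_prop) fun s hs => ⟨hs, ht⟩
  have slice2 : ∀ {F : ℝ × ℝ → ℝ}, ContinuousOn F R → ∀ s ∈ Set.Icc (-a) a,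
      ContinuousOn (fun t => F (s, t)) (Set.Icc b (b + 1)) := fun hF s hs =>
    hF.comp (by fun_prop) fun t ht => ⟨hs, ht⟩
  have haa : -a ≤ a := by linarith
  have hbb : b ≤ b + 1 := by linarith
  have van : ∀ p ∈ D, p ∈ {p : ℝ × ℝ | b ≤ p.2 ∧ p.2 ≤ b + 1} → p ∉ Z → τ (Y p - c) = 0 :=
    fun p hp hpS hpZ => (h0 _ (hYlt p hp hpS.1 hpS.2 hpZ)).1
  have If : ∀ t ∈ Set.Icc b (b + 1), ∫ s in (-a)..a, D.indicator f' (s, t) = 0 := fun t ht => by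
    rw [intervalIntegral.integral_eq_sub_of_hasDerivAt
      (f := fun s => D.indicator f (s, t)) (fun s _ => ?_)
      (ContinuousOn.intervalIntegrable (by rw [Set.uIcc_of_le haa]; exact slice1 cf' t ht))]
    · rw [Set.indicator_of_notMem (hend _ _ hae), Set.indicator_of_notMem (hend _ _ hae'), sub_zero]
    · refine hasDerivAt_indicator_glue (c := fun s => (s, t)) hDo hZ hZD (by fun_prop)
        (St := {p | b ≤ p.2 ∧ p.2 ≤ b + 1}) (Filter.Eventually.of_forall fun s => ht) (fun hp => ?_)
        fun p hp hpS hpZ => by simp [hf, van p hp hpS hpZ]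
      exact (((hτs _ (hDΩ hp)).fun_mul (hasDerivAt_dsFlux hΩ hu (hDΩ hp))).const_mul
        ((t - b) * (b + 1 - t)))
  have Ig : ∀ s ∈ Set.Icc (-a) a, ∫ t in b..(b + 1), D.indicator g' (s, t) = 0 := fun s hs => by
    rw [intervalIntegral.integral_eq_sub_of_hasDerivAt_of_le hbb
      (f := fun t => D.indicator g (s, t)) (slice2 cg s hs) (fun t ht => ?_)
      (ContinuousOn.intervalIntegrable (by rw [Set.uIcc_of_le hbb]; exact slice2 cg' s hs))]
    · have e1 : D.indicator g (s, b + 1) = 0 := by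
        by_cases h : (s, b + 1) ∈ D
        · rw [Set.indicator_of_mem h]; simp [hg]
        · exact Set.indicator_of_notMem h _
      have e2 : D.indicator g (s, b) = 0 := by
        by_cases h : (s, b) ∈ D
        · rw [Set.indicator_of_mem h]; simp [hg]
        · exact Set.indicator_of_notMem h _
      rw [e1, e2, sub_zero]
    · refine hasDerivAt_indicator_glue (c := fun t => (s, t)) hDo hZ hZD (by fun_prop)
        (St := {p | b ≤ p.2 ∧ p.2 ≤ b + 1}) ?_ (fun hp => ?_)
        fun p hp hpS hpZ => by simp [hg, van p hp hpS hpZ]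
      · filter_upwards [Ioo_mem_nhds ht.1 ht.2] with t' ht'
        exact ⟨ht'.1.le, ht'.2.le⟩
      · have e1 : HasDerivAt (fun t : ℝ => (t - b) * (b + 1 - t)) (b + 1 - t - (t - b)) t := by
          have := ((hasDerivAt_id t).sub_const b).fun_mul ((hasDerivAt_id t).const_sub (b + 1))
          refine this.congr_deriv ?_
          simp only [id]; ring
        exact e1.fun_mul ((hτt _ (hDΩ hp)).fun_mul (hasDerivAt_dtFlux hΩ hu (hDΩ hp)))
  have Ik : ∀ t ∈ Set.Icc b (b + 1),
      (t - b) * (b + 1 - t) ≤ ∫ s in (-a)..a, D.indicator k (s, t) := fun t ht => by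
    obtain ⟨x, hx, hxY⟩ := hpt t ht.1 ht.2
    have hxw := abs_le.1 (hDw _ hx)
    simp only at hxw
    have hx1 : -a ≤ x := by linarith
    have hx2 : x ≤ a := by linarith
    have cφs := slice1 cφ' t ht
    have e1 : ∫ s in (-a)..x, D.indicator φ' (s, t) = 1 := by
      rw [intervalIntegral.integral_eq_sub_of_hasDerivAt
        (f := fun s => D.indicator φ (s, t)) (fun s _ => ?_)
        (ContinuousOn.intervalIntegrable (by
          rw [Set.uIcc_of_le hx1]; exact cφs.mono (Set.Icc_subset_Icc_right hx2)))]
      · rw [Set.indicator_of_notMem (hend _ _ hae'), Set.indicator_of_mem hx, sub_zero]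
        exact h1 _ (by simp only [hY]; linarith)
      · refine hasDerivAt_indicator_glue (c := fun s => (s, t)) hDo hZ hZD (by fun_prop)
          (St := {p | b ≤ p.2 ∧ p.2 ≤ b + 1}) (Filter.Eventually.of_forall fun s => ht)
          (fun hp => hτs _ (hDΩ hp)) fun p hp hpS hpZ => van p hp hpS hpZ
    have hη : 0 ≤ (t - b) * (b + 1 - t) := mul_nonneg (by linarith [ht.1]) (by linarith [ht.2])
    have e2 : ∫ s in (-a)..a, D.indicator k (s, t) =
        (t - b) * (b + 1 - t) * ∫ s in (-a)..a, |D.indicator φ' (s, t)| := by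
      rw [← intervalIntegral.integral_const_mul]
      congr 1; funext s
      by_cases h : (s, t) ∈ D
      · rw [Set.indicator_of_mem h, Set.indicator_of_mem h, hφ', abs_mul (τ' _),
          abs_of_nonneg (hb' _).1]
      · rw [Set.indicator_of_notMem h, Set.indicator_of_notMem h, abs_zero, mul_zero]
    rw [e2]
    refine le_mul_of_one_le_right hη ?_
    have i1 : IntervalIntegrable (fun s => |D.indicator φ' (s, t)|) volume (-a) a :=
      ContinuousOn.intervalIntegrable (by rw [Set.uIcc_of_le haa]; exact cφs.abs)
    calc (1 : ℝ) = ∫ s in (-a)..x, D.indicator φ' (s, t) := e1.symm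
      _ ≤ |∫ s in (-a)..x, D.indicator φ' (s, t)| := le_abs_self _
      _ ≤ ∫ s in (-a)..x, |D.indicator φ' (s, t)| :=
        intervalIntegral.abs_integral_le_integral_abs hx1
      _ ≤ ∫ s in (-a)..a, |D.indicator φ' (s, t)| :=
        intervalIntegral.integral_mono_interval le_rfl hx1 hx2
          (Filter.Eventually.of_forall fun s => abs_nonneg _) i1
  have Jf : ∫ z in R, D.indicator f' z = 0 := by
    rw [(setIntegral_rect haa hbb cf').2]
    rw [intervalIntegral.integral_congr (g := fun _ => 0) fun t ht =>
      If t (by rwa [Set.uIcc_of_le hbb] at ht)]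
    simp
  have Jg : ∫ z in R, D.indicator g' z = 0 := by
    rw [(setIntegral_rect haa hbb cg').1]
    rw [intervalIntegral.integral_congr (g := fun _ => 0) fun s hs =>
      Ig s (by rwa [Set.uIcc_of_le haa] at hs)]
    simp
  have hRc : IsCompact R := isCompact_Icc.prod isCompact_Icc
  have Jk : 1 / 6 ≤ ∫ z in R, D.indicator k z := by
    rw [(setIntegral_rect haa hbb ck).2, ← integral_parabola b]
    refine intervalIntegral.integral_mono_on hbb
      ((by fun_prop : Continuous fun t : ℝ => (t - b) * (b + 1 - t)).intervalIntegrable _ _) ?_ Ik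
    have hint : IntegrableOn (fun z : ℝ × ℝ => D.indicator k z.swap)
        (Set.Icc b (b + 1) ×ˢ Set.Icc (-a) a) (volume.prod volume) := by
      refine ContinuousOn.integrableOn_compact (isCompact_Icc.prod isCompact_Icc) ?_
      exact ck.comp continuous_swap.continuousOn fun z hz => ⟨hz.2, hz.1⟩
    rw [IntegrableOn, ← Measure.prod_restrict] at hint
    have h2 := hint.integral_prod_left
    rw [intervalIntegrable_iff_integrableOn_Icc_of_le hbb]
    refine h2.congr (Filter.Eventually.of_forall fun t => ?_)
    simp only [Prod.swap_prod_mk]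
    rw [intervalIntegral.integral_of_le haa, integral_Icc_eq_integral_Ioc]
  obtain ⟨s, hs, hsν⟩ : ∃ s : ℝ, |s| = 1 ∧ s * ν = |ν| := by
    rcases le_total 0 ν with h | h
    · exact ⟨1, by simp, by rw [abs_of_nonneg h, one_mul]⟩
    · exact ⟨-1, by simp, by rw [abs_of_nonpos h]; ring⟩
  have hpoint : ∀ z ∈ R, D.indicator k z ≤ s * (D.indicator f' z + D.indicator g' z) +
      (3 + 2 * C) * D.indicator 1 z := fun z hz => by
    by_cases hzD : z ∈ D
    · simp only [Set.indicator_of_mem hzD]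
      have hη0 : 0 ≤ (z.2 - b) * (b + 1 - z.2) :=
        mul_nonneg (by linarith [hz.2.1]) (by linarith [hz.2.2])
      have hη1 : (z.2 - b) * (b + 1 - z.2) ≤ 1 := by nlinarith [hz.2.1, hz.2.2]
      have hη' : |b + 1 - z.2 - (z.2 - b)| ≤ 1 := abs_le.2
        ⟨by linarith [hz.2.2], by linarith [hz.2.1]⟩
      have := flux_bound (a := pds u z) (d := pdt u z) (gradW_pos u z) (gradW_sq u z) hκ hσ hμ hs
        hsν hν1 ⟨hη0, hη1⟩ hη' (hb (Y z - c)) (hb' (Y z - c))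
      rw [← dsFlux_add_dtFlux hΩ hu (hDΩ hzD) (heq z (hDΩ hzD))] at this
      simp only [hk, hf', hg', Pi.one_apply, mul_one]
      refine this.trans (le_of_eq ?_)
      ring
    · simp only [Set.indicator_of_notMem hzD]; simp
  have if' : IntegrableOn (D.indicator f') R := cf'.integrableOn_compact hRc
  have ig' : IntegrableOn (D.indicator g') R := cg'.integrableOn_compact hRc
  have i1 : IntegrableOn (D.indicator (1 : ℝ × ℝ → ℝ)) R :=
    (integrableOn_const hRc.measure_lt_top.ne (C := (1 : ℝ))).indicator hDo.measurableSet
  have iab : IntegrableOn (fun z => D.indicator f' z + D.indicator g' z) R := if'.add ig'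
  have ia : IntegrableOn (fun z => s * (D.indicator f' z + D.indicator g' z)) R :=
    iab.const_mul s
  have ib : IntegrableOn (fun z => (3 + 2 * C) * D.indicator (1 : ℝ × ℝ → ℝ) z) R :=
    i1.const_mul (3 + 2 * C)
  have iabs : IntegrableOn (fun z => s * (D.indicator f' z + D.indicator g' z) +
      (3 + 2 * C) * D.indicator 1 z) R := ia.add ib
  have hmono := setIntegral_mono_on (ck.integrableOn_compact hRc) iabs hRc.measurableSet hpoint
  have hcalc : ∫ z in R, (s * (D.indicator f' z + D.indicator g' z) +
      (3 + 2 * C) * D.indicator 1 z) = (3 + 2 * C) * volume.real (D ∩ R) := by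
    have e1 := integral_add ia ib
    have e2 := integral_add if' ig'
    rw [e1, integral_const_mul, integral_const_mul, e2, Jf, Jg,
      integral_indicator_one hDo.measurableSet, measureReal_restrict_apply hDo.measurableSet]
    ring
  have hDR : D ∩ R = D ∩ {p | b ≤ p.2 ∧ p.2 ≤ b + 1} := by
    ext p
    constructor
    · rintro ⟨hp1, hp2⟩; exact ⟨hp1, hp2.2.1, hp2.2.2⟩
    · rintro ⟨hp1, hp2⟩
      have := abs_le.1 (hDw p hp1)
      exact ⟨hp1, ⟨by linarith, by linarith⟩, hp2.1, hp2.2⟩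
  rw [← hDR, ← hcalc]
  exact Jk.trans hmono

end AreaBound

/-- A lower area bound for the components of a superlevel set in a strip: either they touch the
boundary of `Ω`, or a piece of them of height one has area at least `ε`. -/
def AreaProperty (Ω : Set (ℝ × ℝ)) (u : ℝ × ℝ → ℝ) (m : ℝ × ℝ × ℝ) (ε : ℝ) : Prop :=
  ∀ (c B b T : ℝ) (p₀ : ℝ × ℝ), B < b → b + 1 < T →
    (∀ t, b ≤ t → t ≤ b + 1 → ∃ x : ℝ,
      (x, t) ∈ connectedComponentIn (superlevel Ω u m c ∩ {p | B < p.2 ∧ p.2 < T}) p₀ ∧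
      c + 1 ≤ dot3 m (graph3 u (x, t))) →
    (∃ s ∈ closure (connectedComponentIn (superlevel Ω u m c ∩ {p | B < p.2 ∧ p.2 < T}) p₀),
      s ∉ Ω ∧ b ≤ s.2 ∧ s.2 ≤ b + 1) ∨
    ε ≤ volume.real (connectedComponentIn (superlevel Ω u m c ∩ {p | B < p.2 ∧ p.2 < T}) p₀ ∩
      {p | b ≤ p.2 ∧ p.2 ≤ b + 1})

section AreaProperty

variable {e : ℝ × ℝ × ℝ} {w κ σ μ ν : ℝ} {Ω : Set (ℝ × ℝ)} {u : ℝ × ℝ → ℝ}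
  {n : ℝ × ℝ → ℝ × ℝ × ℝ}

lemma isOpen_strip (B T : ℝ) : IsOpen {p : ℝ × ℝ | B < p.2 ∧ p.2 < T} :=
  (isOpen_lt continuous_const continuous_snd).inter (isOpen_lt continuous_snd continuous_const)

lemma SlabSoliton.exists_areaProperty (H : SlabSoliton e w Ω u n)
    (hu : ContDiffOn ℝ (⊤ : ℕ∞) u Ω)
    (heq : ∀ p ∈ Ω, TranslatorEq κ σ u p) (hκ : |κ| ≤ 1) (hσ : |σ| ≤ 1) (hμ : |μ| ≤ 1)
    (hν : |ν| ≤ 1) : ∃ ε : ℝ, 0 < ε ∧ AreaProperty Ω u (0, μ, ν) ε := by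
  obtain ⟨τ, τ', C, h1, h2, h3, h4, h5, h6⟩ := exists_cutoff
  have hC : 0 ≤ C := (h6 0).1.trans (h6 0).2
  have hC' : 0 < 3 + 2 * C := by positivity
  have hw : 0 ≤ w := by
    obtain ⟨p, hp⟩ := H.isConnected.nonempty
    exact (abs_nonneg _).trans (H.abs_fst_le p hp)
  have hY : ∀ p : ℝ × ℝ, dot3 (0, μ, ν) (graph3 u p) = μ * p.2 + ν * u p := fun p => by
    simp [dot3, graph3]
  refine ⟨1 / (6 * (3 + 2 * C)), by positivity, fun c B b T p₀ hB hT hpt => ?_⟩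
  set F := superlevel Ω u (0, μ, ν) c ∩ {p | B < p.2 ∧ p.2 < T} with hF
  by_cases hs : ∃ s ∈ closure (connectedComponentIn F p₀), s ∉ Ω ∧ b ≤ s.2 ∧ s.2 ≤ b + 1
  · exact Or.inl hs
  refine Or.inr ?_
  push Not at hs
  have hp₀ : p₀ ∈ F := by
    obtain ⟨x, hx, -⟩ := hpt b le_rfl (by linarith)
    exact connectedComponentIn_nonempty_iff.1 ⟨_, hx⟩
  have hsub : connectedComponentIn F p₀ ⊆ F := connectedComponentIn_subset _ _
  have hcl : ∀ p ∈ closure (connectedComponentIn F p₀), b ≤ p.2 → p.2 ≤ b + 1 → p ∈ Ω := by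
    intro p hp hp1 hp2
    by_contra hpn
    exact absurd hp2 (not_le.2 (hs p hp hpn hp1))
  have key := area_bound (D := connectedComponentIn F p₀) (c := c) H.isOpen hu heq hκ hσ hμ hν h1 h2
    h3 h4 h5 h6 hw ((H.isOpen_superlevel _ c).inter (isOpen_strip B T)).connectedComponentIn
    (fun p hp => (hsub hp).1.1) (fun p hp => H.abs_fst_le p (hsub hp).1.1) hcl
    (fun p hp hp1 hp2 hpc => mem_connectedComponentIn_of_mem_closure hp₀
      ⟨⟨hcl p hp hp1 hp2, by rw [hY]; exact hpc⟩, by linarith, by linarith⟩ hp)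
    (fun t ht1 ht2 => by
      obtain ⟨x, hx, hx'⟩ := hpt t ht1 ht2
      exact ⟨x, hx, by rw [hY] at hx'; exact hx'⟩)
  rw [div_le_iff₀ (by positivity)]
  linarith only [key]

end AreaProperty

/-- The rotation by `π` about the first axis. -/
def neg23 (P : ℝ × ℝ × ℝ) : ℝ × ℝ × ℝ := (P.1, -P.2.1, -P.2.2)

/-- The reflection of the plane in the first axis. -/
def reflSnd : ℝ × ℝ ≃ₜ ℝ × ℝ := (Homeomorph.refl ℝ).prodCongr (Homeomorph.neg ℝ)

/-- The function whose graph is obtained from that of `u` by the rotation `neg23`. -/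
def flipFun (u : ℝ × ℝ → ℝ) (p : ℝ × ℝ) : ℝ := -u (reflSnd p)

section Flip

variable {e m : ℝ × ℝ × ℝ} {w ε : ℝ} {Ω : Set (ℝ × ℝ)} {u : ℝ × ℝ → ℝ} {n : ℝ × ℝ → ℝ × ℝ × ℝ}

@[simp] lemma reflSnd_fst (p : ℝ × ℝ) : (reflSnd p).1 = p.1 := rfl

@[simp] lemma reflSnd_snd (p : ℝ × ℝ) : (reflSnd p).2 = -p.2 := rfl

lemma reflSnd_reflSnd (p : ℝ × ℝ) : reflSnd (reflSnd p) = p :=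
  Prod.ext rfl (neg_neg p.2)

lemma neg23_neg23 (P : ℝ × ℝ × ℝ) : neg23 (neg23 P) = P := by
  simp [neg23]

lemma dot3_neg23 (P Q : ℝ × ℝ × ℝ) : dot3 (neg23 P) Q = dot3 P (neg23 Q) := by
  simp [neg23, dot3]

lemma graph3_flipFun (u : ℝ × ℝ → ℝ) (p : ℝ × ℝ) :
    graph3 (flipFun u) p = neg23 (graph3 u (reflSnd p)) := by
  simp [graph3, flipFun, neg23]

lemma expSum_neg23 (L : List (ℝ × (ℝ × ℝ × ℝ))) (l P : ℝ × ℝ × ℝ) :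
    expSum L l (neg23 P) = expSum (L.map fun a => (a.1, neg23 a.2)) (neg23 l) P := by
  simp [expSum, dot3_neg23, Function.comp_def]

lemma driftLap_neg23 (e N : ℝ × ℝ × ℝ) (L : List (ℝ × (ℝ × ℝ × ℝ))) (l P : ℝ × ℝ × ℝ) :
    driftLap (neg23 e) (neg23 N) L l (neg23 P) =
      driftLap e N (L.map fun a => (a.1, neg23 a.2)) (neg23 l) P := by
  have h : ∀ a b, dot3 a (neg23 b) = dot3 (neg23 a) b := fun a b => (dot3_neg23 a b).symm
  simp only [driftLap, List.map_map, Function.comp_def, h, neg23_neg23]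

lemma superlevel_flip (Ω : Set (ℝ × ℝ)) (u : ℝ × ℝ → ℝ) (m : ℝ × ℝ × ℝ) (c : ℝ) :
    superlevel (reflSnd ⁻¹' Ω) (flipFun u) (neg23 m) c = reflSnd ⁻¹' superlevel Ω u m c := by
  ext p
  simp [superlevel, graph3_flipFun, dot3_neg23, neg23_neg23]

lemma connectedComponentIn_reflSnd (F : Set (ℝ × ℝ)) (p : ℝ × ℝ) :
    connectedComponentIn (reflSnd ⁻¹' F) p = reflSnd ⁻¹' connectedComponentIn F (reflSnd p) := by
  by_cases hp : reflSnd p ∈ F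
  · have h := reflSnd.symm.image_connectedComponentIn (s := F) hp
    rw [Homeomorph.symm_apply_apply, Homeomorph.image_symm] at h
    exact h.symm
  · rw [connectedComponentIn_eq_empty hp, connectedComponentIn_eq_empty (F := reflSnd ⁻¹' F) hp,
      Set.preimage_empty]

lemma measurePreserving_reflSnd : MeasurePreserving reflSnd (volume : Measure (ℝ × ℝ)) volume :=
  (MeasurePreserving.id (volume : Measure ℝ)).prod (Measure.measurePreserving_neg volume)

lemma SlabSoliton.flip (H : SlabSoliton e w Ω u n) :
    SlabSoliton (neg23 e) w (reflSnd ⁻¹' Ω) (flipFun u) (fun p => neg23 (n (reflSnd p))) where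
  isOpen := H.isOpen.preimage reflSnd.continuous
  isConnected := by
    rw [← Homeomorph.image_symm]
    exact H.isConnected.image _ reflSnd.symm.continuous.continuousOn
  abs_fst_le p hp := H.abs_fst_le (reflSnd p) hp
  continuousOn := (H.continuousOn.comp reflSnd.continuous.continuousOn fun _ h => h).neg
  isClosed := by
    have h : Continuous neg23 := by unfold neg23; fun_prop
    convert H.isClosed.preimage h using 1
    ext P
    simp only [Set.mem_ofPred_eq, Set.mem_preimage, flipFun, neg23]
    have e1 : reflSnd (P.1, P.2.1) = (P.1, -P.2.1) := rfl
    rw [e1, neg_eq_iff_eq_neg]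
  fst_dir := H.fst_dir
  dot_dir := by rw [dot3_neg23, neg23_neg23]; exact H.dot_dir
  dot_normal p hp := by rw [dot3_neg23, neg23_neg23]; exact H.dot_normal _ hp
  max_le L l p hp hmax := by
    rw [graph3_flipFun, driftLap_neg23]
    refine H.max_le _ _ _ hp ?_
    have hc : Filter.Tendsto reflSnd (𝓝 (reflSnd p)) (𝓝 p) := by
      have := reflSnd.continuous.tendsto (reflSnd p)
      rwa [reflSnd_reflSnd] at this
    refine (hc.eventually hmax).mono fun q hq => ?_
    simpa only [graph3_flipFun, reflSnd_reflSnd, expSum_neg23] using hq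

lemma AreaProperty.flip (h : AreaProperty Ω u m ε) :
    AreaProperty (reflSnd ⁻¹' Ω) (flipFun u) (neg23 m) ε := by
  intro c B b T p₀ hB hT hpt
  have hF : superlevel (reflSnd ⁻¹' Ω) (flipFun u) (neg23 m) c ∩ {p | B < p.2 ∧ p.2 < T} =
      reflSnd ⁻¹' (superlevel Ω u m c ∩ {p | -T < p.2 ∧ p.2 < -B}) := by
    rw [superlevel_flip, Set.preimage_inter]
    congr 1
    ext p
    simp only [Set.mem_ofPred_eq, Set.mem_preimage, reflSnd_snd, neg_lt_neg_iff]
    exact and_comm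
  rw [hF, connectedComponentIn_reflSnd] at hpt ⊢
  set D := connectedComponentIn (superlevel Ω u m c ∩ {p | -T < p.2 ∧ p.2 < -B}) (reflSnd p₀)
    with hD
  have hpt' : ∀ t, -(b + 1) ≤ t → t ≤ -(b + 1) + 1 → ∃ x : ℝ, (x, t) ∈ D ∧
      c + 1 ≤ dot3 m (graph3 u (x, t)) := by
    intro t h1 h2
    obtain ⟨x, hx, hx'⟩ := hpt (-t) (by linarith) (by linarith)
    have e1 : reflSnd (x, -t) = (x, t) := Prod.ext rfl (neg_neg t)
    refine ⟨x, by rw [← e1]; exact hx, ?_⟩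
    rwa [graph3_flipFun, dot3_neg23, neg23_neg23, e1] at hx'
  rcases h c (-T) (-(b + 1)) (-B) (reflSnd p₀) (by linarith) (by linarith) hpt' with
    ⟨s, hs, hsΩ, h1, h2⟩ | harea
  · refine Or.inl ⟨reflSnd s, ?_, ?_, ?_, ?_⟩
    · rw [← Homeomorph.preimage_closure, Set.mem_preimage, reflSnd_reflSnd]; exact hs
    · rwa [Set.mem_preimage, reflSnd_reflSnd]
    · rw [reflSnd_snd]; linarith
    · rw [reflSnd_snd]; linarith
  · refine Or.inr (harea.trans (le_of_eq ?_))
    rw [measureReal_def, measureReal_def, ← measurePreserving_reflSnd.measure_preimage_equiv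
      (f := reflSnd.toMeasurableEquiv)]
    congr 2
    ext p
    simp only [Set.mem_inter_iff, Set.mem_ofPred_eq, Set.mem_preimage]
    refine and_congr Iff.rfl ?_
    change -(b + 1) ≤ -p.2 ∧ -p.2 ≤ -(b + 1) + 1 ↔ _
    constructor <;> rintro ⟨h1, h2⟩ <;> constructor <;> linarith

end Flip

section Crossing

/-- The change of a continuous argument of a curve contained in a closed half-plane. -/
lemma im_sub_eq_of_halfPlane {g L : ℝ → ℂ} (hg : Continuous g) (hL : Continuous L)
    (hexp : ∀ r, Complex.exp (L r) = g r) {c : ℂ} (hc : c ≠ 0) (h : ∀ r, 0 ≤ (c * g r).re) :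
    (L 1).im - (L 0).im = Complex.arg (c * g 1) - Complex.arg (c * g 0) := by
  have h0 : ∀ r, c * g r ≠ 0 := fun r => mul_ne_zero hc (by rw [← hexp]; exact Complex.exp_ne_zero _)
  have hsl : ∀ r, c * g r ∈ Complex.slitPlane := by
    intro r
    rw [Complex.mem_slitPlane_iff]
    rcases (h r).lt_or_eq with h1 | h1
    · exact Or.inl h1
    · exact Or.inr fun h2 => h0 r (Complex.ext h1.symm h2)
  have hd : Continuous fun r => L r - Complex.log (c * g r) :=
    hL.sub ((continuous_const.mul hg).clog hsl)
  have hconst : ∀ r, Complex.exp (L r - Complex.log (c * g r)) = c⁻¹ := by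
    intro r
    have := h0 r
    rw [Complex.exp_sub, Complex.exp_log this, hexp, div_eq_iff this, inv_mul_cancel_left₀ hc]
  obtain ⟨F, -, hF⟩ := Complex.isCoveringMapOn_exp.existsUnique_continuousMap_lifts
    (ContinuousMap.const ℝ c⁻¹) (a₀ := 0) (e₀ := L 0 - Complex.log (c * g 0)) (hconst 0)
    fun _ => inv_ne_zero hc
  have e1 := hF ⟨_, hd⟩ ⟨rfl, funext hconst⟩
  have e2 := hF (ContinuousMap.const ℝ (L 0 - Complex.log (c * g 0)))
    ⟨rfl, funext fun _ => hconst 0⟩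
  have e3 : L 1 - Complex.log (c * g 1) = L 0 - Complex.log (c * g 0) :=
    DFunLike.congr_fun (e1.trans e2.symm) 1
  have e4 := congrArg Complex.im e3
  simp only [Complex.sub_im, Complex.log_im] at e4
  linarith

lemma arg_I_mul_ofReal {r : ℝ} (hr : 0 < r) : Complex.arg (Complex.I * r) = π / 2 := by
  rw [Complex.arg_mul_real hr, Complex.arg_I]

lemma arg_neg_I_mul_ofReal {r : ℝ} (hr : 0 < r) : Complex.arg (-Complex.I * r) = -(π / 2) := by
  rw [Complex.arg_mul_real hr, Complex.arg_neg_I]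

lemma arg_I_mul_ofReal_of_neg {r : ℝ} (hr : r < 0) : Complex.arg (Complex.I * r) = -(π / 2) := by
  rw [← arg_neg_I_mul_ofReal (neg_pos.2 hr)]
  push_cast
  ring_nf

lemma arg_neg_I_mul_ofReal_of_neg {r : ℝ} (hr : r < 0) :
    Complex.arg (-Complex.I * r) = π / 2 := by
  rw [← arg_I_mul_ofReal (neg_pos.2 hr)]
  push_cast
  ring_nf

lemma exists_crossing_aux {T g₁ g₂ g₃ x : ℝ} (p : Path (g₁, T) (g₃, T))
    (q : Path (g₂, T) (x, T)) (hp : ∀ r, (p r).2 ≤ T) (hq : ∀ r, (q r).2 ≤ T) (h₁ : g₁ < g₂)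
    (h₂ : g₂ < g₃) (h₃ : g₃ < x) : ∃ r s, p r = q s := by
  by_contra! hne
  let H : ℝ × ℝ → ℂ := fun z => ⟨(p.extend z.1).1 - (q.extend z.2).1,
    (p.extend z.1).2 - (q.extend z.2).2⟩
  have hH : Continuous H := by
    have e : H = fun z => (((p.extend z.1).1 - (q.extend z.2).1 : ℝ) : ℂ) +
        (((p.extend z.1).2 - (q.extend z.2).2 : ℝ) : ℂ) * Complex.I := by
      funext z
      exact (Complex.mk_eq_add_mul_I _ _)
    rw [e]
    have c1 := p.continuous_extend
    have c2 := q.continuous_extend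
    fun_prop
  have hH0 : ∀ z, H z ≠ 0 := by
    intro z hz
    have e1 := congrArg Complex.re hz
    have e2 := congrArg Complex.im hz
    exact hne (Set.projIcc 0 1 zero_le_one z.1) (Set.projIcc 0 1 zero_le_one z.2)
      (Prod.ext (sub_eq_zero.1 e1) (sub_eq_zero.1 e2))
  have hp' : ∀ r, (p.extend r).2 ≤ T := fun r => hp _
  have hq' : ∀ r, (q.extend r).2 ≤ T := fun r => hq _
  obtain ⟨L, ⟨-, hL⟩, -⟩ := Complex.isCoveringMapOn_exp.existsUnique_continuousMap_lifts
    (⟨H, hH⟩ : C(ℝ × ℝ, ℂ)) (a₀ := (0, 0)) (Complex.exp_log (hH0 (0, 0))) hH0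
  have hL' : ∀ z, Complex.exp (L z) = H z := fun z => congrFun hL z
  have E1 := im_sub_eq_of_halfPlane (g := fun b => H (0, b)) (L := fun b => L (0, b))
    (by fun_prop) (by fun_prop) (fun _ => hL' _) (c := -Complex.I) (by simp)
    (fun r => by simpa [H] using hq' r)
  have E2 := im_sub_eq_of_halfPlane (g := fun b => H (1, b)) (L := fun b => L (1, b))
    (by fun_prop) (by fun_prop) (fun _ => hL' _) (c := -Complex.I) (by simp)
    (fun r => by simpa [H] using hq' r)
  have E3 := im_sub_eq_of_halfPlane (g := fun a => H (a, 0)) (L := fun a => L (a, 0))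
    (by fun_prop) (by fun_prop) (fun _ => hL' _) (c := Complex.I) (by simp)
    (fun r => by simpa [H] using hp' r)
  have E4 := im_sub_eq_of_halfPlane (g := fun a => H (a, 1)) (L := fun a => L (a, 1))
    (by fun_prop) (by fun_prop) (fun _ => hL' _) (c := Complex.I) (by simp)
    (fun r => by simpa [H] using hp' r)
  have v00 : H (0, 0) = ((g₁ - g₂ : ℝ) : ℂ) := by
    apply Complex.ext <;> simp [H]
  have v01 : H (0, 1) = ((g₁ - x : ℝ) : ℂ) := by
    apply Complex.ext <;> simp [H]
  have v10 : H (1, 0) = ((g₃ - g₂ : ℝ) : ℂ) := by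
    apply Complex.ext <;> simp [H]
  have v11 : H (1, 1) = ((g₃ - x : ℝ) : ℂ) := by
    apply Complex.ext <;> simp [H]
  simp only [v00, v01, v10, v11] at E1 E2 E3 E4
  rw [arg_neg_I_mul_ofReal_of_neg (by linarith), arg_neg_I_mul_ofReal_of_neg (by linarith)] at E1
  rw [arg_neg_I_mul_ofReal_of_neg (by linarith), arg_neg_I_mul_ofReal (by linarith)] at E2
  rw [arg_I_mul_ofReal (by linarith), arg_I_mul_ofReal_of_neg (by linarith)] at E3
  rw [arg_I_mul_ofReal_of_neg (by linarith), arg_I_mul_ofReal_of_neg (by linarith)] at E4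
  linarith [Real.pi_pos]

/-- In a half-plane, a curve joining two boundary points meets every curve joining a boundary
point between them to a boundary point outside of the segment they span. -/
lemma exists_crossing {T g₁ g₂ g₃ x : ℝ} (p : Path (g₁, T) (g₃, T))
    (q : Path (g₂, T) (x, T)) (hp : ∀ r, (p r).2 ≤ T) (hq : ∀ r, (q r).2 ≤ T) (h₁ : g₁ < g₂)
    (h₂ : g₂ < g₃) (h₃ : x < g₁ ∨ g₃ < x) : ∃ r s, p r = q s := by
  rcases h₃ with h₃ | h₃
  · have hc : Continuous fun z : ℝ × ℝ => (-z.1, z.2) := by fun_prop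
    obtain ⟨r, s, h⟩ := exists_crossing_aux (T := T) (g₁ := -g₃) (g₂ := -g₂) (g₃ := -g₁)
      (x := -x) (p.map hc).symm (q.map hc) (fun r => hp _) (fun r => hq _) (by linarith)
      (by linarith) (by linarith)
    refine ⟨unitInterval.symm r, s, ?_⟩
    have h1 := congrArg Prod.fst h
    have h2 := congrArg Prod.snd h
    exact Prod.ext (neg_injective h1) h2
  · exact exists_crossing_aux p q hp hq h₁ h₂ h₃

end Crossing

/-- A curve which goes up from below the level `B` to the level `T` contains an initial arc `Γ`
touching the level `T` only at its end point, and a final piece `Γ'` of that arc lies between the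
two levels. -/
lemma exists_arc_of_joinedIn {D : Set (ℝ × ℝ)} {p q : ℝ × ℝ} {B T : ℝ} (h : JoinedIn D p q)
    (hp : p.2 ≤ B) (hBT : B < T) (hq : T ≤ q.2) :
    ∃ (Γ Γ' : Set (ℝ × ℝ)) (g : ℝ), IsCompact Γ ∧ Γ ⊆ D ∧ (∀ z ∈ Γ, z.2 ≤ T) ∧
      (∀ z ∈ Γ, z.2 = T → z = (g, T)) ∧ JoinedIn Γ p (g, T) ∧ Γ' ⊆ Γ ∧ IsPreconnected Γ' ∧
      (∀ z ∈ Γ', B < z.2 ∧ z.2 < T) ∧ (g, T) ∈ closure Γ' ∧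
      ∀ t, B < t → t < T → ∃ x : ℝ, (x, t) ∈ Γ' := by
  obtain ⟨γ, hγ⟩ := h
  have hc : Continuous γ.extend := γ.continuous_extend
  have hf : Continuous fun r => (γ.extend r).2 := continuous_snd.comp hc
  have hD : ∀ r, γ.extend r ∈ D := fun r => hγ _
  obtain ⟨r₁, ⟨hr₁, hTr₁⟩, hmin⟩ : ∃ r, IsLeast {r ∈ Set.Icc (0 : ℝ) 1 | T ≤ (γ.extend r).2} r := by
    refine IsCompact.exists_isLeast ?_ ⟨1, ⟨by simp, by simpa using hq⟩⟩
    exact isCompact_Icc.inter_right (isClosed_le continuous_const hf)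
  have hlt : ∀ r, 0 ≤ r → r < r₁ → (γ.extend r).2 < T := by
    intro r h0 h1
    by_contra hcon
    exact absurd (hmin ⟨⟨h0, h1.le.trans hr₁.2⟩, not_lt.1 hcon⟩) (not_le.2 h1)
  have h0T : (γ.extend 0).2 < T := by rw [γ.extend_zero]; linarith
  have h0r : 0 < r₁ := by
    rcases hr₁.1.lt_or_eq with h | h
    · exact h
    · rw [← h] at hTr₁; linarith
  have hle : ∀ r, 0 ≤ r → r ≤ r₁ → (γ.extend r).2 ≤ T := by
    intro r h1 h2
    have : r ∈ closure (Set.Ico 0 r₁) := by rw [closure_Ico h0r.ne]; exact ⟨h1, h2⟩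
    exact closure_minimal (fun x hx => (hlt x hx.1 hx.2).le : Set.Ico 0 r₁ ⊆
      {r | (γ.extend r).2 ≤ T}) (isClosed_le hf continuous_const) this
  have heq : (γ.extend r₁).2 = T := le_antisymm (hle r₁ h0r.le le_rfl) hTr₁
  obtain ⟨r₂, ⟨hr₂, hr₂B⟩, hmax⟩ : ∃ r, IsGreatest {r ∈ Set.Icc 0 r₁ | (γ.extend r).2 ≤ B} r := by
    refine IsCompact.exists_isGreatest ?_ ⟨0, ⟨le_rfl, h0r.le⟩, by simpa using hp⟩
    exact isCompact_Icc.inter_right (isClosed_le hf continuous_const)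
  have h21 : r₂ < r₁ := by
    rcases hr₂.2.lt_or_eq with h | h
    · exact h
    · rw [h] at hr₂B; linarith
  have hend : γ.extend r₁ = ((γ.extend r₁).1, T) := Prod.ext rfl heq
  refine ⟨γ.extend '' Set.Icc 0 r₁, γ.extend '' Set.Ioo r₂ r₁, (γ.extend r₁).1,
    isCompact_Icc.image hc, ?_, ?_, ?_, ?_, ?_, ?_, ?_, ?_, ?_⟩
  · rintro _ ⟨r, -, rfl⟩; exact hD r
  · rintro _ ⟨r, hr, rfl⟩; exact hle r hr.1 hr.2
  · rintro _ ⟨r, hr, rfl⟩ hT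
    rcases hr.2.lt_or_eq with h | h
    · exact absurd hT (hlt r hr.1 h).ne
    · rw [h, ← hend]
  · rw [← hend]
    have hj : JoinedIn (γ.extend '' Set.Icc 0 r₁) (γ.extend 0) (γ.extend r₁) := by
      refine ((convex_Icc 0 r₁).isPathConnected ⟨0, ⟨le_rfl, h0r.le⟩⟩ |>.joinedIn 0
        ⟨le_rfl, h0r.le⟩ r₁ ⟨h0r.le, le_rfl⟩).map_continuousOn hc.continuousOn
    rwa [γ.extend_zero] at hj
  · exact Set.image_mono fun r hr => ⟨hr₂.1.trans hr.1.le, hr.2.le⟩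
  · exact isPreconnected_Ioo.image _ hc.continuousOn
  · rintro _ ⟨r, hr, rfl⟩
    refine ⟨?_, hlt r (hr₂.1.trans hr.1.le) hr.2⟩
    by_contra hcon
    exact absurd (hmax ⟨⟨hr₂.1.trans hr.1.le, hr.2.le⟩, not_lt.1 hcon⟩) (not_le.2 hr.1)
  · rw [← hend]
    refine image_closure_subset_closure_image hc ⟨r₁, ?_, rfl⟩
    rw [closure_Ioo h21.ne]
    exact ⟨h21.le, le_rfl⟩
  · intro t h1 h2
    obtain ⟨r, hr, hrt⟩ := intermediate_value_Icc h21.le hf.continuousOn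
      (show t ∈ Set.Icc _ _ from ⟨by linarith, by linarith⟩)
    refine ⟨(γ.extend r).1, r, ⟨lt_of_le_of_ne hr.1 ?_, lt_of_le_of_ne hr.2 ?_⟩,
      Prod.ext rfl hrt⟩
    · rintro rfl
      exact absurd hrt (by simp only; linarith)
    · rintro rfl
      exact absurd hrt (by simp only; linarith)

section Trapped

variable {T g₁ g₂ g₃ : ℝ} {C D : Set (ℝ × ℝ)}

/-- The component of the complement of an arc in a half-plane which contains a boundary point
between the end points of the arc is bounded. -/
lemma exists_trapped_component (h₁ : g₁ < g₂) (h₂ : g₂ < g₃) (hC : IsCompact C)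
    (hCT : ∀ z ∈ C, z.2 ≤ T) (hCe : ∀ z ∈ C, z.2 = T → z.1 = g₁ ∨ z.1 = g₃)
    (hCj : JoinedIn C (g₁, T) (g₃, T)) (hD : IsPreconnected D) (hDT : ∀ z ∈ D, z.2 < T)
    (hDC : ∀ z ∈ D, z ∉ C) (hDg : (g₂, T) ∈ closure D) :
    ∃ G : Set (ℝ × ℝ), IsOpen G ∧ D ⊆ G ∧ IsCompact (closure G) ∧ ∀ y ∈ closure G, y.2 ≤ T ∧
      (y.2 = T → g₁ ≤ y.1 ∧ y.1 ≤ g₃) ∧ (y.2 < T → y ∉ C → y ∈ G) := by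
  obtain ⟨p₀, hp₀⟩ : D.Nonempty := closure_nonempty_iff.1 ⟨_, hDg⟩
  set O : Set (ℝ × ℝ) := {z | z.2 < T} ∩ Cᶜ with hO
  set W : Set (ℝ × ℝ) := {z | z.2 ≤ T} ∩ Cᶜ with hW
  have hOW : O ⊆ W := fun z hz => ⟨(show z.2 < T from hz.1).le, hz.2⟩
  have hOo : IsOpen O :=
    (isOpen_lt continuous_snd continuous_const).inter hC.isClosed.isOpen_compl
  have hDO : D ⊆ O := fun z hz => ⟨hDT z hz, hDC z hz⟩
  set G := connectedComponentIn O p₀ with hG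
  have hGO : G ⊆ O := connectedComponentIn_subset _ _
  have hDG : D ⊆ G := hD.subset_connectedComponentIn hp₀ hDO
  have hGo : IsOpen G := hOo.connectedComponentIn
  have hGp : IsPathConnected G :=
    (hGo.isConnected_iff_isPathConnected).1 ⟨⟨p₀, hDG hp₀⟩, isPreconnected_connectedComponentIn⟩
  have hball : ∀ y : ℝ × ℝ, y.2 = T → y ∉ C → ∃ U ∈ 𝓝 y, ∀ z ∈ U, z.2 ≤ T → JoinedIn W z y := by
    intro y hy hyC
    obtain ⟨r, hr, hrC⟩ := Metric.isOpen_iff.1 hC.isClosed.isOpen_compl y hyC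
    refine ⟨Metric.ball y r, Metric.ball_mem_nhds y hr, fun z hz hzT => ?_⟩
    have hconv : Convex ℝ ({z : ℝ × ℝ | z.2 ≤ T} ∩ Metric.ball y r) :=
      (convex_halfSpace_le (LinearMap.snd ℝ ℝ ℝ).isLinear T).inter (convex_ball y r)
    have hy' : y ∈ {z : ℝ × ℝ | z.2 ≤ T} ∩ Metric.ball y r := ⟨hy.le, Metric.mem_ball_self hr⟩
    exact ((hconv.isPathConnected ⟨y, hy'⟩).joinedIn z ⟨hzT, hz⟩ y hy').mono
      fun z hz => ⟨hz.1, hrC hz.2⟩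
  have hg₂C : (g₂, T) ∉ C := fun h => by
    rcases hCe _ h rfl with h | h <;> simp only at h <;> linarith
  have hstart : ∀ z ∈ G, JoinedIn W (g₂, T) z := by
    intro z hz
    obtain ⟨U, hU, hUj⟩ := hball (g₂, T) rfl hg₂C
    obtain ⟨z', hz'U, hz'D⟩ := mem_closure_iff_nhds.1 hDg U hU
    exact (hUj z' hz'U (hDT z' hz'D).le).symm.trans
      ((hGp.joinedIn z' (hDG hz'D) z hz).mono (hGO.trans hOW))
  have hescape : ∀ z ∈ G, ∀ x : ℝ, JoinedIn W z (x, T) → g₁ ≤ x ∧ x ≤ g₃ := by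
    intro z hz x hzx
    by_contra hcon
    have hx : x < g₁ ∨ g₃ < x := by
      rw [not_and_or, not_le, not_le] at hcon; exact hcon
    obtain ⟨q, hq⟩ := (hstart z hz).trans hzx
    obtain ⟨p, hp⟩ := hCj
    obtain ⟨r, s, hrs⟩ := exists_crossing p q (fun r => hCT _ (hp r)) (fun r => (hq r).1) h₁ h₂ hx
    exact (hq s).2 (hrs ▸ hp r)
  obtain ⟨R, hR⟩ : ∃ R : ℝ, ∀ z ∈ C, |z.1| ≤ R ∧ |z.2| ≤ R := by
    obtain ⟨R, hR⟩ := hC.isBounded.exists_norm_le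
    exact ⟨R, fun z hz => ⟨(norm_fst_le z).trans (hR z hz), (norm_snd_le z).trans (hR z hz)⟩⟩
  have hseg : ∀ {a b : ℝ × ℝ} (V : Set (ℝ × ℝ)), Convex ℝ V → a ∈ V → b ∈ V → V ⊆ W →
      JoinedIn W a b := fun {a b} V hV ha hb hVW =>
    ((hV.isPathConnected ⟨a, ha⟩).joinedIn a ha b hb).mono hVW
  have hvert : ∀ a : ℝ × ℝ, R < |a.1| → a.2 ≤ T → JoinedIn W a (a.1, T) := by
    intro a ha haT
    refine hseg ({a.1} ×ˢ Set.Iic T) ((convex_singleton _).prod (convex_Iic T)) ⟨rfl, haT⟩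
      ⟨rfl, Set.mem_Iic.2 le_rfl⟩ ?_
    rintro z ⟨hz1, hz2⟩
    refine ⟨hz2, fun hzC => ?_⟩
    have := (hR z hzC).1
    rw [Set.mem_singleton_iff.1 hz1] at this
    linarith
  have hend : ∀ x : ℝ, g₁ ≤ x ∧ x ≤ g₃ → |x| ≤ R := by
    intro x hx
    have e1 := (hR _ hCj.source_mem).1
    have e2 := (hR _ hCj.target_mem).1
    rw [abs_le] at e1 e2 ⊢
    constructor <;> simp only at e1 e2 <;> linarith [e1.1, e1.2, e2.1, e2.2, hx.1, hx.2]
  have hGb : ∀ z ∈ G, |z.1| ≤ R ∧ -R ≤ z.2 := by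
    intro z hz
    have hzT : z.2 < T := (hGO hz).1
    constructor
    · by_contra hcon
      exact hcon (hend _ (hescape z hz _ (hvert z (not_le.1 hcon) hzT.le)))
    · by_contra hcon
      have hhor : JoinedIn W z (R + 1, z.2) := by
        refine hseg (Set.univ ×ˢ {z.2}) (convex_univ.prod (convex_singleton _)) ⟨trivial, rfl⟩
          ⟨trivial, rfl⟩ ?_
        rintro y ⟨-, hy⟩
        rw [Set.mem_singleton_iff] at hy
        refine ⟨by rw [Set.mem_ofPred_eq, hy]; exact hzT.le, fun hyC => ?_⟩
        have := (abs_le.1 (hR y hyC).2).1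
        rw [hy] at this
        exact hcon this
      have := hend _ (hescape z hz _ (hhor.trans (hvert (R + 1, z.2)
        ((lt_add_one R).trans_le (le_abs_self _)) hzT.le)))
      linarith [le_abs_self (R + 1)]
  refine ⟨G, hGo, hDG, ?_, fun y hy => ⟨?_, fun hyT => ?_, fun hyT hyC => ?_⟩⟩
  · refine Bornology.IsBounded.isCompact_closure
      ((isCompact_Icc (a := ((-R, -R) : ℝ × ℝ)) (b := (R, T))).isBounded.subset ?_)
    intro z hz
    have := abs_le.1 (hGb z hz).1
    exact ⟨⟨this.1, (hGb z hz).2⟩, ⟨this.2, (hGO hz).1.le⟩⟩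
  · exact closure_minimal (fun z hz => (show z.2 < T from (hGO hz).1).le : G ⊆ {z | z.2 ≤ T})
      (isClosed_le continuous_snd continuous_const) hy
  · by_cases hyC : y ∈ C
    · rcases hCe y hyC hyT with h | h <;> rw [h] <;> constructor <;> linarith
    · obtain ⟨U, hU, hUj⟩ := hball y hyT hyC
      obtain ⟨z, hzU, hzG⟩ := mem_closure_iff_nhds.1 hy U hU
      have hyy : y = (y.1, T) := Prod.ext rfl hyT
      have := hUj z hzU (hGO hzG).1.le
      rw [hyy] at this
      exact hescape z hzG y.1 this
  · exact mem_connectedComponentIn_of_mem_closure (hDO hp₀) ⟨hyT, hyC⟩ hy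

end Trapped

namespace SlabSoliton

section Trapped

variable {κ σ w T g₁ g₂ g₃ : ℝ} {Ω C D G : Set (ℝ × ℝ)} {u : ℝ × ℝ → ℝ}
  {n : ℝ × ℝ → ℝ × ℝ × ℝ}

/-- In a trapped region, the maximum on the boundary of `Ω` of a function which is strictly
subharmonic for the drift Laplacian is attained at the top level. -/
lemma exists_le_top {e : ℝ × ℝ × ℝ} (H : SlabSoliton e w Ω u n) (hC : C ⊆ Ω) (hG : IsOpen G)
    (hGc : IsCompact (closure G))
    (hy : ∀ y ∈ closure G, y.2 ≤ T ∧
      (y.2 = T → g₁ ≤ y.1 ∧ y.1 ≤ g₃) ∧ (y.2 < T → y ∉ C → y ∈ G))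
    {L : List (ℝ × (ℝ × ℝ × ℝ))} {l : ℝ × ℝ × ℝ} (hL : ∀ a ∈ L, a.2.2.2 = 0) (hl : l.2.2 = 0)
    (hpos : ∀ q ∈ closure G, q ∈ closure Ω \ Ω → ∀ N, dot3 N N = 1 →
      0 < driftLap e N L l (q.1, q.2, 0))
    {s : ℝ × ℝ} (hs : s ∈ closure G) (hsΩ : s ∈ closure Ω \ Ω) :
    ∃ x, g₁ ≤ x ∧ x ≤ g₃ ∧ expSum L l (s.1, s.2, 0) ≤ expSum L l (x, T, 0) := by
  have hK : IsCompact (closure G ∩ (closure Ω \ Ω)) :=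
    hGc.inter_right (isClosed_closure.sdiff H.isOpen)
  have hf : Continuous fun p : ℝ × ℝ => expSum L l (p.1, p.2, 0) :=
    (continuous_expSum L l).comp (by fun_prop)
  obtain ⟨q, ⟨hqG, hqΩ⟩, hqmax⟩ := hK.exists_isMaxOn ⟨s, hs, hsΩ⟩ hf.continuousOn
  have hq := hy q hqG
  rcases hq.1.lt_or_eq with hqT | hqT
  · exfalso
    refine H.frontier_maximum_principle hL hl hqΩ (hpos q hqG hqΩ) ?_
    filter_upwards [hG.mem_nhds (hq.2.2 hqT fun h => hqΩ.2 (hC h))] with p hp hpΩ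
    exact hqmax ⟨subset_closure hp, hpΩ⟩
  · refine ⟨q.1, (hq.2.1 hqT).1, (hq.2.1 hqT).2, ?_⟩
    rw [← hqT]
    exact hqmax ⟨hs, hsΩ⟩

lemma cosh_sum_pos {κ N₁ N₂ E F : ℝ} (hκ : κ ≤ 1) (hN : N₁ ^ 2 + N₂ ^ 2 ≤ 1)
    (hE : 0 < E) (hF : 0 < F) (hEF : E < 3 * F) (hFE : F < 3 * E) :
    0 < E * (8 - (2 * N₁ - 2 * N₂) ^ 2 - 2 * κ) + F * (8 - (-2 * N₁ - 2 * N₂) ^ 2 - 2 * κ) := by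
  have h1 : N₁ * N₂ ≤ 1 / 2 := by nlinarith [sq_nonneg (N₁ - N₂)]
  have h2 : -(1 / 2) ≤ N₁ * N₂ := by nlinarith [sq_nonneg (N₁ + N₂)]
  have h3 : 0 ≤ (E + F) * (2 - 2 * κ + 4 * (1 - (N₁ ^ 2 + N₂ ^ 2))) :=
    mul_nonneg (by linarith) (by linarith)
  rcases le_total E F with h | h
  · have h4 : 0 ≤ (F - E) * (1 / 2 - N₁ * N₂) := mul_nonneg (by linarith) (by linarith)
    linarith only [h3, h4, hFE, hEF]
  · have h4 : 0 ≤ (E - F) * (1 / 2 + N₁ * N₂) := mul_nonneg (by linarith) (by linarith)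
    linarith only [h3, h4, hFE, hEF]

lemma trapped_false (H : SlabSoliton (0, κ, σ) w Ω u n) (hC : C ⊆ Ω) (hG : IsOpen G)
    (hGc : IsCompact (closure G))
    (hy : ∀ y ∈ closure G, y.2 ≤ T ∧
      (y.2 = T → g₁ ≤ y.1 ∧ y.1 ≤ g₃) ∧ (y.2 < T → y ∉ C → y ∈ G))
    (hg : g₃ - g₁ < 1 / 5) {s : ℝ × ℝ} (hs : s ∈ closure G) (hsΩ : s ∈ closure Ω \ Ω)
    (hsT : s.2 + 1 ≤ T) : False := by
  have hκσ : κ ^ 2 + σ ^ 2 = 1 := by have := H.dot_dir; simp [dot3] at this; linarith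
  have hκ1 : κ ≤ 1 := by nlinarith [sq_nonneg σ]
  have hunit : ∀ N : ℝ × ℝ × ℝ, dot3 N N = 1 → N.1 ^ 2 + N.2.1 ^ 2 ≤ 1 := by
    intro N hN
    simp only [dot3] at hN
    nlinarith [sq_nonneg N.2.2]
  rcases le_or_gt κ 0 with hκ | hκ
  · have key : ∀ ρ : ℝ, 0 < ρ → Real.exp (-s.2) ≤ Real.exp (-T) + ρ * Real.exp g₃ := by
      intro ρ hρ
      obtain ⟨x, -, hx, hle⟩ := H.exists_le_top hC hG hGc hy
        (L := [(1, (0, -1, 0)), (ρ, (1, 0, 0))]) (l := 0) (by simp) rfl (fun q _ _ N hN => by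
          have h1 := hunit N hN
          have h2 : N.1 ^ 2 < 1 ∨ N.2.1 ^ 2 < 1 := by
            by_contra! hcon; linarith [hcon.1, hcon.2]
          have h3 := Real.exp_pos (-q.2)
          have h4 : 0 < ρ * Real.exp q.1 := by positivity
          have e1 : driftLap (0, κ, σ) N [(1, (0, -1, 0)), (ρ, (1, 0, 0))] 0 (q.1, q.2, 0) =
              Real.exp (-q.2) * (1 - N.2.1 ^ 2) + Real.exp (-q.2) * (-κ) +
              ρ * Real.exp q.1 * (1 - N.1 ^ 2) := by
            simp [driftLap, dot3]; ring
          rw [e1]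
          have h5 : 0 ≤ Real.exp (-q.2) * (-κ) := mul_nonneg h3.le (by linarith)
          rcases h2 with h2 | h2
          · have h6 := mul_pos h4 (show 0 < 1 - N.1 ^ 2 by linarith)
            have h7 := mul_nonneg h3.le (show 0 ≤ 1 - N.2.1 ^ 2 by nlinarith [sq_nonneg N.1])
            linarith
          · have h6 := mul_pos h3 (show 0 < 1 - N.2.1 ^ 2 by linarith)
            have h7 := mul_nonneg h4.le (show 0 ≤ 1 - N.1 ^ 2 by nlinarith [sq_nonneg N.2.1])
            linarith) hs hsΩ
      have e2 : ∀ a b : ℝ, expSum [(1, (0, -1, 0)), (ρ, (1, 0, 0))] 0 (a, b, 0) =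
          Real.exp (-b) + ρ * Real.exp a := fun a b => by simp [expSum, dot3]
      rw [e2, e2] at hle
      have h8 : ρ * Real.exp x ≤ ρ * Real.exp g₃ :=
        mul_le_mul_of_nonneg_left (Real.exp_le_exp.2 hx) hρ.le
      have h9 : 0 < ρ * Real.exp s.1 := by positivity
      linarith
    have hlt : Real.exp (-T) < Real.exp (-s.2) := Real.exp_lt_exp.2 (by linarith)
    have := key ((Real.exp (-s.2) - Real.exp (-T)) / 2 * Real.exp (-g₃))
      (mul_pos (by linarith) (Real.exp_pos _))
    rw [mul_assoc, ← Real.exp_add, neg_add_cancel, Real.exp_zero] at this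
    linarith
  · have hx : ∀ y ∈ closure G, y ∈ closure Ω \ Ω → ∀ δ : ℝ, 0 < δ → ∀ r : ℝ, r ^ 2 = 1 →
        ∃ x, g₁ ≤ x ∧ x ≤ g₃ ∧ r * y.1 - δ * Real.exp (-(κ / 2) * y.2) ≤ r * x := by
      intro y hyG hyΩ δ hδ r hr
      obtain ⟨x, hx1, hx2, hle⟩ := H.exists_le_top hC hG hGc hy
        (L := [(-δ, (0, -(κ / 2), 0))]) (l := (r, 0, 0)) (by simp) rfl (fun q _ _ N hN => by
          have e1 : driftLap (0, κ, σ) N [(-δ, (0, -(κ / 2), 0))] (r, 0, 0) (q.1, q.2, 0) =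
              δ * Real.exp (-(κ / 2) * q.2) * (κ ^ 2 / 4 + κ ^ 2 / 4 * N.2.1 ^ 2) := by
            simp [driftLap, dot3]; ring
          rw [e1]
          positivity) hyG hyΩ
      have e2 : ∀ a b : ℝ, expSum [(-δ, (0, -(κ / 2), 0))] (r, 0, 0) (a, b, 0) =
          r * a - δ * Real.exp (-(κ / 2) * b) := fun a b => by simp [expSum, dot3]; ring
      rw [e2, e2] at hle
      refine ⟨x, hx1, hx2, hle.trans ?_⟩
      have : 0 < δ * Real.exp (-(κ / 2) * T) := by positivity
      linarith
    have hbox : ∀ y ∈ closure G, y ∈ closure Ω \ Ω → g₁ ≤ y.1 ∧ y.1 ≤ g₃ := by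
      intro y hyG hyΩ
      have hcancel : κ / 2 * y.2 + -(κ / 2) * y.2 = 0 := by ring
      constructor
      · by_contra! hcon
        obtain ⟨x, hx1, hx2, hle⟩ := hx y hyG hyΩ
          ((g₁ - y.1) / 2 * Real.exp (κ / 2 * y.2)) (mul_pos (by linarith) (Real.exp_pos _)) (-1)
          (by norm_num)
        rw [mul_assoc, ← Real.exp_add, hcancel, Real.exp_zero] at hle
        linarith
      · by_contra! hcon
        obtain ⟨x, hx1, hx2, hle⟩ := hx y hyG hyΩ
          ((y.1 - g₃) / 2 * Real.exp (κ / 2 * y.2)) (mul_pos (by linarith) (Real.exp_pos _)) 1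
          (by norm_num)
        rw [mul_assoc, ← Real.exp_add, hcancel, Real.exp_zero] at hle
        linarith
    have hexp1 : Real.exp 1 < 3 := by linarith [Real.exp_one_lt_d9]
    set x₀ := (g₁ + g₃) / 2 with hx₀
    set A := Real.exp (-(2 * x₀)) with hA
    set A' := Real.exp (2 * x₀) with hA'
    have e2 : ∀ a b : ℝ, expSum [(A, (2, -2, 0)), (A', (-2, -2, 0))] 0 (a, b, 0) =
        Real.exp (-2 * b + 2 * (a - x₀)) + Real.exp (-2 * b - 2 * (a - x₀)) := by
      intro a b
      simp only [expSum, dot3, hA, hA', List.map_cons, List.map_nil, List.sum_cons, List.sum_nil,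
        ← Real.exp_add]
      simp only [Prod.fst_zero, Prod.snd_zero]
      ring_nf
    obtain ⟨x, hx1, hx2, hle⟩ := H.exists_le_top hC hG hGc hy
      (L := [(A, (2, -2, 0)), (A', (-2, -2, 0))]) (l := 0) (by simp) rfl (fun q hqG hqΩ N hN => by
        have hb := hbox q hqG hqΩ
        have e1 : driftLap (0, κ, σ) N [(A, (2, -2, 0)), (A', (-2, -2, 0))] 0 (q.1, q.2, 0) =
            Real.exp (-2 * q.2 + 2 * (q.1 - x₀)) * (8 - (2 * N.1 - 2 * N.2.1) ^ 2 - 2 * κ) +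
            Real.exp (-2 * q.2 - 2 * (q.1 - x₀)) * (8 - (-2 * N.1 - 2 * N.2.1) ^ 2 - 2 * κ) := by
          simp only [driftLap, dot3, hA, hA', List.map_cons, List.map_nil, List.sum_cons,
            List.sum_nil, ← Real.exp_add]
          simp only [Prod.fst_zero, Prod.snd_zero]
          ring_nf
        rw [e1]
        refine cosh_sum_pos hκ1 (hunit N hN) (Real.exp_pos _) (Real.exp_pos _) ?_ ?_
        · have h1 : Real.exp (-2 * q.2 + 2 * (q.1 - x₀)) ≤
              Real.exp 1 * Real.exp (-2 * q.2 - 2 * (q.1 - x₀)) := by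
            rw [← Real.exp_add]; exact Real.exp_le_exp.2 (by linarith)
          nlinarith [Real.exp_pos (-2 * q.2 - 2 * (q.1 - x₀))]
        · have h1 : Real.exp (-2 * q.2 - 2 * (q.1 - x₀)) ≤
              Real.exp 1 * Real.exp (-2 * q.2 + 2 * (q.1 - x₀)) := by
            rw [← Real.exp_add]; exact Real.exp_le_exp.2 (by linarith)
          nlinarith [Real.exp_pos (-2 * q.2 + 2 * (q.1 - x₀))]) hs hsΩ
    rw [e2, e2] at hle
    have hb := hbox s hs hsΩ
    have h1 : Real.exp (-2 * T + 2 * (x - x₀)) < Real.exp (-2 * s.2 + 2 * (s.1 - x₀)) :=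
      Real.exp_lt_exp.2 (by linarith)
    have h2 : Real.exp (-2 * T - 2 * (x - x₀)) < Real.exp (-2 * s.2 - 2 * (s.1 - x₀)) :=
      Real.exp_lt_exp.2 (by linarith)
    linarith

/-- A connected set trapped between a thin arc and its chord stays away from low boundary points
of `Ω`. -/
lemma trapped_arc_false (H : SlabSoliton (0, κ, σ) w Ω u n) (hCΩ : C ⊆ Ω) (hDΩ : D ⊆ Ω)
    (h₁ : g₁ < g₂) (h₂ : g₂ < g₃) (hg : g₃ - g₁ < 1 / 5) (hC : IsCompact C)
    (hCT : ∀ z ∈ C, z.2 ≤ T) (hCe : ∀ z ∈ C, z.2 = T → z.1 = g₁ ∨ z.1 = g₃)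
    (hCj : JoinedIn C (g₁, T) (g₃, T)) (hD : IsPreconnected D) (hDT : ∀ z ∈ D, z.2 < T)
    (hDC : ∀ z ∈ D, z ∉ C) (hDg : (g₂, T) ∈ closure D) {s : ℝ × ℝ} (hs : s ∈ closure D)
    (hsΩ : s ∉ Ω) (hsT : s.2 + 1 ≤ T) : False := by
  obtain ⟨G, hG, hDG, hGc, hy⟩ := exists_trapped_component h₁ h₂ hC hCT hCe hCj hD hDT hDC hDg
  exact H.trapped_false hCΩ hG hGc hy hg (closure_mono hDG hs) ⟨closure_mono hDΩ hs, hsΩ⟩ hsT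

end Trapped

end SlabSoliton

namespace SlabSoliton

section Count

variable {κ σ w ε c : ℝ} {m : ℝ × ℝ × ℝ} {Ω : Set (ℝ × ℝ)} {u : ℝ × ℝ → ℝ}
  {n : ℝ × ℝ → ℝ × ℝ × ℝ}

lemma exists_connecting_sets (H : SlabSoliton (0, κ, σ) w Ω u n) {ι : Type*} [Finite ι]
    (r : ι → ℝ × ℝ) (hr : ∀ i, r i ∈ Ω) :
    ∃ (p₀ : ℝ × ℝ) (K : ι → Set (ℝ × ℝ)) (B : ℝ), (∀ i, IsCompact (K i)) ∧ (∀ i, K i ⊆ Ω) ∧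
      (∀ i, JoinedIn (K i) p₀ (r i)) ∧ ∀ i, ∀ z ∈ K i, z.2 ≤ B := by
  obtain ⟨p₀, hp₀⟩ := H.isConnected.nonempty
  have hpath := H.isOpen.isConnected_iff_isPathConnected.1 H.isConnected
  have h1 : ∀ i, JoinedIn Ω p₀ (r i) := fun i => hpath.joinedIn p₀ hp₀ _ (hr i)
  have h2 : ∀ i, ∃ R : ℝ, ∀ z ∈ Set.range (h1 i).somePath, z.2 ≤ R := fun i => by
    obtain ⟨R, hR⟩ := ((isCompact_range (h1 i).somePath.continuous).image
      continuous_snd).bddAbove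
    exact ⟨R, fun z hz => hR ⟨z, hz, rfl⟩⟩
  choose R hR using h2
  obtain ⟨B, hB⟩ := (Set.finite_range R).bddAbove
  refine ⟨p₀, fun i => Set.range (h1 i).somePath, B,
    fun i => isCompact_range (h1 i).somePath.continuous, fun i => ?_, fun i => ?_,
    fun i z hz => (hR i z hz).trans (hB ⟨i, rfl⟩)⟩
  · rintro _ ⟨t, rfl⟩
    exact (h1 i).somePath_mem t
  · exact ⟨(h1 i).somePath, fun t => ⟨t, rfl⟩⟩

lemma card_le_of_upward (H : SlabSoliton (0, κ, σ) w Ω u n) (hε : 0 < ε)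
    (hA : AreaProperty Ω u m ε) {ι : Type*} [Fintype ι] (r : ι → ℝ × ℝ)
    (hr : ∀ i, r i ∈ superlevel Ω u m (c + 1))
    (hdisj : Pairwise fun i j => Disjoint (connectedComponentIn (superlevel Ω u m c) (r i))
      (connectedComponentIn (superlevel Ω u m c) (r j)))
    (hup : ∀ i T, ∃ q ∈ connectedComponentIn (superlevel Ω u m (c + 1)) (r i), T < q.2) :
    (Fintype.card ι : ℝ) ≤ 2 * w / ε + 2 * (⌊20 * w⌋₊ + 1) := by
  classical
  obtain ⟨p₀, K, B, hKc, hKΩ, hKj, hKB⟩ := H.exists_connecting_sets r fun i => (hr i).1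
  have hw : 0 ≤ w := (abs_nonneg _).trans (H.abs_fst_le _ H.isConnected.nonempty.some_mem)
  have hmono : ∀ i, connectedComponentIn (superlevel Ω u m (c + 1)) (r i) ⊆
      connectedComponentIn (superlevel Ω u m c) (r i) := fun i =>
    connectedComponentIn_mono _ (superlevel_anti (by linarith))
  have harc : ∀ i, ∃ (Γ Γ' : Set (ℝ × ℝ)) (g : ℝ), IsCompact Γ ∧
      Γ ⊆ connectedComponentIn (superlevel Ω u m (c + 1)) (r i) ∧ (∀ z ∈ Γ, z.2 ≤ B + 5) ∧
      (∀ z ∈ Γ, z.2 = B + 5 → z = (g, B + 5)) ∧ JoinedIn Γ (r i) (g, B + 5) ∧ Γ' ⊆ Γ ∧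
      IsPreconnected Γ' ∧ (∀ z ∈ Γ', B < z.2 ∧ z.2 < B + 5) ∧ (g, B + 5) ∈ closure Γ' ∧
      ∀ t, B < t → t < B + 5 → ∃ x : ℝ, (x, t) ∈ Γ' := by
    intro i
    obtain ⟨q, hq, hqT⟩ := hup i (B + 5)
    have hpc : IsPathConnected (connectedComponentIn (superlevel Ω u m (c + 1)) (r i)) :=
      ((H.isOpen_superlevel m (c + 1)).connectedComponentIn.isConnected_iff_isPathConnected).1
        ⟨⟨q, hq⟩, isPreconnected_connectedComponentIn⟩
    exact exists_arc_of_joinedIn (hpc.joinedIn _ (mem_connectedComponentIn (hr i)) q hq)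
      (hKB i _ (hKj i).target_mem) (by linarith) hqT.le
  choose Γ Γ' g hΓc hΓD hΓT hΓe hΓj hΓ'Γ hΓ'p hΓ't hΓ'g hΓ'l using harc
  choose x hx using fun i => hΓ'l i (B + 1) (by linarith) (by linarith)
  set F := superlevel Ω u m c ∩ {p | B < p.2 ∧ p.2 < B + 5} with hF
  set D : ι → Set (ℝ × ℝ) := fun i => connectedComponentIn F (x i, B + 1) with hD
  have hΓΩ : ∀ i, Γ i ⊆ superlevel Ω u m (c + 1) := fun i =>
    (hΓD i).trans (connectedComponentIn_subset _ _)
  have hΓ'F : ∀ i, Γ' i ⊆ F := fun i z hz =>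
    ⟨superlevel_anti (by linarith) (hΓΩ i (hΓ'Γ i hz)), hΓ't i z hz⟩
  have hΓ'D : ∀ i, Γ' i ⊆ D i := fun i =>
    (hΓ'p i).subset_connectedComponentIn (hx i) (hΓ'F i)
  have hDF : ∀ i, D i ⊆ F := fun i => connectedComponentIn_subset _ _
  have hDD : ∀ i, D i ⊆ connectedComponentIn (superlevel Ω u m c) (r i) := by
    intro i
    rw [connectedComponentIn_eq (hmono i (hΓD i (hΓ'Γ i (hx i))))]
    exact isPreconnected_connectedComponentIn.subset_connectedComponentIn
      (mem_connectedComponentIn (hΓ'F i (hx i))) ((hDF i).trans Set.inter_subset_left)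
  have hcases := fun i => hA c B (B + 1) (B + 5) (x i, B + 1) (by linarith) (by linarith)
    (fun t h1 h2 => by
      obtain ⟨y, hy⟩ := hΓ'l i t (by linarith) (by linarith)
      exact ⟨y, hΓ'D i hy, (hΓΩ i (hΓ'Γ i hy)).2.le⟩)
  have hgmem : ∀ i, (g i, B + 5) ∈ Γ i := fun i => (hΓj i).target_mem
  have htrap : ∀ i j k : ι, g i < g k → g k < g j → g j - g i < 1 / 5 →
      (∃ s ∈ closure (D k), s ∉ Ω ∧ B + 1 ≤ s.2 ∧ s.2 ≤ B + 1 + 1) → False := by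
    rintro i j k h1 h2 h3 ⟨s, hs, hsΩ, -, hsT⟩
    have hik : i ≠ k := by rintro rfl; exact h1.false
    have hjk : j ≠ k := by rintro rfl; exact h2.false
    have hoff : ∀ l, l ≠ k → ∀ z ∈ D k, z ∉ Γ l := fun l hl z hz hzl =>
      Set.disjoint_left.1 (hdisj hl) (hmono l (hΓD l hzl)) (hDD k hz)
    refine H.trapped_arc_false (C := Γ i ∪ (K i ∪ (K j ∪ Γ j))) (D := D k) (T := B + 5) ?_
      (fun z hz => (hDF k hz).1.1) h1 h2 h3
      ((hΓc i).union ((hKc i).union ((hKc j).union (hΓc j)))) ?_ ?_ ?_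
      isPreconnected_connectedComponentIn (fun z hz => (hDF k hz).2.2) ?_
      (closure_mono (hΓ'D k) (hΓ'g k)) hs hsΩ (by linarith)
    · exact Set.union_subset (fun z hz => (hΓΩ i hz).1) (Set.union_subset (hKΩ i)
        (Set.union_subset (hKΩ j) fun z hz => (hΓΩ j hz).1))
    · rintro z (hz | hz | hz | hz)
      · exact hΓT i z hz
      · linarith [hKB i z hz]
      · linarith [hKB j z hz]
      · exact hΓT j z hz
    · rintro z (hz | hz | hz | hz) hzT
      · exact Or.inl (congrArg Prod.fst (hΓe i z hz hzT))
      · linarith [hKB i z hz]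
      · linarith [hKB j z hz]
      · exact Or.inr (congrArg Prod.fst (hΓe j z hz hzT))
    · refine ((hΓj i).symm.mono Set.subset_union_left).trans (JoinedIn.mono ?_
        Set.subset_union_right)
      refine ((hKj i).symm.mono Set.subset_union_left).trans (JoinedIn.mono ?_
        Set.subset_union_right)
      exact ((hKj j).mono Set.subset_union_left).trans ((hΓj j).mono Set.subset_union_right)
    · rintro z hz (h | h | h | h)
      · exact hoff i hik z hz h
      · linarith [hKB i z h, (hDF k hz).2.1]
      · linarith [hKB j z h, (hDF k hz).2.1]
      · exact hoff j hjk z hz h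
  have hgne : ∀ i j, i ≠ j → g i ≠ g j := fun i j hij h =>
    Set.disjoint_left.1 (hdisj hij) (hmono i (hΓD i (hgmem i)))
      (h ▸ hmono j (hΓD j (hgmem j)))
  have hgw : ∀ i, |g i| ≤ w := fun i => H.abs_fst_le _ (hΓΩ i (hgmem i)).1
  set J : Finset ι := Finset.univ.filter fun i =>
    ∃ s ∈ closure (D i), s ∉ Ω ∧ B + 1 ≤ s.2 ∧ s.2 ≤ B + 1 + 1 with hJ
  have hJcard : J.card ≤ (⌊20 * w⌋₊ + 1) * 2 := by
    by_contra! hcon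
    obtain ⟨y, -, hy⟩ := Finset.exists_lt_card_fiber_of_mul_lt_card_of_maps_to
      (f := fun i => ⌊(g i + w) * 10⌋₊) (t := Finset.range (⌊20 * w⌋₊ + 1)) (s := J) (n := 2)
      (fun i _ => by
        rw [Finset.mem_range, Nat.lt_succ_iff]
        exact Nat.floor_le_floor (by linarith [(abs_le.1 (hgw i)).2]))
      (by rwa [Finset.card_range])
    obtain ⟨i, hi, j, hj, k, hk, hij, hik, hjk⟩ := Finset.two_lt_card.1 hy
    simp only [Finset.mem_filter] at hi hj hk
    have hbox : ∀ i, ⌊(g i + w) * 10⌋₊ = y → (y : ℝ) ≤ (g i + w) * 10 ∧ (g i + w) * 10 < y + 1 :=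
      fun i hi => (Nat.floor_eq_iff (by linarith [(abs_le.1 (hgw i)).1])).1 hi
    have bi := hbox i hi.2
    have bj := hbox j hj.2
    have bk := hbox k hk.2
    have si := (Finset.mem_filter.1 hi.1).2
    have sj := (Finset.mem_filter.1 hj.1).2
    have sk := (Finset.mem_filter.1 hk.1).2
    rcases lt_or_gt_of_ne (hgne _ _ hij) with h1 | h1 <;>
      rcases lt_or_gt_of_ne (hgne _ _ hik) with h2 | h2 <;>
      rcases lt_or_gt_of_ne (hgne _ _ hjk) with h3 | h3
    · exact htrap i k j h1 h3 (by linarith) sj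
    · exact htrap i j k h2 h3 (by linarith) sk
    · linarith
    · exact htrap k j i h2 h1 (by linarith) si
    · exact htrap j k i h1 h2 (by linarith) si
    · linarith
    · exact htrap j i k h3 h2 (by linarith) sk
    · exact htrap k i j h3 h1 (by linarith) sj
  have hJc : ((Finset.univ \ J).card : ℝ) * ε ≤ 2 * w := by
    have hmeas : ∀ i, MeasurableSet (D i ∩ {p | B + 1 ≤ p.2 ∧ p.2 ≤ B + 1 + 1}) := fun i =>
      (((H.isOpen_superlevel m c).inter (isOpen_strip B (B + 5))).connectedComponentIn).measurableSet.inter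
        ((measurableSet_le measurable_const measurable_snd).inter
          (measurableSet_le measurable_snd measurable_const))
    have hsub : ⋃ i ∈ Finset.univ \ J, (D i ∩ {p | B + 1 ≤ p.2 ∧ p.2 ≤ B + 1 + 1}) ⊆
        Set.Icc (-w) w ×ˢ Set.Icc (B + 1) (B + 1 + 1) := by
      refine Set.iUnion₂_subset fun i _ z hz => ?_
      exact ⟨abs_le.1 (H.abs_fst_le z (hDF i hz.1).1.1), hz.2⟩
    have hfin : volume (Set.Icc (-w) w ×ˢ Set.Icc (B + 1) (B + 1 + 1)) ≠ ⊤ :=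
      (isCompact_Icc.prod isCompact_Icc).measure_lt_top.ne
    have hvol : volume.real (Set.Icc (-w) w ×ˢ Set.Icc (B + 1) (B + 1 + 1)) = 2 * w := by
      rw [measureReal_def, Measure.volume_eq_prod, Measure.prod_prod, ENNReal.toReal_mul,
        Real.volume_Icc, Real.volume_Icc, ENNReal.toReal_ofReal (by linarith),
        ENNReal.toReal_ofReal (by linarith)]
      ring
    have h1 := measureReal_mono hsub hfin
    rw [hvol, measureReal_biUnion_finset (fun i _ j _ hij => ?_) (fun i _ => hmeas i)
      (fun i _ => measure_ne_top_of_subset ((Set.subset_biUnion_of_mem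
        (u := fun i => D i ∩ {p | B + 1 ≤ p.2 ∧ p.2 ≤ B + 1 + 1})
        ‹i ∈ Finset.univ \ J›).trans hsub) hfin)] at h1
    · refine le_trans ?_ h1
      rw [← nsmul_eq_mul]
      refine Finset.card_nsmul_le_sum _ _ _ fun i hi => ?_
      refine (hcases i).resolve_left fun h => ?_
      exact (Finset.mem_sdiff.1 hi).2 (Finset.mem_filter.2 ⟨Finset.mem_univ _, h⟩)
    · exact (hdisj hij).mono (Set.inter_subset_left.trans (hDD i))
        (Set.inter_subset_left.trans (hDD j))
  have htot : Fintype.card ι = (Finset.univ \ J).card + J.card := by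
    rw [Finset.card_sdiff_add_card_eq_card (Finset.subset_univ J), Finset.card_univ]
  have h2 : ((Finset.univ \ J).card : ℝ) ≤ 2 * w / ε := by rwa [le_div_iff₀ hε]
  have h3 : (J.card : ℝ) ≤ (⌊20 * w⌋₊ + 1) * 2 := by exact_mod_cast hJcard
  rw [htot]
  push_cast
  linarith

end Count

end SlabSoliton

lemma finite_and_card_le {α : Type*} {M : ℕ} (h : ∀ k : ℕ, (Fin k ↪ α) → k ≤ M) :
    Finite α ∧ Nat.card α ≤ M := by
  have hfin : Finite α := by
    by_contra hinf
    rw [not_finite_iff_infinite] at hinf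
    have := h (M + 1) (Fin.valEmbedding.trans (Infinite.natEmbedding α))
    omega
  exact ⟨hfin, h _ (Finite.equivFin α).symm.toEmbedding⟩

namespace SlabSoliton

section Bound

variable {κ σ w ε : ℝ} {m : ℝ × ℝ × ℝ} {Ω : Set (ℝ × ℝ)} {u : ℝ × ℝ → ℝ}
  {n : ℝ × ℝ → ℝ × ℝ × ℝ}

lemma exists_card_bound (H : SlabSoliton (0, κ, σ) w Ω u n) (hem : dot3 (0, κ, σ) m = 0)
    (hm1 : m.1 = 0) (hmm : dot3 m m = 1) (hε : 0 < ε) (hA : AreaProperty Ω u m ε) :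
    ∃ M : ℕ, ∀ (c : ℝ) (k : ℕ) (r : Fin k → ℝ × ℝ), (∀ i, r i ∈ superlevel Ω u m c) →
      (Pairwise fun i j => Disjoint (connectedComponentIn (superlevel Ω u m c) (r i))
        (connectedComponentIn (superlevel Ω u m c) (r j))) → k ≤ M := by
  classical
  set b : ℝ := 2 * w / ε + 2 * (⌊20 * w⌋₊ + 1) with hb
  refine ⟨⌊2 * b⌋₊, fun c k r hr hdisj => Nat.le_floor ?_⟩
  choose r' hr'D hr'c using fun i => H.exists_lt_dot hem hm1 hmm (hr i) (c + 1)
  have hr' : ∀ i, r' i ∈ superlevel Ω u m (c + 1) := fun i =>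
    ⟨(connectedComponentIn_subset _ _ (hr'D i)).1, hr'c i⟩
  have hdisj' : Pairwise fun i j => Disjoint (connectedComponentIn (superlevel Ω u m c) (r' i))
      (connectedComponentIn (superlevel Ω u m c) (r' j)) := fun i j hij => by
    beta_reduce
    rw [← connectedComponentIn_eq (hr'D i), ← connectedComponentIn_eq (hr'D j)]
    exact hdisj hij
  set up : Fin k → Prop := fun i =>
    ∀ T, ∃ q ∈ connectedComponentIn (superlevel Ω u m (c + 1)) (r' i), T < q.2 with hup
  have hdown : ∀ i, ¬ up i →
      ∀ T, ∃ q ∈ connectedComponentIn (superlevel Ω u m (c + 1)) (r' i), T < -q.2 := by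
    intro i hi T
    simp only [hup] at hi
    push Not at hi
    obtain ⟨T', hT'⟩ := hi
    obtain ⟨q, hq, hqT⟩ := H.exists_lt_abs_snd hem hm1 hmm (hr' i) (max T T')
    have h1 := hT' q hq
    rcases lt_abs.1 hqT with h | h
    · linarith [le_max_right T T']
    · exact ⟨q, hq, (le_max_left T T').trans_lt h⟩
  have hcard1 : (Fintype.card {i // up i} : ℝ) ≤ b :=
    H.card_le_of_upward hε hA (fun i : {i // up i} => r' i.1) (fun i => hr' i.1)
      (fun i j hij => hdisj' fun h => hij (Subtype.ext h)) fun i => i.2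
  have hcard2 : (Fintype.card {i // ¬ up i} : ℝ) ≤ b := by
    have H' : SlabSoliton (0, -κ, -σ) w (reflSnd ⁻¹' Ω) (flipFun u)
      (fun p => neg23 (n (reflSnd p))) := H.flip
    refine H'.card_le_of_upward (c := c) hε hA.flip (fun i : {i // ¬ up i} => reflSnd (r' i.1))
      (fun i => ?_) (fun i j hij => ?_) fun i T => ?_
    · rw [superlevel_flip, Set.mem_preimage, reflSnd_reflSnd]
      exact hr' i.1
    · simp only [superlevel_flip, connectedComponentIn_reflSnd, reflSnd_reflSnd]
      exact (hdisj' fun h => hij (Subtype.ext h)).preimage _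
    · obtain ⟨q, hq, hqT⟩ := hdown i.1 i.2 T
      refine ⟨reflSnd q, ?_, hqT⟩
      rw [superlevel_flip, connectedComponentIn_reflSnd, Set.mem_preimage, reflSnd_reflSnd,
        reflSnd_reflSnd]
      exact hq
  have htot := Fintype.card_subtype_compl up
  have hle := Fintype.card_subtype_le up
  rw [Fintype.card_fin] at htot hle
  have : (k : ℝ) = Fintype.card {i // up i} + Fintype.card {i // ¬ up i} := by
    rw [htot]; push_cast [hle]; ring
  linarith

lemma exists_lt_dot_of_le (H : SlabSoliton (0, κ, σ) w Ω u n) (hem : dot3 (0, κ, σ) m = 0)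
    (hm1 : m.1 = 0) (hmm : dot3 m m = 1) {c : ℝ} {M : ℕ}
    (hM : ∀ (k : ℕ) (r : Fin k → ℝ × ℝ), (∀ i, r i ∈ superlevel Ω u m c) →
      (Pairwise fun i j => Disjoint (connectedComponentIn (superlevel Ω u m c) (r i))
        (connectedComponentIn (superlevel Ω u m c) (r j))) → k ≤ M)
    {p₀ : ℝ × ℝ} (hp₀ : p₀ ∈ {p ∈ Ω | c ≤ dot3 m (graph3 u p)}) (T : ℝ) :
    ∃ p ∈ connectedComponentIn {p ∈ Ω | c ≤ dot3 m (graph3 u p)} p₀,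
      c < dot3 m (graph3 u p) ∧ T < dot3 m (graph3 u p) := by
  set A := {p ∈ Ω | c ≤ dot3 m (graph3 u p)} with hAdef
  set G := superlevel Ω u m c with hG
  have hGA : G ⊆ A := fun p hp => ⟨hp.1, hp.2.le⟩
  suffices h : ∃ p ∈ connectedComponentIn A p₀, c < dot3 m (graph3 u p) by
    obtain ⟨p, hp, hpc⟩ := h
    have hpG : p ∈ G := ⟨(connectedComponentIn_subset _ _ hp).1, hpc⟩
    obtain ⟨q, hq, hqT⟩ := H.exists_lt_dot hem hm1 hmm hpG T
    refine ⟨q, ?_, (connectedComponentIn_subset _ _ hq).2, hqT⟩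
    rw [connectedComponentIn_eq hp]
    exact connectedComponentIn_mono _ hGA hq
  by_contra! hcon
  set 𝒞 : Set (Set (ℝ × ℝ)) := (fun p => connectedComponentIn G p) '' G with h𝒞
  have hfin : 𝒞.Finite := by
    refine Set.finite_coe_iff.1 (finite_and_card_le (M := M) fun k f => ?_).1
    choose r hr hrf using fun i => (f i).2
    refine hM k r hr fun i j hij => ?_
    by_contra hnd
    refine hij (f.injective (Subtype.ext ?_))
    rw [← hrf i, ← hrf j]
    obtain ⟨z, hz1, hz2⟩ := Set.not_disjoint_iff.1 hnd
    exact (connectedComponentIn_eq hz1).trans (connectedComponentIn_eq hz2).symm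
  refine H.component_not_subset hem hm1 hmm hp₀.1
    (le_antisymm (hcon _ (mem_connectedComponentIn hp₀)) hp₀.2)
    (V := (closure G)ᶜ) isClosed_closure.isOpen_compl
    (fun p hp hpΩ => not_lt.1 fun h => hp (subset_closure ⟨hpΩ, h⟩)) fun q hq hqG => ?_
  have hun : G = ⋃ C ∈ 𝒞, C := by
    refine Set.Subset.antisymm (fun p hp => Set.mem_biUnion ⟨p, hp, rfl⟩
      (mem_connectedComponentIn hp)) (Set.iUnion₂_subset ?_)
    rintro _ ⟨p, -, rfl⟩
    exact connectedComponentIn_subset _ _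
  rw [hun, hfin.closure_biUnion, Set.mem_iUnion₂] at hqG
  obtain ⟨_, ⟨p, hp, rfl⟩, hqp⟩ := hqG
  have h1 : q ∈ connectedComponentIn A p :=
    mem_connectedComponentIn_of_mem_closure (hGA hp) (connectedComponentIn_subset _ _ hq)
      (closure_mono (connectedComponentIn_mono _ hGA) hqp)
  have h2 : p ∈ connectedComponentIn A p₀ := by
    rw [connectedComponentIn_eq hq, ← connectedComponentIn_eq h1]
    exact mem_connectedComponentIn (hGA hp)
  exact not_lt.2 (hcon p h2) hp.2

end Bound

end SlabSoliton

/-- If every component of every set of a decreasing family meets all the later sets, and the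
numbers of components are bounded, then the numbers of components are eventually constant. -/
lemma exists_card_connectedComponents_eq {X : Type*} [TopologicalSpace X] {A : ℝ → Set X} {M : ℕ}
    (hanti : Antitone A) (hne : ∀ c, (A c).Nonempty)
    (hmeet : ∀ c, ∀ p ∈ A c, ∀ c', ∃ q ∈ connectedComponentIn (A c) p, q ∈ A c')
    (hM : ∀ c, Finite (ConnectedComponents (A c)) ∧ Nat.card (ConnectedComponents (A c)) ≤ M) :
    ∃ (t₀ : ℝ) (k : ℕ), 0 < k ∧
      ∀ t, t₀ ≤ t → Cardinal.mk (ConnectedComponents (A t)) = (k : Cardinal) := by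
  have hfin : ∀ c, Finite (ConnectedComponents (A c)) := fun c => (hM c).1
  have hmono : Monotone fun c => Nat.card (ConnectedComponents (A c)) := by
    intro c c' hcc
    have hcont : Continuous (Set.inclusion (hanti hcc)) := continuous_inclusion _
    refine Nat.card_le_card_of_surjective hcont.connectedComponentsMap fun x => ?_
    obtain ⟨x, rfl⟩ := ConnectedComponents.surjective_coe x
    obtain ⟨q, hq, hqc⟩ := hmeet c x.1 x.2 c'
    rw [connectedComponentIn_eq_image x.2] at hq
    obtain ⟨y, hy, rfl⟩ := hq
    exact ⟨((⟨y.1, hqc⟩ : A c') : ConnectedComponents (A c')),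
      ConnectedComponents.coe_eq_coe'.2 hy⟩
  set s := Set.range fun c => Nat.card (ConnectedComponents (A c)) with hs
  have hbdd : BddAbove s := ⟨M, by rintro _ ⟨c, rfl⟩; exact (hM c).2⟩
  obtain ⟨t₀, ht₀⟩ : sSup s ∈ s := Nat.sSup_mem (Set.range_nonempty _) hbdd
  refine ⟨t₀, sSup s, ?_, fun t ht => ?_⟩
  · rw [← ht₀]
    have : Nonempty (ConnectedComponents (A t₀)) :=
      (hne t₀).to_subtype.map ((↑) : A t₀ → ConnectedComponents (A t₀))
    exact Nat.card_pos
  · rw [← Nat.cast_card]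
    exact congrArg _ (le_antisymm (le_csSup hbdd ⟨t, rfl⟩) (ht₀ ▸ hmono ht))

namespace SlabSoliton

lemma exists_wing_number {κ σ w ε : ℝ} {m : ℝ × ℝ × ℝ} {Ω : Set (ℝ × ℝ)} {u : ℝ × ℝ → ℝ}
    {n : ℝ × ℝ → ℝ × ℝ × ℝ} (H : SlabSoliton (0, κ, σ) w Ω u n) (hem : dot3 (0, κ, σ) m = 0)
    (hm1 : m.1 = 0) (hmm : dot3 m m = 1) (hε : 0 < ε) (hA : AreaProperty Ω u m ε) :
    ∃ (t₀ : ℝ) (k : ℕ), 0 < k ∧ ∀ t, t₀ ≤ t →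
      Cardinal.mk (ConnectedComponents {p ∈ Ω | t ≤ dot3 m (graph3 u p)}) = (k : Cardinal) := by
  obtain ⟨M, hM⟩ := H.exists_card_bound hem hm1 hmm hε hA
  have hmeet := fun c => fun p hp => H.exists_lt_dot_of_le hem hm1 hmm (hM c) (p₀ := p) hp
  refine exists_card_connectedComponents_eq (M := M)
    (A := fun t => {p ∈ Ω | t ≤ dot3 m (graph3 u p)}) (fun c c' h p hp => ⟨hp.1, h.trans hp.2⟩)
    (fun c => ?_) (fun c p hp c' => ?_) fun c => finite_and_card_le fun k f => ?_
  · obtain ⟨p, hp⟩ := H.isConnected.nonempty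
    obtain ⟨q, hq, -, hqc⟩ := hmeet (dot3 m (graph3 u p)) p ⟨hp, le_rfl⟩ c
    exact ⟨q, (connectedComponentIn_subset _ _ hq).1, hqc.le⟩
  · obtain ⟨q, hq, -, hqc⟩ := hmeet c p hp c'
    exact ⟨q, hq, (connectedComponentIn_subset _ _ hq).1, hqc.le⟩
  · set A := {p ∈ Ω | c ≤ dot3 m (graph3 u p)} with hAdef
    have h1 : ∀ i, ∃ x : A, (x : ConnectedComponents A) = f i ∧ c < dot3 m (graph3 u x.1) := by
      intro i
      obtain ⟨x, hx⟩ := ConnectedComponents.surjective_coe (f i)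
      obtain ⟨q, hq, hqc, -⟩ := hmeet c x.1 x.2 0
      rw [connectedComponentIn_eq_image x.2] at hq
      obtain ⟨y, hy, rfl⟩ := hq
      exact ⟨y, (ConnectedComponents.coe_eq_coe'.2 hy).trans hx, hqc⟩
    choose x hx hxc using h1
    refine hM c k (fun i => (x i).1) (fun i => ⟨(x i).2.1, hxc i⟩) fun i j hij => ?_
    have hGA : superlevel Ω u m c ⊆ A := fun p hp => ⟨hp.1, hp.2.le⟩
    refine Set.disjoint_left.2 fun z hz1 hz2 => hij (f.injective ?_)
    have hz : connectedComponentIn A (x i).1 = connectedComponentIn A (x j).1 :=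
      (connectedComponentIn_eq (connectedComponentIn_mono _ hGA hz1)).trans
        (connectedComponentIn_eq (connectedComponentIn_mono _ hGA hz2)).symm
    have h2 : (x i).1 ∈ connectedComponentIn A (x j).1 :=
      hz ▸ mem_connectedComponentIn (x i).2
    rw [connectedComponentIn_eq_image (x j).2] at h2
    obtain ⟨y, hy, hyx⟩ := h2
    rw [← hx i, ← hx j, ← Subtype.ext hyx]
    exact ConnectedComponents.coe_eq_coe'.2 hy

end SlabSoliton

section Assembly

variable {θ w : ℝ} {Ω : Set (ℝ × ℝ)} {u : ℝ × ℝ → ℝ} {S : Set E3}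

lemma graphPtθ_zero (θ : ℝ) (u : ℝ × ℝ → ℝ) (p : ℝ × ℝ) : graphPtθ θ u p 0 = p.1 := by
  simp [graphPtθ, e1, e2, e3, vθ, bθ]

lemma graphPtθ_one (θ : ℝ) (u : ℝ × ℝ → ℝ) (p : ℝ × ℝ) :
    graphPtθ θ u p 1 = Real.cos θ * u p - Real.sin θ * p.2 := by
  simp [graphPtθ, e1, e2, e3, vθ, bθ]; ring

lemma graphPtθ_two (θ : ℝ) (u : ℝ × ℝ → ℝ) (p : ℝ × ℝ) :
    graphPtθ θ u p 2 = Real.sin θ * u p + Real.cos θ * p.2 := by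
  simp [graphPtθ, e1, e2, e3, vθ, bθ]; ring

/-- The coordinates of a point of `ℝ³` in the plane spanned by `e₁` and `b_θ`. -/
def planeCoord (θ : ℝ) (q : E3) : ℝ × ℝ := (q 0, Real.cos θ * q 2 - Real.sin θ * q 1)

lemma planeCoord_graphPtθ (θ : ℝ) (u : ℝ × ℝ → ℝ) (p : ℝ × ℝ) :
    planeCoord θ (graphPtθ θ u p) = p := by
  refine Prod.ext (graphPtθ_zero θ u p) ?_
  simp only [planeCoord, graphPtθ_one, graphPtθ_two]
  linear_combination p.2 * Real.sin_sq_add_cos_sq θ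

lemma continuous_planeCoord (θ : ℝ) : Continuous (planeCoord θ) := by
  unfold planeCoord; fun_prop

lemma nonempty_homeomorph_graph {A : Set (ℝ × ℝ)} {B : Set E3} (hu : ContinuousOn u A)
    (hAB : ∀ p ∈ A, graphPtθ θ u p ∈ B) (hBA : ∀ q ∈ B, ∃ p ∈ A, q = graphPtθ θ u p) :
    Nonempty (A ≃ₜ B) := by
  have hinv : ∀ q ∈ B, planeCoord θ q ∈ A ∧ graphPtθ θ u (planeCoord θ q) = q := fun q hq => by
    obtain ⟨p, hp, rfl⟩ := hBA q hq
    rw [planeCoord_graphPtθ]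
    exact ⟨hp, rfl⟩
  have h : Continuous fun p : A => u p := continuousOn_iff_continuous_domRestrict.1 hu
  have h1 : Continuous fun p : A => p.1.1 := continuous_fst.comp continuous_subtype_val
  have h2 : Continuous fun p : A => p.1.2 := continuous_snd.comp continuous_subtype_val
  exact ⟨{
    toFun := fun p => ⟨graphPtθ θ u p, hAB p p.2⟩
    invFun := fun q => ⟨planeCoord θ q, (hinv q q.2).1⟩
    left_inv := fun p => Subtype.ext (planeCoord_graphPtθ θ u p)
    right_inv := fun q => Subtype.ext (hinv q q.2).2
    continuous_toFun := (((h1.smul continuous_const).add (h2.smul continuous_const)).add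
      (h.smul continuous_const)).subtype_mk _
    continuous_invFun := ((continuous_planeCoord θ).comp continuous_subtype_val).subtype_mk _ }⟩

lemma mk_connectedComponents_congr {X Y : Type} [TopologicalSpace X] [TopologicalSpace Y]
    (f : X ≃ₜ Y) : Cardinal.mk (ConnectedComponents X) = Cardinal.mk (ConnectedComponents Y) := by
  refine le_antisymm (Cardinal.mk_le_of_surjective (f := f.symm.continuous.connectedComponentsMap) ?_)
    (Cardinal.mk_le_of_surjective (f := f.continuous.connectedComponentsMap) ?_)
  · intro x
    obtain ⟨x, rfl⟩ := ConnectedComponents.surjective_coe x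
    exact ⟨(f x : ConnectedComponents Y), congrArg _ (f.symm_apply_apply x)⟩
  · intro x
    obtain ⟨x, rfl⟩ := ConnectedComponents.surjective_coe x
    exact ⟨(f.symm x : ConnectedComponents X), congrArg _ (f.apply_symm_apply x)⟩

lemma inner_e3_e1 : ⟪e3, e1⟫ = 0 := by
  simp [e1, e3, PiLp.inner_apply]

lemma inner_e3_vθ (θ : ℝ) : ⟪e3, vθ θ⟫ = Real.sin θ := by
  simp [e2, e3, vθ, PiLp.inner_apply]

lemma inner_e3_bθ (θ : ℝ) : ⟪e3, bθ θ⟫ = Real.cos θ := by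
  simp [e2, e3, bθ, PiLp.inner_apply]

lemma IsTranslatingGraph.translatorEq (h : IsTranslatingGraph e1 (bθ θ) (vθ θ) Ω u S) {p : ℝ × ℝ}
    (hp : p ∈ Ω) : TranslatorEq (Real.cos θ) (Real.sin θ) u p := by
  have := h.pde p hp
  rw [inner_e3_e1, inner_e3_vθ, inner_e3_bθ] at this
  unfold TranslatorEq
  rw [gradW_sq]
  linear_combination this

lemma IsTranslatingGraph.slabSoliton (h : IsTranslatingGraph e1 (bθ θ) (vθ θ) Ω u S)
    (hS : IsClosed S) (hw : S ⊆ {q : E3 | |q 0| ≤ w}) :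
    SlabSoliton (0, Real.cos θ, Real.sin θ) w Ω u (graphNormal u) where
  isOpen := h.isOpen_dom
  isConnected := h.isConnected_dom
  abs_fst_le p hp := by
    have hq : graphPtθ θ u p ∈ S := h.graph_eq ▸ ⟨p, hp, rfl⟩
    have := hw hq
    rwa [Set.mem_ofPred_eq, graphPtθ_zero] at this
  continuousOn := h.smooth.continuousOn
  isClosed := by
    have hc : Continuous fun P : ℝ × ℝ × ℝ => P.1 • e1 + P.2.1 • bθ θ + P.2.2 • vθ θ := by fun_prop
    convert hS.preimage hc using 1
    ext P
    have e0 := graphPtθ_zero θ (fun _ => P.2.2) (P.1, P.2.1)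
    constructor
    · rintro ⟨h1, h2⟩
      rw [Set.mem_preimage, h.graph_eq]
      exact ⟨_, h1, by rw [h2]⟩
    · intro hP
      rw [Set.mem_preimage, h.graph_eq] at hP
      obtain ⟨p, hp, hq⟩ := hP
      change graphPtθ θ (fun _ => P.2.2) (P.1, P.2.1) = graphPtθ θ u p at hq
      have h1 : (P.1, P.2.1) = p := by
        rw [← planeCoord_graphPtθ θ (fun _ => P.2.2) (P.1, P.2.1), hq, planeCoord_graphPtθ]
      have h2 := congrArg (fun q : E3 => q 1) hq
      have h3 := congrArg (fun q : E3 => q 2) hq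
      simp only [graphPtθ_one, graphPtθ_two, ← h1] at h2 h3
      refine ⟨h1 ▸ hp, ?_⟩
      linear_combination (-Real.cos θ) * h2 - Real.sin θ * h3 +
        (P.2.2 - u (P.1, P.2.1)) * Real.sin_sq_add_cos_sq θ
  fst_dir := rfl
  dot_dir := by
    simp only [dot3]
    linear_combination Real.sin_sq_add_cos_sq θ
  dot_normal p _ := dot3_graphNormal u p
  max_le L l p hp hmax := driftLap_nonpos_of_isLocalMax h.isOpen_dom h.smooth hp (h.translatorEq hp) hmax

lemma IsTranslatingGraph.exists_wing_number (h : IsTranslatingGraph e1 (bθ θ) (vθ θ) Ω u S)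
    (hS : IsClosed S) (hw : S ⊆ {q : E3 | |q 0| ≤ w}) {r : ℝ} (hr : r ^ 2 = 1) :
    ∃ (t₀ : ℝ) (k : ℕ), 0 < k ∧ ∀ t, t₀ ≤ t →
      numComponents (S ∩ {q : E3 | t ≤ r * q 1}) = (k : Cardinal) := by
  have H := h.slabSoliton hS hw
  have hr1 : |r| = 1 := by rw [← Real.sqrt_sq_eq_abs, hr, Real.sqrt_one]
  have hsin : |-(r * Real.sin θ)| ≤ 1 := by
    rw [abs_neg, abs_mul, hr1, one_mul]; exact Real.abs_sin_le_one θ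
  have hcos : |r * Real.cos θ| ≤ 1 := by
    rw [abs_mul, hr1, one_mul]; exact Real.abs_cos_le_one θ
  obtain ⟨ε, hε, hA⟩ := H.exists_areaProperty h.smooth (fun p hp => h.translatorEq hp)
    (Real.abs_cos_le_one θ) (Real.abs_sin_le_one θ) hsin hcos
  obtain ⟨t₀, k, hk, hkt⟩ := H.exists_wing_number (by simp only [dot3]; ring) rfl
    (by simp only [dot3]; linear_combination hr + r ^ 2 * Real.sin_sq_add_cos_sq θ) hε hA
  have hY : ∀ p, dot3 (0, -(r * Real.sin θ), r * Real.cos θ) (graph3 u p) =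
      r * graphPtθ θ u p 1 := fun p => by
    rw [graphPtθ_one]; simp only [dot3, graph3]; ring
  refine ⟨t₀, k, hk, fun t ht => ?_⟩
  rw [numComponents, ← hkt t ht]
  obtain ⟨f⟩ := nonempty_homeomorph_graph (θ := θ) (u := u)
    (A := {p ∈ Ω | t ≤ dot3 (0, -(r * Real.sin θ), r * Real.cos θ) (graph3 u p)})
    (B := S ∩ {q : E3 | t ≤ r * q 1}) (h.smooth.continuousOn.mono fun p hp => hp.1)
    (fun p hp => ⟨h.graph_eq ▸ ⟨p, hp.1, rfl⟩, hp.2.trans (hY p).le⟩) fun q hq => by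
      obtain ⟨hq, hqt⟩ := hq
      rw [h.graph_eq] at hq
      obtain ⟨p, hp, rfl⟩ := hq
      exact ⟨p, ⟨hp, by rw [hY]; exact hqt⟩, rfl⟩
  exact (mk_connectedComponents_congr f).symm

end Assembly

/-- well-defined wing numbers — for a complete connected translating graph in a
direction `v_θ` contained in a slab, there are `t₀ > 0` and positive integers `ω⁺, ω⁻` counting
the connected components of `Σ ∩ {y ≥ t}` and `Σ ∩ {y ≤ −t}` for all `t ≥ t₀`. -/
theorem stmt5 (θ : ℝ) (hθ : θ ∈ Set.Ico 0 π) (Ω : Set (ℝ × ℝ)) (u : ℝ × ℝ → ℝ) (S : Set E3)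
    (hgraph : IsTranslatingGraph e1 (bθ θ) (vθ θ) Ω u S) (hcomplete : IsClosed S)
    (w : ℝ) (hw : 0 < w) (hslab : S ⊆ {q : E3 | |q 0| ≤ w}) :
    ∃ t₀ : ℝ, 0 < t₀ ∧ ∃ ωp ωm : ℕ, 0 < ωp ∧ 0 < ωm ∧
      ∀ t : ℝ, t₀ ≤ t →
        numComponents (S ∩ {q : E3 | t ≤ q 1}) = (ωp : Cardinal) ∧
        numComponents (S ∩ {q : E3 | q 1 ≤ -t}) = (ωm : Cardinal) := by
  obtain ⟨t₁, k₁, hk₁, h₁⟩ := hgraph.exists_wing_number hcomplete hslab (r := 1) (by norm_num)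
  obtain ⟨t₂, k₂, hk₂, h₂⟩ := hgraph.exists_wing_number hcomplete hslab (r := -1) (by norm_num)
  refine ⟨max 1 (max t₁ t₂), by positivity, k₁, k₂, hk₁, hk₂, fun t ht => ⟨?_, ?_⟩⟩
  · simpa only [one_mul] using h₁ t ((le_max_left _ _).trans ((le_max_right _ _).trans ht))
  · simpa only [neg_one_mul, le_neg] using
      h₂ t ((le_max_right _ _).trans ((le_max_right _ _).trans ht))
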